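/- Let Γ be a torsion-free discrete subgroup of PSL(2,ℂ) of finite covolume, and let P be a maximal parabolic subgroup of Γ. Then P is conjugacy distinguished in Γ: whenever γ ∈ Γ is not conjugate in Γ to any element of P, there exist a finite group F and a homomorphism φ : Γ → F such that φ(γ) is not conjugate in F to any element of φ(P). -/

import Mathlib

set_option synthInstance.maxHeartbeats 400000
set_option maxHeartbeats 800000

open Matrix MeasureTheory

/-- The special linear group `SL(2, ℂ)`, topologized as a subspace of the matrices. -/
abbrev SL2C := Matrix.SpecialLinearGroup (Fin 2) ℂ

noncomputable instance : TopologicalSpace SL2C := instTopologicalSpaceSubtype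

/-- `PSL(2, ℂ)`: the quotient of `SL(2, ℂ)` by its center `{±I}`. -/
abbrev PSL2C := SL2C ⧸ Subgroup.center SL2C

noncomputable instance : MeasurableSpace PSL2C := borel _

/-- A subset `X` of a group `G` is separable (closed in the profinite topology) if for
every `γ ∈ G − X` there is a homomorphism `φ` from `G` to a finite group with
`φ γ ∉ φ '' X`. -/
def IsSeparableSubset {G : Type} [Group G] (X : Set G) : Prop :=
  ∀ γ : G, γ ∉ X → ∃ (F : Type) (_ : Group F) (_ : Finite F) (φ : G →* F), φ γ ∉ φ '' X

/-- A subgroup `Γ ≤ PSL(2, ℂ)` has finite covolume if, with respect to a Haar measure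
`μ` on `PSL(2, ℂ)`, the action of `Γ` on `PSL(2, ℂ)` admits a fundamental domain of
finite measure (equivalently, the quotient carries an induced invariant measure of
finite total mass). -/
def HasFiniteCovolume (Γ : Subgroup PSL2C) : Prop :=
  ∃ μ : Measure PSL2C, μ.IsHaarMeasure ∧
    ∃ s : Set PSL2C, IsFundamentalDomain (↥Γ) s μ ∧ μ s ≠ ⊤

/-- A non-identity element of `PSL(2, ℂ)` is parabolic if its representatives in
`SL(2, ℂ)` have trace `±2`. -/
def IsParabolic (x : PSL2C) : Prop :=
  x ≠ 1 ∧ ∃ A : SL2C, (QuotientGroup.mk A : PSL2C) = x ∧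
    (Matrix.trace (A : Matrix (Fin 2) (Fin 2) ℂ) = 2 ∨
     Matrix.trace (A : Matrix (Fin 2) (Fin 2) ℂ) = -2)

/-- An element of `PSL(2, ℂ)` is loxodromic if the square of the trace of a
representative in `SL(2, ℂ)` is not a real number in the interval `[0, 4]`. -/
def IsLoxodromic (x : PSL2C) : Prop :=
  ∃ A : SL2C, (QuotientGroup.mk A : PSL2C) = x ∧
    ∀ r : ℝ, 0 ≤ r → r ≤ 4 → (Matrix.trace (A : Matrix (Fin 2) (Fin 2) ℂ)) ^ 2 ≠ (r : ℂ)

/-- A maximal parabolic subgroup of `Γ ≤ PSL(2, ℂ)`: a subgroup all of whose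
non-identity elements are parabolic, maximal among such subgroups of `Γ`. -/
def IsMaxParabolicSubgroup (Γ : Subgroup PSL2C) (P : Subgroup ↥Γ) : Prop :=
  (∀ x ∈ P, x ≠ 1 → IsParabolic (x : PSL2C)) ∧
  ∀ P' : Subgroup ↥Γ, (∀ x ∈ P', x ≠ 1 → IsParabolic (x : PSL2C)) → P ≤ P' → P' = P

/-- A maximal cyclic parabolic subgroup of `Γ ≤ PSL(2, ℂ)`: a cyclic subgroup
consisting of parabolic elements (and the identity), maximal among cyclic
subgroups of `Γ`. -/
def IsMaxCyclicParabolicSubgroup (Γ : Subgroup PSL2C) (P : Subgroup ↥Γ) : Prop :=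
  (∃ x : ↥Γ, P = Subgroup.zpowers x) ∧
  (∀ x ∈ P, x ≠ 1 → IsParabolic (x : PSL2C)) ∧
  ∀ P' : Subgroup ↥Γ, (∃ y : ↥Γ, P' = Subgroup.zpowers y) → P ≤ P' → P' = P

/-- A loxodromic subgroup of `Γ ≤ PSL(2, ℂ)`: an infinite cyclic subgroup generated
by a loxodromic element. -/
def IsLoxodromicSubgroup (Γ : Subgroup PSL2C) (H : Subgroup ↥Γ) : Prop :=
  ∃ x : ↥Γ, IsLoxodromic (x : PSL2C) ∧ ¬IsOfFinOrder x ∧ H = Subgroup.zpowers x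

namespace Matrix

/-- The Hilbert–Schmidt norm of a complex `2 × 2` matrix. -/
noncomputable def hs (A : Matrix (Fin 2) (Fin 2) ℂ) : ℝ :=
  √(‖A 0 0‖ ^ 2 + ‖A 0 1‖ ^ 2 + ‖A 1 0‖ ^ 2 + ‖A 1 1‖ ^ 2)

/-- The Euclidean norm of a vector in `ℂ²`. -/
noncomputable def euc (v : Fin 2 → ℂ) : ℝ := √(‖v 0‖ ^ 2 + ‖v 1‖ ^ 2)

/-- The square-zero matrix `v (J v)ᵀ` attached to a vector `v ∈ ℂ²`. -/
def nilp (v : Fin 2 → ℂ) : Matrix (Fin 2) (Fin 2) ℂ :=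
  !![-(v 0 * v 1), v 0 ^ 2; -(v 1 ^ 2), v 0 * v 1]

lemma hs_nonneg (A : Matrix (Fin 2) (Fin 2) ℂ) : 0 ≤ hs A := Real.sqrt_nonneg _

lemma hs_sq (A : Matrix (Fin 2) (Fin 2) ℂ) :
    hs A ^ 2 = ‖A 0 0‖ ^ 2 + ‖A 0 1‖ ^ 2 + ‖A 1 0‖ ^ 2 + ‖A 1 1‖ ^ 2 :=
  Real.sq_sqrt (by positivity)

lemma euc_nonneg (v : Fin 2 → ℂ) : 0 ≤ euc v := Real.sqrt_nonneg _

lemma euc_sq (v : Fin 2 → ℂ) : euc v ^ 2 = ‖v 0‖ ^ 2 + ‖v 1‖ ^ 2 :=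
  Real.sq_sqrt (by positivity)

lemma hs_eq_frobenius (A : Matrix (Fin 2) (Fin 2) ℂ) :
    hs A = (frobeniusNormedAddCommGroup (m := Fin 2) (n := Fin 2) (α := ℂ)).norm A := by
  let _ := frobeniusNormedAddCommGroup (m := Fin 2) (n := Fin 2) (α := ℂ)
  change _ = ‖A‖
  rw [frobenius_norm_def, hs, Real.sqrt_eq_rpow]
  simp [Fin.sum_univ_two, add_assoc]

lemma hs_add (A B : Matrix (Fin 2) (Fin 2) ℂ) : hs (A + B) ≤ hs A + hs B := by
  let _ := frobeniusNormedAddCommGroup (m := Fin 2) (n := Fin 2) (α := ℂ)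
  simpa only [hs_eq_frobenius] using norm_add_le A B

lemma hs_neg (A : Matrix (Fin 2) (Fin 2) ℂ) : hs (-A) = hs A := by simp [hs]

lemma hs_sub (A B : Matrix (Fin 2) (Fin 2) ℂ) : hs (A - B) ≤ hs A + hs B := by
  rw [sub_eq_add_neg, ← hs_neg B]; exact hs_add _ _

lemma hs_mul (A B : Matrix (Fin 2) (Fin 2) ℂ) : hs (A * B) ≤ hs A * hs B := by
  simpa only [hs_eq_frobenius] using frobenius_norm_mul A B

lemma hs_one : hs 1 = √2 := by norm_num [hs]

lemma hs_one_le : hs 1 ≤ 3 / 2 := by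
  rw [hs_one, Real.sqrt_le_left (by norm_num)]; norm_num

lemma norm_apply_le_hs (A : Matrix (Fin 2) (Fin 2) ℂ) (i j : Fin 2) : ‖A i j‖ ≤ hs A := by
  apply Real.le_sqrt_of_sq_le
  fin_cases i <;> fin_cases j <;> simp <;> nlinarith [sq_nonneg ‖A 0 0‖, sq_nonneg ‖A 0 1‖,
    sq_nonneg ‖A 1 0‖, sq_nonneg ‖A 1 1‖]

lemma hs_le_of_forall {A : Matrix (Fin 2) (Fin 2) ℂ} {r : ℝ} (h : ∀ i j, ‖A i j‖ ≤ r) :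
    hs A ≤ 2 * r := by
  have hr : 0 ≤ r := (norm_nonneg _).trans (h 0 0)
  refine Real.sqrt_le_iff.2 ⟨by positivity, ?_⟩
  have := fun i j => pow_le_pow_left₀ (norm_nonneg _) (h i j) 2
  nlinarith [this 0 0, this 0 1, this 1 0, this 1 1]

lemma hs_eq_zero {A : Matrix (Fin 2) (Fin 2) ℂ} (h : hs A = 0) : A = 0 := by
  ext i j
  have := norm_apply_le_hs A i j
  rw [h] at this
  simpa using this

lemma norm_trace_le (A : Matrix (Fin 2) (Fin 2) ℂ) : ‖A.trace‖ ≤ 2 * hs A := by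
  rw [trace_fin_two]
  linarith [norm_add_le (A 0 0) (A 1 1), norm_apply_le_hs A 0 0, norm_apply_le_hs A 1 1]

lemma euc_eq_zero {v : Fin 2 → ℂ} (h : euc v = 0) : v = 0 := by
  have h2 := euc_sq v
  rw [h] at h2
  have h0 : ‖v 0‖ = 0 := by nlinarith [sq_nonneg ‖v 0‖, sq_nonneg ‖v 1‖]
  have h1 : ‖v 1‖ = 0 := by nlinarith [sq_nonneg ‖v 0‖, sq_nonneg ‖v 1‖]
  ext i
  fin_cases i
  exacts [norm_eq_zero.1 h0, norm_eq_zero.1 h1]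

lemma euc_pos {v : Fin 2 → ℂ} (h : v ≠ 0) : 0 < euc v :=
  lt_of_le_of_ne (euc_nonneg v) fun h0 => h (euc_eq_zero h0.symm)

lemma euc_smul (c : ℂ) (v : Fin 2 → ℂ) : euc (c • v) = ‖c‖ * euc v := by
  rw [← sq_eq_sq₀ (euc_nonneg _) (mul_nonneg (norm_nonneg _) (euc_nonneg _)), mul_pow, euc_sq,
    euc_sq]
  simp; ring

lemma norm_apply_le_euc (v : Fin 2 → ℂ) (i : Fin 2) : ‖v i‖ ≤ euc v := by
  apply Real.le_sqrt_of_sq_le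
  fin_cases i <;> simp

lemma euc_le_of_forall {v : Fin 2 → ℂ} {r : ℝ} (h : ∀ i, ‖v i‖ ≤ r) : euc v ≤ 2 * r := by
  have hr : 0 ≤ r := (norm_nonneg _).trans (h 0)
  refine Real.sqrt_le_iff.2 ⟨by positivity, ?_⟩
  have := fun i => pow_le_pow_left₀ (norm_nonneg _) (h i) 2
  nlinarith [this 0, this 1]

/-- Cauchy–Schwarz in `ℂ²`. -/
lemma norm_dotProduct_le (a b c d : ℂ) :
    ‖a * c + b * d‖ ^ 2 ≤ (‖a‖ ^ 2 + ‖b‖ ^ 2) * (‖c‖ ^ 2 + ‖d‖ ^ 2) := by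
  have h : ‖a * c + b * d‖ ≤ ‖a‖ * ‖c‖ + ‖b‖ * ‖d‖ := by
    simpa using norm_add_le (a * c) (b * d)
  have h2 := pow_le_pow_left₀ (norm_nonneg _) h 2
  nlinarith [sq_nonneg (‖a‖ * ‖d‖ - ‖b‖ * ‖c‖)]

lemma euc_mulVec (A : Matrix (Fin 2) (Fin 2) ℂ) (v : Fin 2 → ℂ) :
    euc (A *ᵥ v) ≤ hs A * euc v := by
  rw [← sq_le_sq₀ (euc_nonneg _) (mul_nonneg (hs_nonneg _) (euc_nonneg _)), mul_pow, euc_sq,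
    hs_sq, euc_sq]
  simp only [mulVec, dotProduct, Fin.sum_univ_two]
  linarith [norm_dotProduct_le (A 0 0) (A 0 1) (v 0) (v 1),
    norm_dotProduct_le (A 1 0) (A 1 1) (v 0) (v 1)]

lemma hs_nilp (v : Fin 2 → ℂ) : hs (nilp v) = euc v ^ 2 := by
  rw [← sq_eq_sq₀ (hs_nonneg _) (by positivity), hs_sq, euc_sq]
  simp [nilp]; ring

lemma nilp_smul (c : ℂ) (v : Fin 2 → ℂ) : nilp (c • v) = c ^ 2 • nilp v := by
  ext i j; fin_cases i <;> fin_cases j <;> simp [nilp] <;> ring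

lemma nilp_sq (v : Fin 2 → ℂ) : nilp v * nilp v = 0 := by
  ext i j; fin_cases i <;> fin_cases j <;> simp [nilp, mul_apply, Fin.sum_univ_two] <;> ring

lemma trace_nilp (v : Fin 2 → ℂ) : (nilp v).trace = 0 := by
  simp [nilp, trace_fin_two]

lemma nilp_ne_zero {v : Fin 2 → ℂ} (h : v ≠ 0) : nilp v ≠ 0 := fun h0 => by
  have := hs_nilp v
  rw [h0] at this
  have h1 : hs 0 = 0 := by simp [hs]
  rw [h1] at this
  exact (pow_pos (euc_pos h) 2).ne this

lemma nilp_commute {v w : Fin 2 → ℂ} (h : nilp v * nilp w = nilp w * nilp v) :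
    v 0 * w 1 = v 1 * w 0 := by
  have h0 := congrFun (congrFun h 0) 0
  have h1 := congrFun (congrFun h 0) 1
  have h2 := congrFun (congrFun h 1) 0
  simp [nilp, mul_apply, Fin.sum_univ_two] at h0 h1 h2
  have h3 : (v 0 * w 1 - v 1 * w 0) * (v 0 * w 1 + v 1 * w 0) = 0 := by linear_combination -h0
  have h4 : (v 0 * w 1 - v 1 * w 0) * (v 0 * w 0) = 0 := by linear_combination h1 / 2
  have h5 : (v 0 * w 1 - v 1 * w 0) * (v 1 * w 1) = 0 := by linear_combination -h2 / 2
  by_contra hne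
  have hne' : v 0 * w 1 - v 1 * w 0 ≠ 0 := sub_ne_zero.2 hne
  have h3' := (mul_eq_zero.1 h3).resolve_left hne'
  have h4' := (mul_eq_zero.1 h4).resolve_left hne'
  have h5' := (mul_eq_zero.1 h5).resolve_left hne'
  apply hne'
  have : (v 0 * w 1 - v 1 * w 0) ^ 2 = 0 := by
    linear_combination (v 0 * w 1 + v 1 * w 0) * h3' - 4 * (v 1 * w 1) * h4'
  simpa using this

/-- Proportional vectors: if `v ≠ 0` and `v`, `w` are dependent, `w` is a multiple of `v`. -/
lemma exists_smul_of_det {v w : Fin 2 → ℂ} (hv : v ≠ 0) (h : v 0 * w 1 = v 1 * w 0) :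
    ∃ c : ℂ, w = c • v := by
  by_cases h0 : v 0 = 0
  · have h1 : v 1 ≠ 0 := fun h1 => hv (by ext i; fin_cases i <;> simpa)
    refine ⟨w 1 / v 1, ?_⟩
    have : w 0 = 0 := by simpa [h0, h1] using h
    ext i; fin_cases i <;> simp [h0, h1, this]
  · refine ⟨w 0 / v 0, ?_⟩
    ext i
    fin_cases i
    · simp [h0]
    · simp; field_simp; linear_combination h

end Matrix

namespace SL2C

/-- The matrix underlying an element of `SL(2, ℂ)`. -/
def mat (x : SL2C) : Matrix (Fin 2) (Fin 2) ℂ := x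

notation:max "⇡" x:max => mat x

lemma mat_mul (x y : SL2C) : ⇡(x * y) = ⇡x * ⇡y := Matrix.SpecialLinearGroup.coe_mul x y

lemma mat_one : ⇡(1 : SL2C) = 1 := Matrix.SpecialLinearGroup.coe_one

lemma mat_neg (x : SL2C) : ⇡(-x) = -⇡x := Matrix.SpecialLinearGroup.coe_neg x

lemma mat_injective : Function.Injective mat := Subtype.val_injective

lemma det_mat (x : SL2C) : (⇡x).det = 1 := x.2

/-- An element of `SL(2, ℂ)` from its entries. -/
def mk (a b c d : ℂ) (h : a * d - b * c = 1) : SL2C := ⟨!![a, b; c, d], by rwa [det_fin_two_of]⟩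

lemma mat_mk (a b c d : ℂ) (h : a * d - b * c = 1) : ⇡(mk a b c d h) = !![a, b; c, d] := rfl

lemma mat_inv (x : SL2C) : ⇡x⁻¹ = !![⇡x 1 1, -⇡x 0 1; -⇡x 1 0, ⇡x 0 0] :=
  (Matrix.SpecialLinearGroup.coe_inv x).trans (adjugate_fin_two _)

lemma mat_inv_mul (x : SL2C) : ⇡x⁻¹ * ⇡x = 1 := by rw [← mat_mul, inv_mul_cancel, mat_one]

lemma mat_mul_inv (x : SL2C) : ⇡x * ⇡x⁻¹ = 1 := by rw [← mat_mul, mul_inv_cancel, mat_one]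

lemma hs_inv (x : SL2C) : hs ⇡x⁻¹ = hs ⇡x := by
  simp only [hs, mat_inv]
  simp; congr 1; ring

lemma det_eq (x : SL2C) : ⇡x 0 0 * ⇡x 1 1 - ⇡x 0 1 * ⇡x 1 0 = 1 := by
  rw [← det_fin_two, det_mat]

lemma one_le_hs (x : SL2C) : 1 ≤ hs ⇡x := by
  have h := det_eq x
  have h1 : (1 : ℝ) ≤ ‖⇡x 0 0‖ * ‖⇡x 1 1‖ + ‖⇡x 0 1‖ * ‖⇡x 1 0‖ := by
    have := norm_sub_le (⇡x 0 0 * ⇡x 1 1) (⇡x 0 1 * ⇡x 1 0)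
    rw [h] at this; simpa using this
  have := hs_sq ⇡x
  nlinarith [sq_nonneg (‖⇡x 0 0‖ - ‖⇡x 1 1‖), sq_nonneg (‖⇡x 0 1‖ - ‖⇡x 1 0‖), hs_nonneg ⇡x]

lemma hs_pos (x : SL2C) : 0 < hs ⇡x := one_pos.trans_le (one_le_hs x)

lemma inv_mulVec_mulVec (x : SL2C) (v : Fin 2 → ℂ) : ⇡x⁻¹ *ᵥ (⇡x *ᵥ v) = v := by
  rw [mulVec_mulVec, mat_inv_mul, one_mulVec]

lemma mulVec_inv_mulVec (x : SL2C) (v : Fin 2 → ℂ) : ⇡x *ᵥ (⇡x⁻¹ *ᵥ v) = v := by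
  rw [mulVec_mulVec, mat_mul_inv, one_mulVec]

lemma mulVec_ne_zero (x : SL2C) {v : Fin 2 → ℂ} (hv : v ≠ 0) : ⇡x *ᵥ v ≠ 0 := fun h => by
  apply hv; rw [← inv_mulVec_mulVec x v, h, mulVec_zero]

lemma hs_mul_le (x y : SL2C) : hs ⇡(x * y) ≤ hs ⇡x * hs ⇡y := by
  rw [mat_mul]; exact Matrix.hs_mul _ _

lemma conj_nilp (x : SL2C) (v : Fin 2 → ℂ) : ⇡x * nilp v * ⇡x⁻¹ = nilp (⇡x *ᵥ v) := by
  have h := det_eq x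
  rw [mat_inv]
  ext i j
  fin_cases i <;> fin_cases j <;>
    simp [nilp, mul_apply, Fin.sum_univ_two, mulVec, dotProduct] <;> ring

/-- The unipotent element `1 + nilp v`. -/
def unip (v : Fin 2 → ℂ) : SL2C := ⟨1 + nilp v, by simp [nilp, det_fin_two]; ring⟩

lemma unip_val (v : Fin 2 → ℂ) : ⇡(unip v) = 1 + nilp v := rfl

lemma conj_unip (x : SL2C) (v : Fin 2 → ℂ) : x * unip v * x⁻¹ = unip (⇡x *ᵥ v) := by
  apply mat_injective
  rw [mat_mul, mat_mul, unip_val, unip_val, ← conj_nilp,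
    mul_add, add_mul, mul_one, mat_mul_inv]

lemma conj_unip' (x : SL2C) (v : Fin 2 → ℂ) : x⁻¹ * unip v * x = unip (⇡x⁻¹ *ᵥ v) := by
  simpa using conj_unip x⁻¹ v

lemma hs_unip_sub_one (v : Fin 2 → ℂ) : hs (⇡(unip v) - 1) = euc v ^ 2 := by
  rw [unip_val, add_sub_cancel_left, hs_nilp]

lemma unip_ne_one {v : Fin 2 → ℂ} (hv : v ≠ 0) : unip v ≠ 1 := fun h => by
  apply nilp_ne_zero hv
  have := congrArg mat h
  rw [unip_val, mat_one] at this
  simpa using this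

lemma trace_unip (v : Fin 2 → ℂ) : (⇡(unip v)).trace = 2 := by
  rw [unip_val, trace_add, trace_nilp]; simp

/-- A matrix of determinant one and trace two is of the form `1 + nilp v`. -/
lemma exists_unip {x : SL2C} (h : (⇡x).trace = 2) : ∃ v, x = unip v := by
  have hd := det_eq x
  rw [trace_fin_two] at h
  obtain ⟨s, hs⟩ := IsAlgClosed.exists_pow_nat_eq (⇡x 0 1) (n := 2) (by norm_num)
  obtain ⟨t, ht⟩ := IsAlgClosed.exists_pow_nat_eq (-(⇡x 1 0)) (n := 2) (by norm_num)
  have key : (⇡x 1 1 - 1 - s * t) * (⇡x 1 1 - 1 + s * t) = 0 := by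
    have h00 : ⇡x 0 0 = 2 - ⇡x 1 1 := by linear_combination h
    rw [h00, ← hs] at hd
    have : ⇡x 1 0 = -t ^ 2 := by linear_combination ht
    rw [this] at hd
    linear_combination -hd
  have main : ∀ t : ℂ, t ^ 2 = -(⇡x 1 0) → ⇡x 1 1 - 1 = s * t → x = unip ![s, t] := by
    intro t ht h1
    apply mat_injective
    ext i j
    fin_cases i <;> fin_cases j <;> simp [unip_val, nilp]
    · linear_combination h - h1
    · exact hs.symm
    · linear_combination ht
    · linear_combination h1
  rcases mul_eq_zero.1 key with h1 | h1
  · exact ⟨_, main t ht (by linear_combination h1)⟩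
  · exact ⟨_, main (-t) (by rw [neg_sq, ht]) (by linear_combination h1)⟩

lemma unip_commute {v w : Fin 2 → ℂ} (h : unip v * unip w = unip w * unip v) :
    v 0 * w 1 = v 1 * w 0 := by
  apply nilp_commute
  have := congrArg mat h
  simp only [mat_mul, unip_val] at this
  simpa [add_mul, mul_add, add_comm, add_left_comm, add_assoc] using this

lemma unip_mulVec_smul (c : ℂ) (v : Fin 2 → ℂ) : ⇡(unip v) *ᵥ (c • v) = c • v := by
  rw [unip_val, add_mulVec, one_mulVec, mulVec_smul]
  have : nilp v *ᵥ v = 0 := by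
    ext i; fin_cases i <;> simp [nilp, mulVec, dotProduct, Fin.sum_univ_two] <;> ring
  rw [this, smul_zero, add_zero]

end SL2C

/-- The product of a summable nonnegative weight over finitely many integer coordinates is
summable. -/
lemma summable_prod_fin {w : ℤ → ℝ} (hw0 : ∀ k, 0 ≤ w k) (hw : Summable w) :
    ∀ n : ℕ, Summable fun v : Fin n → ℤ => ∏ i, w (v i)
  | 0 => Summable.of_finite
  | n + 1 => by
    have h := hw.mul_of_nonneg (summable_prod_fin hw0 hw n) hw0
      (fun v => Finset.prod_nonneg fun i _ => hw0 _)
    rw [← (Fin.consEquiv fun _ : Fin (n + 1) => ℤ).summable_iff]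
    refine h.congr fun v => ?_
    simp [Fin.consEquiv, Fin.prod_univ_succ]

/-- Separated sets with polynomially controlled coordinates are summable for a large exponent. -/
lemma summable_of_separated {S : Type*} {n : ℕ} {h : S → ℝ} (h1 : ∀ s, 1 ≤ h s)
    {r : S → Fin n → ℝ} (hr : ∀ s i, |r s i| ≤ h s) {ε : ℝ} (hε : 0 < ε)
    (sep : ∀ s s', (∀ i, |r s i - r s' i| < ε / h s) → s = s') :
    Summable fun s => ((h s) ^ (4 * (n + 1)))⁻¹ := by
  obtain ⟨N, hN⟩ := exists_nat_gt (1 / ε)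
  have hN0 : (0 : ℝ) < N := (by positivity : 0 < 1 / ε).trans hN
  have hN1 : (1 : ℝ) ≤ N := by
    have : 0 < N := by exact_mod_cast hN0
    exact_mod_cast this
  let F : S → Fin (n + 1) → ℤ := fun s =>
    Fin.cons (α := fun _ => ℤ) ⌈h s⌉ fun i => ⌊(N * ⌈h s⌉ : ℝ) * r s i⌋
  have hF : Function.Injective F := by
    intro s s' hss
    have e0 : ⌈h s⌉ = ⌈h s'⌉ := by simpa [F] using congrFun hss 0
    refine sep s s' fun i => ?_
    have ei : ⌊(N * ⌈h s⌉ : ℝ) * r s i⌋ = ⌊(N * ⌈h s'⌉ : ℝ) * r s' i⌋ := by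
      simpa [F] using congrFun hss i.succ
    rw [← e0] at ei
    have h3 := Int.abs_sub_lt_one_of_floor_eq_floor ei
    have hT : h s ≤ ⌈h s⌉ := Int.le_ceil _
    have hs0 : 0 < h s := one_pos.trans_le (h1 s)
    rw [← mul_sub, abs_mul, abs_of_pos (by positivity)] at h3
    rw [lt_div_iff₀ hs0]
    have h4 : 1 < N * ε := by rwa [div_lt_iff₀ hε] at hN
    have h5 := abs_nonneg (r s i - r s' i)
    have h6 : N * (|r s i - r s' i| * h s) < N * ε := by
      nlinarith [mul_le_mul_of_nonneg_left hT (mul_nonneg hN0.le h5)]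
    exact lt_of_mul_lt_mul_left h6 hN0.le
  have hb : ∀ s i, |(F s i : ℝ)| ≤ 3 * N * h s ^ 2 := by
    intro s i
    have hs1 := h1 s
    have hT : (⌈h s⌉ : ℝ) < h s + 1 := Int.ceil_lt_add_one _
    have hT0 : h s ≤ ⌈h s⌉ := Int.le_ceil _
    refine Fin.cases ?_ (fun i => ?_) i
    · simp only [F, Fin.cons_zero]
      rw [abs_of_nonneg (by linarith)]
      nlinarith [mul_le_mul_of_nonneg_right hN1 (sq_nonneg (h s))]
    · simp only [F, Fin.cons_succ]
      have hx : |(N * ⌈h s⌉ : ℝ) * r s i| ≤ N * (2 * h s) * h s := by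
        rw [abs_mul, abs_of_nonneg (by positivity)]
        refine mul_le_mul ?_ (hr s i) (abs_nonneg _) (by positivity)
        exact mul_le_mul_of_nonneg_left (by linarith) hN0.le
      have h6 := Int.floor_le ((N * ⌈h s⌉ : ℝ) * r s i)
      have h7 := Int.lt_floor_add_one ((N * ⌈h s⌉ : ℝ) * r s i)
      have h8 := abs_le.1 hx
      have h9 : 1 ≤ N * h s ^ 2 := one_le_mul_of_one_le_of_one_le hN1 (one_le_pow₀ hs1)
      rw [abs_le]
      constructor <;> nlinarith
  let w : ℤ → ℝ := fun k => (1 + (k : ℝ) ^ 2)⁻¹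
  have hw0 : ∀ k, 0 ≤ w k := fun k => by positivity
  have hw : Summable w := by
    have h2 : Summable fun k : ℤ => 1 / (k : ℝ) ^ 2 :=
      Real.summable_one_div_int_pow.2 (by norm_num)
    refine Summable.of_norm_bounded_eventually h2 ?_
    refine (Set.finite_singleton (0 : ℤ)).subset fun k hk => ?_
    by_contra hk0
    apply hk
    change ‖w k‖ ≤ 1 / (k : ℝ) ^ 2
    have hk1 : (0 : ℝ) < (k : ℝ) ^ 2 := by
      have : (k : ℝ) ≠ 0 := by exact_mod_cast hk0
      positivity
    rw [Real.norm_of_nonneg (hw0 k), one_div]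
    exact inv_anti₀ hk1 (by linarith)
  set C : ℝ := 1 + (3 * N) ^ 2
  have hC : 0 < C := by positivity
  have hsum := ((summable_prod_fin hw0 hw (n + 1)).comp_injective hF).mul_left (C ^ (n + 1))
  refine Summable.of_nonneg_of_le (fun s => by have := h1 s; positivity) (fun s => ?_) hsum
  have hs0 : 0 < h s := one_pos.trans_le (h1 s)
  have key : ∀ i, (C * h s ^ 4)⁻¹ ≤ w (F s i) := fun i => by
    refine inv_anti₀ (by positivity) ?_
    have h2 := pow_le_pow_left₀ (abs_nonneg _) (hb s i) 2
    rw [sq_abs] at h2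
    have h3 : 1 ≤ h s ^ 4 := one_le_pow₀ (h1 s)
    calc 1 + (F s i : ℝ) ^ 2 ≤ 1 + (3 * N * h s ^ 2) ^ 2 := by linarith
      _ ≤ C * h s ^ 4 := by simp only [C]; nlinarith
  have h5 : ∏ _i : Fin (n + 1), (C * h s ^ 4)⁻¹ ≤ ∏ i, w (F s i) :=
    Finset.prod_le_prod (fun i _ => by positivity) fun i _ => key i
  rw [Finset.prod_const, Finset.card_univ, Fintype.card_fin] at h5
  calc ((h s) ^ (4 * (n + 1)))⁻¹ = C ^ (n + 1) * ((C * h s ^ 4)⁻¹) ^ (n + 1) := by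
        rw [pow_mul, inv_pow, mul_pow]; field_simp
    _ ≤ C ^ (n + 1) * ∏ i, w (F s i) := mul_le_mul_of_nonneg_left h5 (by positivity)

namespace SL2C

/-- The properties of the preimage in `SL(2, ℂ)` of a torsion-free lattice which are used below:
it contains `-1`, it is discrete, points of injectivity radius at least `ε` are at bounded
distance from it, and its only torsion elements are `±1`. -/
structure Good (H : Subgroup SL2C) : Prop where
  neg : -1 ∈ H
  disc : ∃ ε > 0, ∀ g ∈ H, hs (⇡g - 1) < ε → g = 1
  thick : ∀ ε > 0, ∃ R, ∀ x : SL2C, (∀ γ ∈ H, hs (⇡(x⁻¹ * γ * x) - 1) < ε → γ = 1) →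
    ∃ γ ∈ H, hs ⇡(γ * x) ≤ R
  tf : ∀ g ∈ H, ∀ n : ℕ, n ≠ 0 → g ^ n = 1 → g = 1 ∨ g = -1

variable {H : Subgroup SL2C}

lemma Good.neg_mem (hH : Good H) {g : SL2C} (hg : g ∈ H) : -g ∈ H := by
  have := H.mul_mem hH.neg hg
  rwa [neg_one_mul] at this

lemma Good.summable (hH : Good H) : Summable fun g : H => ((hs ⇡(g : SL2C)) ^ 36)⁻¹ := by
  obtain ⟨ε, hε, hd⟩ := hH.disc
  let r : H → Fin 8 → ℝ := fun g => ![(⇡(g : SL2C) 0 0).re, (⇡(g : SL2C) 0 0).im,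
    (⇡(g : SL2C) 0 1).re, (⇡(g : SL2C) 0 1).im, (⇡(g : SL2C) 1 0).re, (⇡(g : SL2C) 1 0).im,
    (⇡(g : SL2C) 1 1).re, (⇡(g : SL2C) 1 1).im]
  refine summable_of_separated (n := 8) (r := r) (ε := ε / 5) (fun g => one_le_hs g) ?_
    (by positivity) ?_
  · intro g i
    fin_cases i <;> simp [r] <;>
    first
    | exact (Complex.abs_re_le_norm _).trans (norm_apply_le_hs _ _ _)
    | exact (Complex.abs_im_le_norm _).trans (norm_apply_le_hs _ _ _)
  · intro g g' h
    have hg := hs_pos (g : SL2C)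
    have hmain : hs (⇡(g' : SL2C) - ⇡(g : SL2C)) ≤ 2 * (2 * (ε / 5 / hs ⇡(g : SL2C))) := by
      apply hs_le_of_forall
      have hz : ∀ z w : ℂ, ∀ δ : ℝ, |z.re - w.re| < δ → |z.im - w.im| < δ →
          ‖w - z‖ ≤ 2 * δ := by
        intro z w δ h1 h2
        rw [norm_sub_rev]
        have := Complex.norm_le_abs_re_add_abs_im (z - w)
        simp only [Complex.sub_re, Complex.sub_im] at this
        linarith
      intro i j
      fin_cases i <;> fin_cases j
      · exact hz _ _ _ (h 0) (h 1)
      · exact hz _ _ _ (h 2) (h 3)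
      · exact hz _ _ _ (h 4) (h 5)
      · exact hz _ _ _ (h 6) (h 7)
    have h1 : (g : SL2C)⁻¹ * g' = 1 := by
      apply hd _ (H.mul_mem (H.inv_mem g.2) g'.2)
      have e : ⇡((g : SL2C)⁻¹ * g') - 1 = ⇡(g : SL2C)⁻¹ * (⇡(g' : SL2C) - ⇡(g : SL2C)) := by
        rw [mul_sub, mat_inv_mul, mat_mul]
      rw [e]
      calc _ ≤ hs ⇡(g : SL2C)⁻¹ * hs (⇡(g' : SL2C) - ⇡(g : SL2C)) := Matrix.hs_mul _ _
        _ ≤ hs ⇡(g : SL2C) * (2 * (2 * (ε / 5 / hs ⇡(g : SL2C)))) := by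
          rw [hs_inv]; exact mul_le_mul_of_nonneg_left hmain hg.le
        _ = 4 / 5 * ε := by field_simp; norm_num
        _ < ε := by linarith
    exact Subtype.ext (inv_mul_eq_one.1 h1)

lemma Good.finite (hH : Good H) (R : ℝ) : {g : SL2C | g ∈ H ∧ hs ⇡g ≤ R}.Finite := by
  have h := hH.summable.tendsto_cofinite_zero
  have hR : 0 < (max R 1 ^ 36)⁻¹ := by positivity
  have h2 := h.eventually (gt_mem_nhds hR)
  rw [Filter.eventually_cofinite] at h2
  refine (h2.image Subtype.val).subset fun g hg => ⟨⟨g, hg.1⟩, ?_, rfl⟩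
  simp only [Set.mem_ofPred_eq, not_lt]
  exact inv_anti₀ (pow_pos (hs_pos g) _)
    (pow_le_pow_left₀ (hs_nonneg _) (hg.2.trans (le_max_left _ _)) _)

lemma commute_iff (x y : SL2C) : x * y = y * x ↔
    ⇡x 0 1 * ⇡y 1 0 = ⇡y 0 1 * ⇡x 1 0 ∧
    ⇡x 0 1 * (⇡y 0 0 - ⇡y 1 1) = ⇡y 0 1 * (⇡x 0 0 - ⇡x 1 1) ∧
    ⇡x 1 0 * (⇡y 0 0 - ⇡y 1 1) = ⇡y 1 0 * (⇡x 0 0 - ⇡x 1 1) := by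
  constructor
  · intro h
    have h := congrArg mat h
    rw [mat_mul, mat_mul] at h
    have h0 := congrFun (congrFun h 0) 0
    have h1 := congrFun (congrFun h 0) 1
    have h2 := congrFun (congrFun h 1) 0
    simp only [mul_apply, Fin.sum_univ_two] at h0 h1 h2
    refine ⟨?_, ?_, ?_⟩
    · linear_combination h0
    · linear_combination -h1
    · linear_combination h2
  · rintro ⟨h0, h1, h2⟩
    apply mat_injective
    rw [mat_mul, mat_mul]
    ext i j
    fin_cases i <;> fin_cases j <;> simp only [mul_apply, Fin.sum_univ_two, Fin.zero_eta,
      Fin.mk_one, Fin.isValue]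
    · linear_combination h0
    · linear_combination -h1
    · linear_combination h2
    · linear_combination -h0

/-- The centralizer of a non-central element is commutative. -/
lemma commute_of_commute {m x y : SL2C} (h1 : m ≠ 1) (h2 : m ≠ -1) (hx : m * x = x * m)
    (hy : m * y = y * m) : x * y = y * x := by
  rw [commute_iff] at *
  obtain ⟨a1, a2, a3⟩ := hx
  obtain ⟨b1, b2, b3⟩ := hy
  have hm : ⇡m 0 1 ≠ 0 ∨ ⇡m 1 0 ≠ 0 ∨ ⇡m 0 0 - ⇡m 1 1 ≠ 0 := by
    by_contra! h
    obtain ⟨c1, c2, c3⟩ := h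
    have hd := det_eq m
    rw [c1] at hd
    have e : ⇡m 1 1 = ⇡m 0 0 := by linear_combination -c3
    have hd : (⇡m 0 0 - 1) * (⇡m 0 0 + 1) = 0 := by rw [e] at hd; linear_combination hd
    rcases mul_eq_zero.1 hd with h | h
    · apply h1; apply mat_injective; ext i j
      fin_cases i <;> fin_cases j <;> simp [mat_one, c1, c2, e, sub_eq_zero.1 h]
    · apply h2; apply mat_injective; ext i j
      fin_cases i <;> fin_cases j <;>
        simp [mat_one, mat_neg, c1, c2, e, eq_neg_of_add_eq_zero_left h]
  rcases hm with h | h | h <;> refine ⟨?_, ?_, ?_⟩ <;> apply mul_left_cancel₀ h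
  · linear_combination ⇡x 0 1 * b1 - ⇡y 0 1 * a1
  · linear_combination ⇡x 0 1 * b2 - ⇡y 0 1 * a2
  · linear_combination (⇡y 0 0 - ⇡y 1 1) * a1 - ⇡y 1 0 * a2 + ⇡x 0 1 * b3
  · linear_combination ⇡x 1 0 * b1 - ⇡y 1 0 * a1
  · linear_combination ⇡x 1 0 * b2 - (⇡y 0 0 - ⇡y 1 1) * a1 - ⇡y 0 1 * a3
  · linear_combination ⇡x 1 0 * b3 - ⇡y 1 0 * a3
  · linear_combination (⇡x 0 0 - ⇡x 1 1) * b1 - ⇡y 1 0 * a2 + ⇡y 0 1 * a3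
  · linear_combination (⇡x 0 0 - ⇡x 1 1) * b2 - (⇡y 0 0 - ⇡y 1 1) * a2
  · linear_combination (⇡x 0 0 - ⇡x 1 1) * b3 - (⇡y 0 0 - ⇡y 1 1) * a3

/-- The Zassenhaus lemma: elements moving a point by little commute. -/
lemma Good.zassenhaus (hH : Good H) (x : SL2C) {γ δ : SL2C} (hγ : γ ∈ H) (hδ : δ ∈ H)
    (h1 : hs (⇡(x⁻¹ * γ * x) - 1) < 1 / 8) (h2 : hs (⇡(x⁻¹ * δ * x) - 1) < 1 / 8) :
    γ * δ = δ * γ := by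
  have size : ∀ A : SL2C, hs (⇡A - 1) < 1 / 8 → hs ⇡A ≤ 13 / 8 := fun A hA => by
    have := hs_add (⇡A - 1) 1
    rw [sub_add_cancel] at this
    linarith [hs_one_le]
  have comm : ∀ A B : SL2C, hs (⇡A - 1) < 1 / 8 → hs (⇡B - 1) < 1 / 8 →
      hs (⇡(A * B * A⁻¹ * B⁻¹) - 1) ≤ 6 * hs (⇡A - 1) * hs (⇡B - 1) := by
    intro A B hA hB
    have e : ⇡(A * B * A⁻¹ * B⁻¹) - 1 =
        ((⇡A - 1) * (⇡B - 1) - (⇡B - 1) * (⇡A - 1)) * (⇡A⁻¹ * ⇡B⁻¹) := by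
      have e1 : (⇡A - 1) * (⇡B - 1) - (⇡B - 1) * (⇡A - 1) = ⇡A * ⇡B - ⇡B * ⇡A := by noncomm_ring
      have e2 : ⇡B * ⇡A * (⇡A⁻¹ * ⇡B⁻¹) = 1 := by
        rw [← mat_mul, ← mat_mul, ← mat_mul, ← mat_one]; congr 1; group
      rw [e1, sub_mul, e2, mat_mul, mat_mul, mat_mul, mul_assoc (⇡A * ⇡B)]
    have hab := mul_nonneg (hs_nonneg (⇡A - 1)) (hs_nonneg (⇡B - 1))
    rw [e]
    calc _ ≤ hs ((⇡A - 1) * (⇡B - 1) - (⇡B - 1) * (⇡A - 1)) * hs (⇡A⁻¹ * ⇡B⁻¹) :=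
          Matrix.hs_mul _ _
      _ ≤ (2 * (hs (⇡A - 1) * hs (⇡B - 1))) * (13 / 8 * (13 / 8)) := by
          refine mul_le_mul ?_ ?_ (hs_nonneg _) (by positivity)
          · have i1 := hs_sub ((⇡A - 1) * (⇡B - 1)) ((⇡B - 1) * (⇡A - 1))
            have i2 := Matrix.hs_mul (⇡A - 1) (⇡B - 1)
            have i3 := Matrix.hs_mul (⇡B - 1) (⇡A - 1)
            linarith
          · refine (Matrix.hs_mul _ _).trans ?_
            rw [hs_inv, hs_inv]
            exact mul_le_mul (size A hA) (size B hB) (hs_nonneg _) (by norm_num)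
      _ ≤ _ := by nlinarith
  set S : Set SL2C := {g | g ∈ H ∧ g ≠ 1 ∧ hs (⇡(x⁻¹ * g * x) - 1) < 1 / 8} with hS
  have hfin : S.Finite := by
    refine (hH.finite (hs ⇡x * (13 / 8) * hs ⇡x)).subset fun g hg => ⟨hg.1, ?_⟩
    have e : g = x * (x⁻¹ * g * x) * x⁻¹ := by group
    calc hs ⇡g = hs ⇡(x * (x⁻¹ * g * x) * x⁻¹) := by rw [← e]
      _ ≤ hs ⇡x * hs ⇡(x⁻¹ * g * x) * hs ⇡x := by
        refine (hs_mul_le _ _).trans ?_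
        rw [hs_inv]
        exact mul_le_mul_of_nonneg_right (hs_mul_le _ _) (hs_nonneg _)
      _ ≤ _ := by gcongr; exacts [hs_nonneg _, hs_nonneg _, size _ hg.2.2]
  by_cases hγ1 : γ = 1
  · simp [hγ1]
  obtain ⟨m, hm, hmin⟩ := Set.exists_min_image S (fun g => hs (⇡(x⁻¹ * g * x) - 1)) hfin
    ⟨γ, hγ, hγ1, h1⟩
  have hcm : ∀ g ∈ H, hs (⇡(x⁻¹ * g * x) - 1) < 1 / 8 → m * g = g * m := by
    intro g hg hg8
    by_contra hne
    have hc1 : m * g * m⁻¹ * g⁻¹ ≠ 1 := fun h => hne (by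
      rw [mul_inv_eq_one, mul_inv_eq_iff_eq_mul] at h; exact h)
    have e : x⁻¹ * (m * g * m⁻¹ * g⁻¹) * x = (x⁻¹ * m * x) * (x⁻¹ * g * x) * (x⁻¹ * m * x)⁻¹ *
        (x⁻¹ * g * x)⁻¹ := by group
    have hc := comm _ _ hm.2.2 hg8
    rw [← e] at hc
    have hm0 : 0 < hs (⇡(x⁻¹ * m * x) - 1) := by
      refine lt_of_le_of_ne (hs_nonneg _) fun h0 => hm.2.1 ?_
      have h0 := sub_eq_zero.1 (hs_eq_zero h0.symm)
      rw [← mat_one] at h0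
      have h0 := mat_injective h0
      rw [mul_assoc, inv_mul_eq_one] at h0
      exact right_eq_mul.1 h0
    have hlt : hs (⇡(x⁻¹ * (m * g * m⁻¹ * g⁻¹) * x) - 1) < hs (⇡(x⁻¹ * m * x) - 1) := by
      nlinarith
    have := hmin _ ⟨H.mul_mem (H.mul_mem (H.mul_mem hm.1 hg) (H.inv_mem hm.1)) (H.inv_mem hg), hc1,
      hlt.trans hm.2.2⟩
    exact absurd hlt (not_lt.2 this)
  refine commute_of_commute (m := m) hm.2.1 ?_ (hcm γ hγ h1) (hcm δ hδ h2)
  rintro rfl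
  have := hm.2.2
  have e : x⁻¹ * (-1) * x = -1 := by simp
  rw [e, mat_neg, mat_one] at this
  have h3 := norm_apply_le_hs (-1 - 1) 0 0
  have h4 : (-1 - 1 : Matrix (Fin 2) (Fin 2) ℂ) 0 0 = -2 := by simp; norm_num
  rw [h4] at h3
  norm_num at h3 this
  linarith

/-- The discriminant of the characteristic polynomial. -/
noncomputable def discr (x : SL2C) : ℂ := (⇡x).trace ^ 2 - 4

lemma discr_eq (x : SL2C) : discr x = (⇡x 0 0 - ⇡x 1 1) ^ 2 + 4 * (⇡x 0 1 * ⇡x 1 0) := by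
  rw [discr, trace_fin_two]; linear_combination 4 * det_eq x

lemma trace_conj (x y : SL2C) : (⇡(y⁻¹ * x * y)).trace = (⇡x).trace := by
  rw [mat_mul, mat_mul, trace_mul_cycle, mat_mul_inv, one_mul]

lemma discr_conj (x y : SL2C) : discr (y⁻¹ * x * y) = discr x := by
  rw [discr, discr, trace_conj]

lemma discr_neg (x : SL2C) : discr (-x) = discr x := by
  rw [discr, discr, mat_neg, trace_neg, neg_sq]

lemma trace_one : (⇡(1 : SL2C)).trace = 2 := by rw [mat_one]; simp

lemma ne_one_of_discr {x : SL2C} (h : discr x ≠ 0) : x ≠ 1 := by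
  rintro rfl; apply h; rw [discr, trace_one]; norm_num

lemma ne_neg_one_of_discr {x : SL2C} (h : discr x ≠ 0) : x ≠ -1 := by
  rintro rfl; apply h; rw [discr_neg, discr, trace_one]; norm_num

/-- An element of `SL(2, ℂ)` with first column `v`, of controlled size. -/
noncomputable def frame (v : Fin 2 → ℂ) (hv : v ≠ 0) : SL2C :=
  mk (v 0) (-(starRingEnd ℂ (v 1)) / (euc v ^ 2 : ℝ)) (v 1) (starRingEnd ℂ (v 0) / (euc v ^ 2 : ℝ))
    (by
      have h := euc_sq v
      have h0 : ((euc v ^ 2 : ℝ) : ℂ) ≠ 0 := by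
        exact_mod_cast (pow_pos (euc_pos hv) 2).ne'
      have h1 : v 0 * starRingEnd ℂ (v 0) + v 1 * starRingEnd ℂ (v 1) = (euc v ^ 2 : ℝ) := by
        rw [h, Complex.mul_conj', Complex.mul_conj']; push_cast; ring
      field_simp
      linear_combination h1)

lemma mulVec_e1 (x : SL2C) : ⇡x *ᵥ ![1, 0] = ![⇡x 0 0, ⇡x 1 0] := by
  ext i; fin_cases i <;> simp [mulVec, dotProduct, Fin.sum_univ_two]

lemma frame_e1 (v : Fin 2 → ℂ) (hv : v ≠ 0) : ⇡(frame v hv) *ᵥ ![1, 0] = v := by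
  rw [mulVec_e1]
  ext i; fin_cases i <;> simp [frame, mat_mk]

lemma frame_inv_e1 (v : Fin 2 → ℂ) (hv : v ≠ 0) : ⇡(frame v hv)⁻¹ *ᵥ v = ![1, 0] := by
  have := inv_mulVec_mulVec (frame v hv) ![1, 0]
  rwa [frame_e1] at this

lemma hs_frame (v : Fin 2 → ℂ) (hv : v ≠ 0) :
    hs ⇡(frame v hv) ^ 2 = euc v ^ 2 + (euc v ^ 2)⁻¹ := by
  have h := euc_sq v
  have h0 := euc_pos hv
  rw [hs_sq]
  simp only [frame, mat_mk]
  simp only [of_apply, cons_val', cons_val_zero, cons_val_one, cons_val_fin_one, norm_div, norm_neg,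
    RCLike.norm_conj, Complex.norm_real, Real.norm_eq_abs]
  rw [abs_of_pos (by positivity)]
  field_simp
  linear_combination (-euc v ^ 4 - 1) * h

lemma exists_triangular (x : SL2C) :
    ∃ (y : SL2C) (μ s : ℂ), μ ≠ 0 ∧ ⇡(y⁻¹ * x * y) = !![μ, s; 0, μ⁻¹] := by
  obtain ⟨r, hr⟩ := IsAlgClosed.exists_pow_nat_eq (discr x) (n := 2) (by norm_num)
  set μ := ((⇡x).trace + r) / 2 with hμ
  have hdet : (⇡x - scalar (Fin 2) μ).det = 0 := by
    rw [det_fin_two]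
    simp
    rw [discr] at hr
    have ht := trace_fin_two ⇡x
    have hd := det_eq x
    rw [hμ]
    linear_combination hd + hr / 4 + ((⇡x).trace + r) / 2 * ht
  obtain ⟨v, hv, hxv⟩ := exists_mulVec_eq_zero_iff.2 hdet
  have hxv : ⇡x *ᵥ v = μ • v := by
    rw [sub_mulVec, sub_eq_zero] at hxv
    rw [hxv]
    ext i; fin_cases i <;> simp [mulVec, dotProduct, Fin.sum_univ_two]
  have hcol := mulVec_e1 ((frame v hv)⁻¹ * x * frame v hv)
  rw [mat_mul, mat_mul, ← mulVec_mulVec, frame_e1, ← mulVec_mulVec, hxv, mulVec_smul] at hcol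
  rw [frame_inv_e1, ← mat_mul, ← mat_mul] at hcol
  set z := (frame v hv)⁻¹ * x * frame v hv with hz
  have h0 : ⇡z 0 0 = μ := by simpa using (congrFun hcol 0).symm
  have h1 : ⇡z 1 0 = 0 := by simpa using (congrFun hcol 1).symm
  have hd := det_eq z
  rw [h0, h1, mul_zero, sub_zero] at hd
  refine ⟨frame v hv, μ, ⇡z 0 1, left_ne_zero_of_mul_eq_one hd, ?_⟩
  rw [← hz]
  ext i j
  fin_cases i <;> fin_cases j <;> simp [h0, h1, eq_inv_of_mul_eq_one_right hd]

/-- The matrix `!![1, t; 0, 1]`. -/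
def shear (t : ℂ) : SL2C := mk 1 t 0 1 (by ring)

lemma mat_shear (t : ℂ) : ⇡(shear t) = !![1, t; 0, 1] := rfl

lemma shear_inv (t : ℂ) : (shear t)⁻¹ = shear (-t) := by
  apply mat_injective
  rw [mat_inv, mat_shear, mat_shear]
  ext i j; fin_cases i <;> fin_cases j <;> simp

lemma shear_conj {x : SL2C} {μ s : ℂ} (h : ⇡x = !![μ, s; 0, μ⁻¹]) (hd : μ - μ⁻¹ ≠ 0) (s₀ : ℂ) :
    ∃ b, ⇡((shear b)⁻¹ * x * shear b) = !![μ, s₀; 0, μ⁻¹] := by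
  refine ⟨(s₀ - s) / (μ - μ⁻¹), ?_⟩
  rw [mat_mul, mat_mul, h, shear_inv, mat_shear, mat_shear]
  ext i j
  fin_cases i <;> fin_cases j <;> simp
  linear_combination div_mul_cancel₀ (s₀ - s) hd

lemma exists_normal_form {x : SL2C} (hx : discr x ≠ 0) (s₀ : ℂ) :
    ∃ (y : SL2C) (μ : ℂ), μ ≠ 0 ∧ μ - μ⁻¹ ≠ 0 ∧ ⇡(y⁻¹ * x * y) = !![μ, s₀; 0, μ⁻¹] := by
  obtain ⟨y, μ, s, hμ, h⟩ := exists_triangular x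
  have hd : μ - μ⁻¹ ≠ 0 := by
    rw [← discr_conj x y, discr_eq, h] at hx
    intro h0
    simp [h0] at hx
  obtain ⟨b, hb⟩ := shear_conj h hd s₀
  refine ⟨y * shear b, μ, hμ, hd, ?_⟩
  have e : (y * shear b)⁻¹ * x * (y * shear b) = (shear b)⁻¹ * (y⁻¹ * x * y) * shear b := by group
  rw [e, hb]

lemma hs_conj_le (x y : SL2C) : hs ⇡(y * x * y⁻¹) ≤ hs ⇡y ^ 2 * hs ⇡x := by
  refine (hs_mul_le _ _).trans ?_
  rw [hs_inv]
  nlinarith [hs_mul_le y x, hs_nonneg ⇡y]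

/-- Discriminants of elements of a lattice are bounded away from zero, if nonzero. -/
lemma Good.discr_gap (hH : Good H) : ∃ q > 0, ∀ γ ∈ H, discr γ ≠ 0 → q ≤ ‖discr γ‖ := by
  obtain ⟨R, hR⟩ := hH.thick (1 / 16) (by norm_num)
  obtain ⟨q₂, hq₂, hF⟩ : ∃ q > 0, ∀ h ∈ H, hs ⇡h ≤ R ^ 2 * 2 → discr h ≠ 0 → q ≤ ‖discr h‖ := by
    set F : Set SL2C := {h | h ∈ H ∧ hs ⇡h ≤ R ^ 2 * 2} ∩ {h | discr h ≠ 0}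
    have hfin : F.Finite := (hH.finite _).inter_of_left _
    by_cases hne : F.Nonempty
    · obtain ⟨m, hm, hmin⟩ := Set.exists_min_image F (fun h => ‖discr h‖) hfin hne
      exact ⟨_, norm_pos_iff.2 hm.2, fun h h1 h2 h3 => hmin h ⟨⟨h1, h2⟩, h3⟩⟩
    · exact ⟨1, one_pos, fun h h1 h2 h3 => (hne ⟨h, ⟨h1, h2⟩, h3⟩).elim⟩
  refine ⟨min q₂ (1 / 500), by positivity, fun γ hγ hγ0 => ?_⟩
  by_contra! hlt
  have hlt1 := hlt.trans_le (min_le_left _ _)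
  have hlt2 := hlt.trans_le (min_le_right _ _)
  set Z : Set SL2C := {δ | δ ∈ H ∧ γ * δ = δ * γ ∧ discr δ ≠ 0 ∧ ‖discr δ‖ ≤ ‖discr γ‖}
  have hZ : Z.Finite := by
    obtain ⟨y, μ, hμ, hd, hy⟩ := exists_normal_form hγ0 0
    refine (hH.finite (hs ⇡y ^ 2 * 3)).subset fun δ hδ => ⟨hδ.1, ?_⟩
    set M := y⁻¹ * δ * y with hM
    have hc : (y⁻¹ * γ * y) * M = M * (y⁻¹ * γ * y) := by
      have : y⁻¹ * γ * y * M = y⁻¹ * (γ * δ) * y := by rw [hM]; group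
      rw [this, hδ.2.1, hM]; group
    obtain ⟨-, c2, c3⟩ := (commute_iff _ _).1 hc
    rw [hy] at c2 c3
    have c2 : ⇡M 0 1 = 0 := by simpa [hd] using c2
    have c3 : ⇡M 1 0 = 0 := by simpa [hd] using c3
    have hdet := det_eq M
    have hq := discr_eq M
    rw [hM, discr_conj, ← hM, c2, zero_mul, mul_zero, add_zero] at hq
    rw [c2, zero_mul, sub_zero] at hdet
    have n1 : ‖⇡M 0 0‖ * ‖⇡M 1 1‖ = 1 := by rw [← norm_mul, hdet, norm_one]
    have n2 : (‖⇡M 0 0‖ - ‖⇡M 1 1‖) ^ 2 ≤ 1 / 500 := by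
      have h1 := abs_norm_sub_norm_le (⇡M 0 0) (⇡M 1 1)
      have h2 : ‖⇡M 0 0 - ⇡M 1 1‖ ^ 2 = ‖discr δ‖ := by rw [hq, norm_pow]
      have h3 := pow_le_pow_left₀ (abs_nonneg _) h1 2
      rw [sq_abs, h2] at h3
      linarith [hδ.2.2.2]
    have hsM : hs ⇡M ≤ 3 := by
      refine Real.sqrt_le_iff.2 ⟨by norm_num, ?_⟩
      rw [c2, c3]; norm_num; nlinarith
    have e : δ = y * M * y⁻¹ := by rw [hM]; group
    rw [e]
    exact (hs_conj_le _ _).trans (mul_le_mul_of_nonneg_left hsM (by positivity))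
  obtain ⟨δ, hδ, hmin⟩ := Set.exists_min_image Z (fun h => ‖discr h‖) hZ ⟨γ, hγ, rfl, hγ0, le_rfl⟩
  wlog hre : 0 ≤ ((⇡δ).trace).re generalizing δ
  · refine this (-δ) ⟨hH.neg_mem hδ.1, ?_, ?_, ?_⟩ ?_ ?_
    · rw [mul_neg, neg_mul, hδ.2.1]
    · rw [discr_neg]; exact hδ.2.2.1
    · rw [discr_neg]; exact hδ.2.2.2
    · simpa only [discr_neg] using hmin
    · rw [mat_neg, trace_neg, Complex.neg_re]; linarith
  have hq1 : ‖discr δ‖ < 1 / 500 := hδ.2.2.2.trans_lt hlt2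
  have htr : ‖(⇡δ).trace - 2‖ ≤ 1 / 1000 := by
    have h1 : ‖(⇡δ).trace - 2‖ * ‖(⇡δ).trace + 2‖ = ‖discr δ‖ := by
      rw [← norm_mul, discr]; congr 1; ring
    have h2 : 2 ≤ ‖(⇡δ).trace + 2‖ := by
      refine le_trans ?_ (Complex.re_le_norm _)
      simp [hre]
    nlinarith [norm_nonneg ((⇡δ).trace - 2)]
  obtain ⟨y, μ, hμ, hd, hy⟩ := exists_normal_form hδ.2.2.1 (1 / 16)
  have htμ : (⇡δ).trace = μ + μ⁻¹ := by rw [← trace_conj δ y, hy]; simp [trace_fin_two]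
  have small : ∀ ν : ℂ, ν ≠ 0 → (⇡δ).trace = ν + ν⁻¹ → ‖ν - 1‖ ≤ 1 / 20 := by
    intro ν hν ht
    have h1 : (ν - 1) ^ 2 = ν * ((⇡δ).trace - 2) := by rw [ht]; field_simp; ring
    have h2 : ‖ν - 1‖ ^ 2 = ‖ν‖ * ‖(⇡δ).trace - 2‖ := by rw [← norm_pow, h1, norm_mul]
    have h3 : ‖ν‖ ≤ ‖ν - 1‖ + 1 := by simpa using norm_add_le (ν - 1) 1
    have h4 : ‖ν - 1‖ ^ 2 ≤ (‖ν - 1‖ + 1) * (1 / 1000) := by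
      rw [h2]; exact mul_le_mul h3 htr (norm_nonneg _) (by positivity)
    by_contra! h5
    nlinarith
  have s1 := small μ hμ htμ
  have s2 := small μ⁻¹ (inv_ne_zero hμ) (by rw [inv_inv, htμ]; ring)
  have hN : hs (⇡(y⁻¹ * δ * y) - 1) < 1 / 8 := by
    rw [hs, hy]
    refine (Real.sqrt_lt' (by norm_num)).2 ?_
    simp
    have := pow_le_pow_left₀ (norm_nonneg _) s1 2
    have := pow_le_pow_left₀ (norm_nonneg _) s2 2
    norm_num at *
    linarith
  have hthick : ∀ g ∈ H, hs (⇡(y⁻¹ * g * y) - 1) < 1 / 16 → g = 1 := by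
    intro g hg hg1
    have hcomm := hH.zassenhaus y hδ.1 hg hN (hg1.trans (by norm_num))
    set M := y⁻¹ * g * y with hM
    have hc : (y⁻¹ * δ * y) * M = M * (y⁻¹ * δ * y) := by
      have : y⁻¹ * δ * y * M = y⁻¹ * (δ * g) * y := by rw [hM]; group
      rw [this, hcomm, hM]; group
    obtain ⟨c1, c2, -⟩ := (commute_iff _ _).1 hc
    rw [hy] at c1 c2
    have c1 : ⇡M 1 0 = 0 := by simpa using c1
    have c2 : ⇡M 0 0 - ⇡M 1 1 = 16 * ⇡M 0 1 * (μ - μ⁻¹) := by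
      simp at c2; linear_combination 16 * c2
    have hqM := discr_eq M
    rw [hM, discr_conj, ← hM, c1, mul_zero, mul_zero, add_zero] at hqM
    have hqδ : discr δ = (μ - μ⁻¹) ^ 2 := by rw [← discr_conj δ y, discr_eq, hy]; simp
    have hM01 : ‖⇡M 0 1‖ < 1 / 16 := by
      have := norm_apply_le_hs (⇡M - 1) 0 1
      simp at this; norm_num at hg1 ⊢; linarith
    by_cases he : ⇡M 0 0 - ⇡M 1 1 = 0
    · have hM0 : ⇡M 0 1 = 0 := by simpa [he, hd] using c2.symm
      have h11 : ⇡M 1 1 = ⇡M 0 0 := by linear_combination -he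
      have hdet := det_eq M
      rw [hM0, h11, zero_mul, sub_zero] at hdet
      have h00 : ⇡M 0 0 = 1 := by
        have : (⇡M 0 0 - 1) * (⇡M 0 0 + 1) = 0 := by linear_combination hdet
        rcases mul_eq_zero.1 this with h | h
        · exact sub_eq_zero.1 h
        · have := norm_apply_le_hs (⇡M - 1) 0 0
          rw [Matrix.sub_apply, eq_neg_of_add_eq_zero_left h] at this
          norm_num at this hg1
          linarith
      have hM1 : M = 1 := by
        apply mat_injective; ext i j
        fin_cases i <;> fin_cases j <;> simp [mat_one, hM0, c1, h11, h00]
      rw [hM, mul_assoc, inv_mul_eq_one] at hM1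
      exact right_eq_mul.1 hM1
    · exfalso
      have hqg : discr g ≠ 0 := by rw [hqM]; exact pow_ne_zero 2 he
      have hlt' : ‖discr g‖ < ‖discr δ‖ := by
        rw [hqM, hqδ, norm_pow, norm_pow, c2, norm_mul, norm_mul]
        have : 0 < ‖μ - μ⁻¹‖ := norm_pos_iff.2 hd
        refine pow_lt_pow_left₀ ?_ (by positivity) two_ne_zero
        norm_num at hM01 ⊢
        nlinarith
      refine absurd (hmin g ⟨hg, ?_, hqg, hlt'.le.trans hδ.2.2.2⟩) (not_le.2 hlt')
      exact commute_of_commute (ne_one_of_discr hδ.2.2.1) (ne_neg_one_of_discr hδ.2.2.1)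
        hδ.2.1.symm hcomm
  obtain ⟨g, hg, hgR⟩ := hR y hthick
  have e : g * δ * g⁻¹ = (g * y) * (y⁻¹ * δ * y) * (g * y)⁻¹ := by group
  have h1 : discr (g * δ * g⁻¹) = discr δ := by simpa using discr_conj δ g⁻¹
  have h2 := hF (g * δ * g⁻¹) (H.mul_mem (H.mul_mem hg hδ.1) (H.inv_mem hg)) (by
    rw [e]
    refine (hs_conj_le _ _).trans ?_
    have h3 := hs_add (⇡(y⁻¹ * δ * y) - 1) 1
    rw [sub_add_cancel] at h3
    have h4 := pow_le_pow_left₀ (hs_nonneg _) hgR 2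
    exact mul_le_mul h4 (by linarith [hs_one_le]) (hs_nonneg _) (by positivity)) (by
    rw [h1]; exact hδ.2.2.1)
  rw [h1] at h2
  linarith [hδ.2.2.2]

/-- Elements moving a point by little are unipotent. -/
lemma Good.exists_unipotent_radius (hH : Good H) : ∃ ε > 0, ε < 1 / 8 ∧ ∀ x : SL2C, ∀ γ ∈ H,
    hs (⇡(x⁻¹ * γ * x) - 1) < ε → ∃ v, γ = unip v := by
  obtain ⟨q, hq, hgap⟩ := hH.discr_gap
  refine ⟨min (q / 20) (1 / 16), by positivity, (min_le_right _ _).trans_lt (by norm_num),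
    fun x γ hγ h => exists_unip ?_⟩
  have h1 := h.trans_le (min_le_left _ _)
  have h2 := h.trans_le (min_le_right _ _)
  have ht : ‖(⇡γ).trace - 2‖ ≤ 2 * hs (⇡(x⁻¹ * γ * x) - 1) := by
    have := norm_trace_le (⇡(x⁻¹ * γ * x) - 1)
    rw [trace_sub, trace_conj] at this
    simpa using this
  have hplus : ‖(⇡γ).trace + 2‖ ≤ 5 := by
    have : (⇡γ).trace + 2 = ((⇡γ).trace - 2) + 4 := by ring
    rw [this]
    refine (norm_add_le _ _).trans ?_
    norm_num; linarith
  have hd : ‖discr γ‖ = ‖(⇡γ).trace - 2‖ * ‖(⇡γ).trace + 2‖ := by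
    rw [← norm_mul, discr]; congr 1; ring
  have h0 : discr γ = 0 := by
    by_contra h0
    have := hgap γ hγ h0
    nlinarith [norm_nonneg ((⇡γ).trace - 2), norm_nonneg ((⇡γ).trace + 2)]
  have h3 : ((⇡γ).trace - 2) * ((⇡γ).trace + 2) = 0 := by rw [← h0, discr]; ring
  rcases mul_eq_zero.1 h3 with h4 | h4
  · exact sub_eq_zero.1 h4
  · rw [eq_neg_of_add_eq_zero_left h4] at ht
    norm_num at ht
    linarith

lemma shear_mul (s t : ℂ) : shear s * shear t = shear (s + t) := by
  apply mat_injective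
  rw [mat_mul, mat_shear, mat_shear, mat_shear]
  ext i j; fin_cases i <;> fin_cases j <;> simp [add_comm]

lemma shear_zero : shear 0 = 1 := by
  apply mat_injective
  rw [mat_shear, mat_one]
  ext i j; fin_cases i <;> fin_cases j <;> simp

lemma hs_shear_sub_one (t : ℂ) : hs (⇡(shear t) - 1) = ‖t‖ := by
  rw [hs, mat_shear]; simp

lemma norm_le_hs_shear (t : ℂ) : ‖t‖ ≤ hs ⇡(shear t) := by
  simpa [mat_shear] using norm_apply_le_hs ⇡(shear t) 0 1

lemma hs_shear_le (t : ℂ) : hs ⇡(shear t) ≤ ‖t‖ + 3 / 2 := by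
  have h := hs_add (⇡(shear t) - 1) 1
  rw [sub_add_cancel, hs_shear_sub_one] at h
  linarith [hs_one_le]

lemma shear_injective : Function.Injective shear := fun s t h => by
  simpa [mat_shear] using congrFun (congrFun (congrArg mat h) 0) 1

lemma eq_shear_of_diag {y : SL2C} (h0 : ⇡y 1 0 = 0) (h1 : ⇡y 0 0 = ⇡y 1 1) :
    ∃ s, y = shear s ∨ y = -shear s := by
  have hd := det_eq y
  rw [h0, ← h1] at hd
  have : (⇡y 0 0 - 1) * (⇡y 0 0 + 1) = 0 := by linear_combination hd
  rcases mul_eq_zero.1 this with h | h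
  · refine ⟨⇡y 0 1, Or.inl (mat_injective ?_)⟩
    ext i j; fin_cases i <;> fin_cases j <;> simp [mat_shear, h0, ← h1, sub_eq_zero.1 h]
  · refine ⟨-⇡y 0 1, Or.inr (mat_injective ?_)⟩
    ext i j
    fin_cases i <;> fin_cases j <;>
      simp [mat_neg, mat_shear, h0, ← h1, eq_neg_of_add_eq_zero_left h]

lemma eq_shear_of_commute {t : ℂ} (ht : t ≠ 0) {y : SL2C} (h : shear t * y = y * shear t) :
    ∃ s, y = shear s ∨ y = -shear s := by
  obtain ⟨h1, h2, -⟩ := (commute_iff _ _).1 h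
  simp only [mat_shear] at h1 h2
  refine eq_shear_of_diag (by simpa [ht] using h1) ?_
  simpa [ht, sub_eq_zero] using h2

/-- The diagonal matrix with entries `a`, `a⁻¹`. -/
noncomputable def dia (a : ℂ) (ha : a ≠ 0) : SL2C := mk a 0 0 a⁻¹ (by simp [ha])

lemma mat_dia (a : ℂ) (ha : a ≠ 0) : ⇡(dia a ha) = !![a, 0; 0, a⁻¹] := rfl

lemma dia_conj (a : ℂ) (ha : a ≠ 0) (t : ℂ) :
    (dia a ha)⁻¹ * shear t * dia a ha = shear (t / a ^ 2) := by
  apply mat_injective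
  rw [mat_mul, mat_mul, mat_inv, mat_dia, mat_shear, mat_shear]
  ext i j
  fin_cases i <;> fin_cases j <;> simp [ha]
  field_simp

/-- The conjugate subgroup `σ⁻¹ H σ`. -/
def conjSubgroup (σ : SL2C) (H : Subgroup SL2C) : Subgroup SL2C :=
  H.comap (MulAut.conj σ).toMonoidHom

lemma mem_conjSubgroup {σ : SL2C} {H : Subgroup SL2C} {g : SL2C} :
    g ∈ conjSubgroup σ H ↔ σ * g * σ⁻¹ ∈ H := Iff.rfl

lemma Good.conj (hH : Good H) (σ : SL2C) : Good (conjSubgroup σ H) where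
  neg := by rw [mem_conjSubgroup]; simpa using hH.neg
  disc := by
    obtain ⟨ε, hε, h⟩ := hH.disc
    have hσ := hs_pos σ
    refine ⟨ε / hs ⇡σ ^ 2, by positivity, fun g hg hlt => ?_⟩
    have h1 := h _ hg (by
      have e : ⇡(σ * g * σ⁻¹) - 1 = ⇡σ * (⇡g - 1) * ⇡σ⁻¹ := by
        rw [mul_sub, sub_mul, mul_one, mat_mul_inv, mat_mul, mat_mul]
      rw [MulEquiv.coe_toMonoidHom, MulAut.conj_apply, e]
      rw [lt_div_iff₀ (by positivity)] at hlt
      refine lt_of_le_of_lt ?_ hlt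
      refine (Matrix.hs_mul _ _).trans ?_
      rw [hs_inv]
      nlinarith [Matrix.hs_mul ⇡σ (⇡g - 1)])
    rw [MulEquiv.coe_toMonoidHom, MulAut.conj_apply, mul_inv_eq_one] at h1
    exact mul_eq_left.1 h1
  thick := by
    intro ε hε
    obtain ⟨R, h⟩ := hH.thick ε hε
    refine ⟨hs ⇡σ * R, fun x hx => ?_⟩
    obtain ⟨γ, hγ, h1⟩ := h (σ * x) (fun γ hγ hlt => by
      have := hx (σ⁻¹ * γ * σ) (by
        rw [mem_conjSubgroup]
        have e : σ * (σ⁻¹ * γ * σ) * σ⁻¹ = γ := by group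
        rwa [e]) (by
        have e : x⁻¹ * (σ⁻¹ * γ * σ) * x = (σ * x)⁻¹ * γ * (σ * x) := by group
        rwa [e])
      rw [mul_assoc, inv_mul_eq_one] at this
      exact right_eq_mul.1 this)
    refine ⟨σ⁻¹ * γ * σ, ?_, ?_⟩
    · rw [mem_conjSubgroup]
      have e : σ * (σ⁻¹ * γ * σ) * σ⁻¹ = γ := by group
      rwa [e]
    · have e : σ⁻¹ * γ * σ * x = σ⁻¹ * (γ * (σ * x)) := by group
      rw [e]
      refine (hs_mul_le _ _).trans ?_
      rw [hs_inv]
      exact mul_le_mul_of_nonneg_left h1 (hs_nonneg _)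
  tf := by
    intro g hg n hn h
    have := hH.tf _ hg n hn (by
      rw [MulEquiv.coe_toMonoidHom, MulAut.conj_apply, conj_pow, h]; simp)
    rw [MulEquiv.coe_toMonoidHom, MulAut.conj_apply] at this
    refine this.imp (fun h1 => ?_) (fun h1 => ?_)
    · rw [mul_inv_eq_one] at h1
      exact mul_eq_left.1 h1
    · rw [mul_inv_eq_iff_eq_mul, neg_one_mul, ← mul_neg_one] at h1
      exact mul_left_cancel h1

/-- Cocompactness of the cusp subgroup on horospheres. -/
lemma Good.exists_shear_near (hH : Good H) {t₀ : ℂ} (ht₀ : t₀ ≠ 0) (h₀ : shear t₀ ∈ H) :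
    ∃ R, ∀ z : ℂ, ∃ t, shear t ∈ H ∧ ‖z - t‖ ≤ R := by
  obtain ⟨εd, hεd, hdisc⟩ := hH.disc
  obtain ⟨a, ha⟩ := IsAlgClosed.exists_pow_nat_eq (16 * t₀) (n := 2) (by norm_num)
  have ha0 : a ≠ 0 := by
    rintro rfl; apply ht₀; simpa using ha.symm
  have hna : 0 < ‖a ^ 2‖ := norm_pos_iff.2 (pow_ne_zero 2 ha0)
  obtain ⟨R, hR⟩ := hH.thick (min (1 / 8) (εd / ‖a ^ 2‖)) (by positivity)
  set D := dia a ha0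
  have hconj : ∀ z t, (shear z * D)⁻¹ * shear t * (shear z * D) = shear (t / a ^ 2) := by
    intro z t
    rw [← dia_conj a ha0 t]
    have : (shear z)⁻¹ * shear t * shear z = shear t := by
      rw [shear_inv, shear_mul, shear_mul]; congr 1; ring
    calc _ = D⁻¹ * ((shear z)⁻¹ * shear t * shear z) * D := by group
      _ = _ := by rw [this]
  have h16 : t₀ / a ^ 2 = 1 / 16 := by rw [ha]; field_simp
  have hpt : ∀ z, ∃ γ ∈ H, hs ⇡(γ * (shear z * D)) ≤ R := by
    intro z
    refine hR _ fun γ hγ hlt => ?_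
    have hlt1 := hlt.trans_le (min_le_left _ _)
    have hlt2 := hlt.trans_le (min_le_right _ _)
    have hc := hH.zassenhaus (shear z * D) h₀ hγ (by
      rw [hconj, hs_shear_sub_one, h16]; norm_num) hlt1
    obtain ⟨t, rfl | rfl⟩ := eq_shear_of_commute ht₀ hc
    · rw [hconj, hs_shear_sub_one, norm_div] at hlt2
      refine hdisc _ hγ ?_
      rw [hs_shear_sub_one]
      exact (div_lt_div_iff_of_pos_right hna).1 hlt2
    · exfalso
      rw [mul_neg, neg_mul, hconj] at hlt1
      have h2 := norm_apply_le_hs (⇡(-shear (t / a ^ 2)) - 1) 0 0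
      rw [mat_neg, mat_shear] at h2 hlt1
      have h4 : (-!![1, t / a ^ 2; 0, 1] - 1 : Matrix (Fin 2) (Fin 2) ℂ) 0 0 = -2 := by
        simp; norm_num
      rw [h4, norm_neg, Complex.norm_ofNat] at h2
      linarith
  set F : Set SL2C := {f | f ∈ H ∧ hs ⇡f ≤ R ^ 2 * 2} ∩ {f | ∃ δ ∈ H, δ * shear t₀ * δ⁻¹ = f}
  have hF : F.Finite := (hH.finite _).inter_of_left _
  have hch : ∀ f ∈ F, ∃ δ, δ ∈ H ∧ δ * shear t₀ * δ⁻¹ = f := fun f hf => by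
    obtain ⟨δ, h1, h2⟩ := hf.2
    exact ⟨δ, h1, h2⟩
  choose! δ hδ using hch
  obtain ⟨B, hB⟩ := (hF.image fun f => hs ⇡(δ f)).bddAbove
  refine ⟨B * R * hs ⇡D, fun z => ?_⟩
  obtain ⟨γ, hγ, hγR⟩ := hpt z
  have hf : γ * shear t₀ * γ⁻¹ ∈ F := by
    refine ⟨⟨H.mul_mem (H.mul_mem hγ h₀) (H.inv_mem hγ), ?_⟩, γ, hγ, rfl⟩
    have e : γ * shear t₀ * γ⁻¹ = (γ * (shear z * D)) * ((shear z * D)⁻¹ * shear t₀ *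
      (shear z * D)) * (γ * (shear z * D))⁻¹ := by group
    rw [e, hconj, h16]
    refine (hs_conj_le _ _).trans (mul_le_mul (pow_le_pow_left₀ (hs_nonneg _) hγR 2) ?_
      (hs_nonneg _) (by positivity))
    refine (hs_shear_le _).trans ?_
    norm_num
  obtain ⟨hδH, hδ2⟩ := hδ _ hf
  have hBδ : hs ⇡(δ (γ * shear t₀ * γ⁻¹)) ≤ B := hB ⟨_, hf, rfl⟩
  set d := δ (γ * shear t₀ * γ⁻¹)
  have hc : shear t₀ * (d⁻¹ * γ) = d⁻¹ * γ * shear t₀ := by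
    have h1 : shear t₀ = d⁻¹ * (γ * shear t₀ * γ⁻¹) * d := by rw [← hδ2]; group
    calc shear t₀ * (d⁻¹ * γ) = d⁻¹ * (γ * shear t₀ * γ⁻¹) * d * (d⁻¹ * γ) := by rw [← h1]
      _ = _ := by group
  have hR0 : 0 ≤ R := (hs_nonneg _).trans hγR
  have fin : ∀ s, hs ⇡(shear s * (shear z * D)) ≤ B * R → ‖z + s‖ ≤ B * R * hs ⇡D := by
    intro s hs1
    calc ‖z + s‖ ≤ hs ⇡(shear (z + s)) := norm_le_hs_shear _
      _ = hs ⇡(shear s * (shear z * D) * D⁻¹) := by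
        rw [add_comm, ← shear_mul]; congr 2; group
      _ ≤ hs ⇡(shear s * (shear z * D)) * hs ⇡D := by
        refine (hs_mul_le _ _).trans ?_
        rw [hs_inv]
      _ ≤ _ := mul_le_mul_of_nonneg_right hs1 (hs_nonneg _)
  have hfin2 : hs ⇡(d⁻¹ * γ * (shear z * D)) ≤ B * R := by
    rw [mul_assoc]
    refine (hs_mul_le _ _).trans ?_
    rw [hs_inv]
    exact mul_le_mul hBδ hγR (hs_nonneg _) ((hs_nonneg _).trans hBδ)
  have hmem : d⁻¹ * γ ∈ H := H.mul_mem (H.inv_mem hδH) hγ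
  obtain ⟨s, h | h⟩ := eq_shear_of_commute ht₀ hc
  · rw [h] at hfin2 hmem
    refine ⟨-s, ?_, ?_⟩
    · rw [← shear_inv]; exact H.inv_mem hmem
    · rw [sub_neg_eq_add]; exact fin s hfin2
  · rw [h, neg_mul, mat_neg, hs_neg] at hfin2
    rw [h] at hmem
    have hmem := hH.neg_mem hmem
    rw [neg_neg] at hmem
    refine ⟨-s, ?_, ?_⟩
    · rw [← shear_inv]; exact H.inv_mem hmem
    · rw [sub_neg_eq_add]; exact fin s hfin2

lemma shear_conj_triangular {g : SL2C} {μ s : ℂ} (hμ : μ ≠ 0) (hg : ⇡g = !![μ, s; 0, μ⁻¹])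
    (t : ℂ) : g * shear t * g⁻¹ = shear (μ ^ 2 * t) := by
  apply mat_injective
  rw [mat_mul, mat_mul, mat_inv, hg, mat_shear, mat_shear]
  ext i j
  fin_cases i <;> fin_cases j <;> simp [hμ]
  ring

/-- The stabilizer of a cusp consists of parabolic elements. -/
lemma Good.eq_shear_of_triangular (hH : Good H) {t₀ : ℂ} (ht₀ : t₀ ≠ 0) (h₀ : shear t₀ ∈ H)
    {g : SL2C} (hg : g ∈ H) (hg0 : ⇡g 1 0 = 0) : ∃ t, g = shear t ∨ g = -shear t := by
  set μ := ⇡g 0 0 with hμ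
  have hdet := det_eq g
  rw [hg0, mul_zero, sub_zero, ← hμ] at hdet
  have hμ0 : μ ≠ 0 := left_ne_zero_of_mul_eq_one hdet
  have h11 : ⇡g 1 1 = μ⁻¹ := eq_inv_of_mul_eq_one_right hdet
  have hgm : ⇡g = !![μ, ⇡g 0 1; 0, μ⁻¹] := by
    ext i j; fin_cases i <;> fin_cases j <;> simp [hg0, h11, hμ]
  have hgm' : ⇡g⁻¹ = !![μ⁻¹, -⇡g 0 1; 0, μ⁻¹⁻¹] := by
    rw [mat_inv]
    ext i j; fin_cases i <;> fin_cases j <;> simp [hg0, h11, hμ]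
  have root : ∀ ν : ℂ, ν ≠ 0 → ‖ν‖ ≤ 1 → (∀ t, shear t ∈ H → shear (ν ^ 2 * t) ∈ H) →
      ∃ k : ℕ, k ≠ 0 ∧ ν ^ k = 1 := by
    intro ν hν hν1 hst
    have hfin : {t | shear t ∈ H ∧ ‖t‖ ≤ ‖t₀‖}.Finite := by
      refine Set.Finite.of_finite_image ((hH.finite (‖t₀‖ + 3 / 2)).subset ?_)
        shear_injective.injOn
      rintro _ ⟨t, ht, rfl⟩
      exact ⟨ht.1, (hs_shear_le t).trans (by linarith [ht.2])⟩
    have hpow : ∀ n : ℕ, (ν ^ 2) ^ n * t₀ ∈ {t | shear t ∈ H ∧ ‖t‖ ≤ ‖t₀‖} := by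
      intro n
      induction n with
      | zero => simpa using h₀
      | succ n ih =>
        refine ⟨?_, ?_⟩
        · have := hst _ ih.1
          rwa [← mul_assoc, ← pow_succ'] at this
        · rw [norm_mul, norm_pow, norm_pow]
          exact mul_le_of_le_one_left (norm_nonneg _) (pow_le_one₀ (by positivity)
            (pow_le_one₀ (norm_nonneg _) hν1))
    obtain ⟨m, n, hmn, he⟩ : ∃ m n : ℕ, m < n ∧ (ν ^ 2) ^ m * t₀ = (ν ^ 2) ^ n * t₀ := by
      have : ¬ Function.Injective fun n : ℕ => (ν ^ 2) ^ n * t₀ := fun hinj =>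
        Set.infinite_range_of_injective hinj (hfin.subset (Set.range_subset_iff.2 hpow))
      simp only [Function.Injective, not_forall] at this
      obtain ⟨m, n, he, hne⟩ := this
      rcases lt_or_gt_of_ne hne with h | h
      · exact ⟨m, n, h, he⟩
      · exact ⟨n, m, h, he.symm⟩
    refine ⟨2 * (n - m), by omega, ?_⟩
    have he := mul_right_cancel₀ ht₀ he
    rw [← Nat.sub_add_cancel hmn.le, pow_add] at he
    rw [pow_mul]
    exact (right_eq_mul₀ (pow_ne_zero _ (pow_ne_zero _ hν))).1 he
  have hroot : ∃ k : ℕ, k ≠ 0 ∧ μ ^ k = 1 := by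
    rcases le_total ‖μ‖ 1 with h | h
    · refine root μ hμ0 h fun t ht => ?_
      rw [← shear_conj_triangular hμ0 hgm]
      exact H.mul_mem (H.mul_mem hg ht) (H.inv_mem hg)
    · obtain ⟨k, hk, h1⟩ := root μ⁻¹ (inv_ne_zero hμ0) (by
        rw [norm_inv]; exact inv_le_one_of_one_le₀ h) fun t ht => by
        rw [← shear_conj_triangular (inv_ne_zero hμ0) hgm']
        exact H.mul_mem (H.mul_mem (H.inv_mem hg) ht) (H.inv_mem (H.inv_mem hg))
      exact ⟨k, hk, by simpa using h1⟩
  obtain ⟨k, hk, hμk⟩ := hroot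
  by_cases hd : μ - μ⁻¹ = 0
  · exact eq_shear_of_diag hg0 (by rw [h11, ← hμ]; exact sub_eq_zero.1 hd)
  · obtain ⟨b, hb⟩ := shear_conj hgm hd 0
    have hpow : ∀ n : ℕ, ⇡(((shear b)⁻¹ * g * shear b) ^ n) = !![μ ^ n, 0; 0, (μ ^ n)⁻¹] := by
      intro n
      induction n with
      | zero => rw [pow_zero, mat_one]; ext i j; fin_cases i <;> fin_cases j <;> simp
      | succ n ih =>
        rw [pow_succ, mat_mul, ih, hb]
        ext i j; fin_cases i <;> fin_cases j <;> simp [pow_succ, mul_comm]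
    have h1 : ((shear b)⁻¹ * g * shear b) ^ k = 1 := by
      apply mat_injective
      rw [hpow, hμk, mat_one]
      ext i j; fin_cases i <;> fin_cases j <;> simp
    have e : ((shear b)⁻¹ * g * shear b) ^ k = (shear b)⁻¹ * g ^ k * shear b := by
      simpa using conj_pow (i := k) (a := (shear b)⁻¹) (b := g)
    rw [e, mul_assoc, inv_mul_eq_one] at h1
    rcases hH.tf g hg k hk (right_eq_mul.1 h1 |> fun h => h) with h | h
    · exact ⟨0, Or.inl (by rw [shear_zero, h])⟩
    · exact ⟨0, Or.inr (by rw [shear_zero, h])⟩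

/-- `v` is a shortest translation vector of `H` in its direction. -/
structure Shortest (H : Subgroup SL2C) (v : Fin 2 → ℂ) : Prop where
  ne_zero : v ≠ 0
  mem : unip v ∈ H
  one_le : ∀ c : ℂ, c ≠ 0 → unip (c • v) ∈ H → 1 ≤ ‖c‖

/-- No non-trivial element of `H` moves the point `x` by little. -/
def Thick (H : Subgroup SL2C) (ε : ℝ) (x : SL2C) : Prop :=
  ∀ γ ∈ H, hs (⇡(x⁻¹ * γ * x) - 1) < ε → γ = 1

/-- The horosphere attached to a vector. -/
def Sphere (ε : ℝ) (w : Fin 2 → ℂ) (y : SL2C) : Prop := euc (⇡y⁻¹ *ᵥ w) ^ 2 = ε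

lemma unip_zero : unip 0 = 1 := by
  apply mat_injective
  rw [unip_val, mat_one]
  ext i j; fin_cases i <;> fin_cases j <;> simp [nilp]

lemma hs_conj_unip_sub_one (x : SL2C) (v : Fin 2 → ℂ) :
    hs (⇡(x⁻¹ * unip v * x) - 1) = euc (⇡x⁻¹ *ᵥ v) ^ 2 := by
  rw [conj_unip', hs_unip_sub_one]

lemma Good.exists_shortest (hH : Good H) {v : Fin 2 → ℂ} (hv : v ≠ 0) (hm : unip v ∈ H) :
    ∃ c : ℂ, Shortest H (c • v) ∧ ‖c‖ ≤ 1 := by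
  set S : Set SL2C := {g | (g ∈ H ∧ hs ⇡g ≤ euc v ^ 2 + 3 / 2) ∧ g ≠ 1 ∧
    ∃ c : ℂ, g = unip (c • v) ∧ ‖c‖ ≤ 1} with hS
  have hfin : S.Finite := (hH.finite (euc v ^ 2 + 3 / 2)).subset fun g hg => hg.1
  have hbd (w : Fin 2 → ℂ) : hs ⇡(unip w) ≤ euc w ^ 2 + 3 / 2 := by
    have h := hs_add (⇡(unip w) - 1) 1
    rw [sub_add_cancel, hs_unip_sub_one] at h
    linarith [hs_one_le]
  have hne : S.Nonempty := ⟨unip v, ⟨hm, hbd v⟩, unip_ne_one hv, 1, by simp, by simp⟩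
  obtain ⟨g, ⟨⟨hgH, -⟩, hg1, c, rfl, hc⟩, hmin⟩ :=
    Set.exists_min_image S (fun g => hs (⇡g - 1)) hfin hne
  have hc0 : c ≠ 0 := by
    rintro rfl
    exact hg1 (by rw [zero_smul, unip_zero])
  refine ⟨c, ⟨smul_ne_zero hc0 hv, hgH, fun d hd hdH => ?_⟩, hc⟩
  by_contra! hlt
  have hle : ‖d * c‖ ≤ 1 := by
    rw [norm_mul]; nlinarith [norm_nonneg d, norm_nonneg c]
  have hev := euc_pos hv
  have hcp : 0 < ‖c‖ := norm_pos_iff.2 hc0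
  rw [smul_smul] at hdH
  have := hmin (unip ((d * c) • v)) ⟨⟨hdH, (hbd _).trans ?_⟩, unip_ne_one
    (smul_ne_zero (mul_ne_zero hd hc0) hv), d * c, rfl, hle⟩
  · simp only [hs_unip_sub_one, euc_smul] at this
    rw [norm_mul, mul_assoc, mul_pow] at this
    have h1 : 0 < (‖c‖ * euc v) ^ 2 := by positivity
    have h2 : ‖d‖ ^ 2 < 1 := by nlinarith [norm_nonneg d]
    nlinarith
  · rw [euc_smul]
    have : ‖d * c‖ * euc v ≤ euc v := by nlinarith
    have := pow_le_pow_left₀ (by positivity) this 2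
    linarith

/-- Vectors of unipotent elements that move a point by little are parallel. -/
lemma Good.parallel (hH : Good H) {x : SL2C} {v w : Fin 2 → ℂ} (hv : unip v ∈ H) (hv0 : v ≠ 0)
    (hw : unip w ∈ H) (h1 : euc (⇡x⁻¹ *ᵥ v) ^ 2 < 1 / 8) (h2 : euc (⇡x⁻¹ *ᵥ w) ^ 2 < 1 / 8) :
    ∃ c : ℂ, w = c • v := by
  rw [← hs_conj_unip_sub_one] at h1 h2
  exact exists_smul_of_det hv0 (unip_commute (hH.zassenhaus x hv hw h1 h2))

lemma euc_inv_mulVec_smul (x : SL2C) (c : ℂ) (v : Fin 2 → ℂ) :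
    euc (⇡x⁻¹ *ᵥ (c • v)) = ‖c‖ * euc (⇡x⁻¹ *ᵥ v) := by
  rw [mulVec_smul, euc_smul]

lemma euc_inv_mul_mulVec (x g : SL2C) (v : Fin 2 → ℂ) :
    euc (⇡(x * g)⁻¹ *ᵥ v) ≤ hs ⇡g * euc (⇡x⁻¹ *ᵥ v) := by
  rw [_root_.mul_inv_rev, mat_mul, ← mulVec_mulVec, ← hs_inv g]
  exact euc_mulVec _ _

lemma Shortest.eq_of_smul {w : Fin 2 → ℂ} {c : ℂ} (hw : Shortest H w) (hcw : Shortest H (c • w)) :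
    ‖c‖ = 1 := by
  have hc : c ≠ 0 := by
    rintro rfl
    exact hcw.ne_zero (zero_smul _ _)
  refine le_antisymm ?_ (hw.one_le c hc hcw.mem)
  have := hcw.one_le c⁻¹ (inv_ne_zero hc) (by rw [inv_smul_smul₀ hc]; exact hw.mem)
  rw [norm_inv] at this
  exact (one_le_inv₀ (norm_pos_iff.2 hc)).1 this

lemma Good.thick_of_sphere (hH : Good H) {ε : ℝ} (hε : ε < 1 / 8)
    (hu : ∀ x : SL2C, ∀ γ ∈ H, hs (⇡(x⁻¹ * γ * x) - 1) < ε → ∃ v, γ = unip v)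
    {w : Fin 2 → ℂ} (hw : Shortest H w) {y : SL2C} (hy : Sphere ε w y) : Thick H ε y := by
  intro γ hγ hlt
  obtain ⟨v, rfl⟩ := hu y γ hγ hlt
  rw [hs_conj_unip_sub_one] at hlt
  have hy' : euc (⇡y⁻¹ *ᵥ w) ^ 2 = ε := hy
  obtain ⟨c, rfl⟩ := hH.parallel (x := y) hw.mem hw.ne_zero hγ (by rw [hy']; exact hε)
    (hlt.trans hε)
  by_cases hc : c = 0
  · rw [hc, zero_smul, unip_zero]
  · have h1 := hw.one_le c hc hγ
    rw [euc_inv_mulVec_smul, mul_pow, hy'] at hlt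
    have : 0 ≤ ε := by rw [← hy']; positivity
    nlinarith [one_le_pow₀ h1 (n := 2)]

lemma Good.thick_or_thin (hH : Good H) {ε : ℝ}
    (hu : ∀ x : SL2C, ∀ γ ∈ H, hs (⇡(x⁻¹ * γ * x) - 1) < ε → ∃ v, γ = unip v) (x : SL2C) :
    Thick H ε x ∨ ∃ w, Shortest H w ∧ euc (⇡x⁻¹ *ᵥ w) ^ 2 < ε := by
  by_cases hx : Thick H ε x
  · exact Or.inl hx
  · refine Or.inr ?_
    unfold Thick at hx
    push Not at hx
    obtain ⟨γ, hγ, hlt, hne⟩ := hx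
    obtain ⟨v, rfl⟩ := hu x γ hγ hlt
    have hv : v ≠ 0 := by
      rintro rfl
      exact hne unip_zero
    obtain ⟨c, hc, hc1⟩ := hH.exists_shortest hv hγ
    refine ⟨c • v, hc, lt_of_le_of_lt ?_ hlt⟩
    rw [hs_conj_unip_sub_one, euc_inv_mulVec_smul]
    have := euc_nonneg (⇡x⁻¹ *ᵥ v)
    exact pow_le_pow_left₀ (by positivity) (by nlinarith) 2

lemma Thick.le {ε : ℝ} {x : SL2C} (hx : Thick H ε x) {w : Fin 2 → ℂ} (hw : Shortest H w) :
    ε ≤ euc (⇡x⁻¹ *ᵥ w) ^ 2 := by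
  by_contra! h
  rw [← hs_conj_unip_sub_one] at h
  exact unip_ne_one hw.ne_zero (hx _ hw.mem h)

lemma hs_frame_le {ε : ℝ} (hε : 0 < ε) {e : Fin 2 → ℂ} (he : e ≠ 0) (h1 : ε ≤ euc e ^ 2)
    (h2 : euc e ^ 2 ≤ 4 * ε) : hs ⇡(frame e he) ≤ √(4 * ε + ε⁻¹) := by
  refine Real.le_sqrt_of_sq_le ?_
  rw [hs_frame]
  gcongr

/-- Near a point lying close to a horosphere there is a point of the horosphere. -/
lemma exists_sphere_near {ε : ℝ} (hε : 0 < ε) {x : SL2C} {w : Fin 2 → ℂ} (hw : w ≠ 0)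
    (h1 : ε ≤ euc (⇡x⁻¹ *ᵥ w) ^ 2) (h2 : euc (⇡x⁻¹ *ᵥ w) ^ 2 ≤ 4 * ε) :
    ∃ y, Sphere ε w y ∧ hs ⇡(x⁻¹ * y) ≤ 4 * ε + ε⁻¹ := by
  set e := ⇡x⁻¹ *ᵥ w with he
  have he0 : e ≠ 0 := mulVec_ne_zero _ hw
  have hpos := euc_pos he0
  set c : ℂ := ((√ε / euc e : ℝ) : ℂ) with hc
  have hcn : ‖c‖ = √ε / euc e := by
    rw [hc, Complex.norm_real, Real.norm_of_nonneg (by positivity)]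
  have hce : euc (c • e) ^ 2 = ε := by
    rw [euc_smul, hcn, div_mul_cancel₀ _ hpos.ne', Real.sq_sqrt hε.le]
  have hc0 : c • e ≠ 0 := by
    intro h
    rw [h] at hce
    have : euc 0 = 0 := by simp [euc]
    rw [this] at hce
    norm_num at hce
    exact hε.ne hce
  refine ⟨x * frame e he0 * (frame (c • e) hc0)⁻¹, ?_, ?_⟩
  · unfold Sphere
    have : (x * frame e he0 * (frame (c • e) hc0)⁻¹)⁻¹
        = frame (c • e) hc0 * ((frame e he0)⁻¹ * x⁻¹) := by group
    rw [this, mat_mul, mat_mul, ← mulVec_mulVec, ← mulVec_mulVec, ← he, frame_inv_e1, frame_e1, hce]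
  · have : x⁻¹ * (x * frame e he0 * (frame (c • e) hc0)⁻¹)
        = frame e he0 * (frame (c • e) hc0)⁻¹ := by group
    rw [this]
    refine (hs_mul_le _ _).trans ?_
    rw [hs_inv]
    have a1 := hs_frame_le hε he0 h1 h2
    have a2 := hs_frame_le hε hc0 hce.ge (by rw [hce]; linarith)
    calc _ ≤ √(4 * ε + ε⁻¹) * √(4 * ε + ε⁻¹) :=
          mul_le_mul a1 a2 (hs_nonneg _) (Real.sqrt_nonneg _)
      _ = _ := Real.mul_self_sqrt (by positivity)

lemma eq_shear_of_mulVec_e1 {z : SL2C} (h : ⇡z *ᵥ ![1, 0] = ![1, 0]) : ∃ s, z = shear s := by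
  rw [mulVec_e1] at h
  have h0 : ⇡z 0 0 = 1 := congrFun h 0
  have h1 : ⇡z 1 0 = 0 := congrFun h 1
  have hd := det_eq z
  rw [h0, h1] at hd
  refine ⟨⇡z 0 1, mat_injective ?_⟩
  have h2 : ⇡z 1 1 = 1 := by linear_combination hd
  rw [mat_shear]
  ext i j; fin_cases i <;> fin_cases j <;> simp [h0, h1, h2]

lemma shear_e1 (s : ℂ) : ⇡(shear s) *ᵥ ![1, 0] = ![1, 0] := by
  rw [mulVec_e1, mat_shear]; simp

/-- A property stable under bounded steps within a horosphere holds on all of it. -/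
lemma sphere_chain {ε : ℝ} (hε : 0 < ε) {w : Fin 2 → ℂ} (hw : w ≠ 0) {p : SL2C → Prop}
    (hp : ∀ x y, Sphere ε w x → Sphere ε w y → hs ⇡(x⁻¹ * y) ≤ 3 * (4 * ε + ε⁻¹) → p x → p y)
    {x y : SL2C} (hx : Sphere ε w x) (hy : Sphere ε w y) (hpx : p x) : p y := by
  have he0 (x : SL2C) : ⇡x⁻¹ *ᵥ w ≠ 0 := mulVec_ne_zero _ hw
  have key (n : ℕ) : ∀ x : SL2C, Sphere ε w x → p x → ∀ s : ℂ, ‖s‖ ≤ n →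
      p (x * (frame _ (he0 x) * shear s * (frame _ (he0 x))⁻¹)) := by
    have hstay (x : SL2C) (hx : Sphere ε w x) (s : ℂ) :
        ⇡(x * (frame _ (he0 x) * shear s * (frame _ (he0 x))⁻¹))⁻¹ *ᵥ w = ⇡x⁻¹ *ᵥ w := by
      have : (x * (frame _ (he0 x) * shear s * (frame _ (he0 x))⁻¹))⁻¹
          = frame _ (he0 x) * ((shear s)⁻¹ * ((frame _ (he0 x))⁻¹ * x⁻¹)) := by group
      rw [this]
      simp only [mat_mul, ← mulVec_mulVec]
      rw [frame_inv_e1, shear_inv, shear_e1, frame_e1]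
    intro x hx hpx
    induction n with
    | zero =>
      intro s hs0
      have : s = 0 := by simpa using hs0
      rw [this, shear_zero, mul_one, mul_inv_cancel, mul_one]
      exact hpx
    | succ n ih =>
      intro s hs1
      have hn : (0 : ℝ) < n + 1 := by positivity
      have hn' : (n + 1 : ℂ) ≠ 0 := by exact_mod_cast hn.ne'
      have hnn : ‖(n + 1 : ℂ)‖ = n + 1 := by
        have := Complex.norm_natCast (n + 1)
        push_cast at this
        exact this
      have h1 := ih (s * (n / (n + 1))) (by
        rw [norm_mul, norm_div, hnn, Complex.norm_natCast]
        push_cast at hs1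
        calc ‖s‖ * (n / (n + 1)) ≤ (n + 1) * (n / (n + 1)) := by gcongr
          _ = n := by field_simp)
      refine hp _ _ ?_ ?_ ?_ h1
      · rw [Sphere, hstay x hx]; exact hx
      · rw [Sphere, hstay x hx]; exact hx
      · have : (x * (frame _ (he0 x) * shear (s * (n / (n + 1))) * (frame _ (he0 x))⁻¹))⁻¹ *
            (x * (frame _ (he0 x) * shear s * (frame _ (he0 x))⁻¹))
            = frame _ (he0 x) * ((shear (s * (n / (n + 1))))⁻¹ * shear s) *
              (frame _ (he0 x))⁻¹ := by
          group
        rw [this, shear_inv, shear_mul]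
        refine (hs_conj_le _ _).trans ?_
        have hx' : euc (⇡x⁻¹ *ᵥ w) ^ 2 = ε := hx
        have a1 := hs_frame_le hε (he0 x) hx'.ge (by rw [hx']; linarith)
        have a2 := pow_le_pow_left₀ (hs_nonneg _) a1 2
        rw [Real.sq_sqrt (by positivity)] at a2
        have a3 : ‖-(s * (n / (n + 1))) + s‖ ≤ 1 := by
          have : -(s * (n / (n + 1))) + s = s / (n + 1) := by field_simp; ring
          rw [this, norm_div, hnn, div_le_one hn]
          exact_mod_cast hs1
        have a4 := hs_shear_le (-(s * (n / (n + 1))) + s)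
        have := hs_nonneg ⇡(shear (-(s * (n / (n + 1))) + s))
        rw [mul_comm 3]
        exact mul_le_mul a2 (by linarith) this (by positivity)
  obtain ⟨s, hs'⟩ : ∃ s, (x * frame _ (he0 x))⁻¹ * (y * frame _ (he0 y)) = shear s := by
    apply eq_shear_of_mulVec_e1
    rw [_root_.mul_inv_rev]
    simp only [mat_mul, ← mulVec_mulVec]
    rw [frame_e1, mulVec_inv_mulVec, frame_inv_e1]
  obtain ⟨n, hn⟩ := exists_nat_ge ‖s‖
  have h1 := key n x hx hpx s hn
  have hz : x * (frame _ (he0 x) * shear s * (frame _ (he0 x))⁻¹)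
      = y * (frame _ (he0 y) * (frame _ (he0 x))⁻¹) := by
    rw [← hs']; group
  rw [hz] at h1
  have hx' : euc (⇡x⁻¹ *ᵥ w) ^ 2 = ε := hx
  have hy' : euc (⇡y⁻¹ *ᵥ w) ^ 2 = ε := hy
  refine hp _ _ ?_ hy ?_ h1
  · have : (y * (frame _ (he0 y) * (frame _ (he0 x))⁻¹))⁻¹
        = frame _ (he0 x) * ((frame _ (he0 y))⁻¹ * y⁻¹) := by group
    rw [Sphere, this]
    simp only [mat_mul, ← mulVec_mulVec]
    rw [frame_inv_e1, frame_e1, hx']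
  · have : (y * (frame _ (he0 y) * (frame _ (he0 x))⁻¹))⁻¹ * y
        = frame _ (he0 x) * (frame _ (he0 y))⁻¹ := by group
    rw [this]
    refine (hs_mul_le _ _).trans ?_
    rw [hs_inv]
    have a1 := hs_frame_le hε (he0 x) hx'.ge (by rw [hx']; linarith)
    have a2 := hs_frame_le hε (he0 y) hy'.ge (by rw [hy']; linarith)
    calc _ ≤ √(4 * ε + ε⁻¹) * √(4 * ε + ε⁻¹) :=
          mul_le_mul a1 a2 (hs_nonneg _) (Real.sqrt_nonneg _)
      _ = 4 * ε + ε⁻¹ := Real.mul_self_sqrt (by positivity)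
      _ ≤ _ := by linarith [show 0 < 4 * ε + ε⁻¹ by positivity]

/-- The lower triangular elementary matrix. -/
def lowerShear (t : ℂ) : SL2C := mk 1 0 t 1 (by ring)

lemma mat_lowerShear (t : ℂ) : ⇡(lowerShear t) = !![1, 0; t, 1] := rfl

lemma lowerShear_mul (s t : ℂ) : lowerShear s * lowerShear t = lowerShear (s + t) := by
  apply mat_injective
  rw [mat_mul, mat_lowerShear, mat_lowerShear, mat_lowerShear]
  ext i j; fin_cases i <;> fin_cases j <;> simp

lemma hs_lowerShear_le (t : ℂ) : hs ⇡(lowerShear t) ≤ ‖t‖ + 3 / 2 := by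
  have h := hs_add (⇡(lowerShear t) - 1) 1
  have h1 : hs (⇡(lowerShear t) - 1) = ‖t‖ := by
    rw [hs, mat_lowerShear]; simp
  rw [sub_add_cancel, h1] at h
  linarith [hs_one_le]

lemma eq_shear_mul_of_ne_zero {g : SL2C} (h : ⇡g 1 0 ≠ 0) :
    g = shear ((⇡g 0 0 - 1) / ⇡g 1 0) * lowerShear (⇡g 1 0) * shear ((⇡g 1 1 - 1) / ⇡g 1 0) := by
  have hd := det_eq g
  have h01 : ⇡g 0 1 = (⇡g 0 0 * ⇡g 1 1 - 1) / ⇡g 1 0 := by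
    rw [eq_div_iff h]; linear_combination -hd
  apply mat_injective
  rw [mat_mul, mat_mul, mat_shear, mat_shear, mat_lowerShear]
  ext i j
  fin_cases i <;> fin_cases j <;> simp [mul_apply, Fin.sum_univ_two, h01] <;> field_simp <;> ring

/-- A neighbourhood of the identity generates the whole group. -/
lemma generated_by_small (M : Submonoid SL2C) (hM : ∀ g : SL2C, hs ⇡g ≤ 2 → g ∈ M) (g : SL2C) :
    g ∈ M := by
  have hpow (f : ℂ → SL2C) (hf : ∀ s t, f s * f t = f (s + t))
      (hb : ∀ t, ‖t‖ ≤ 1 / 2 → f t ∈ M) (t : ℂ) : f t ∈ M := by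
    have key (n : ℕ) : ∀ t : ℂ, ‖t‖ ≤ 2 ^ n / 2 → f t ∈ M := by
      induction n with
      | zero => simpa using hb
      | succ n ih =>
        intro t ht
        have h2 : f (t / 2) ∈ M := ih _ (by
          rw [norm_div, Complex.norm_ofNat]
          rw [pow_succ] at ht; linarith)
        have := mul_mem h2 h2
        rwa [hf, add_halves] at this
    obtain ⟨n, hn⟩ := pow_unbounded_of_one_lt (2 * ‖t‖) (one_lt_two)
    exact key n t (by linarith)
  have hU := hpow shear shear_mul fun t ht => hM _ ((hs_shear_le t).trans (by linarith))
  have hL := hpow lowerShear lowerShear_mul fun t ht =>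
    hM _ ((hs_lowerShear_le t).trans (by linarith))
  have hc (g : SL2C) (h : ⇡g 1 0 ≠ 0) : g ∈ M := by
    rw [eq_shear_mul_of_ne_zero h]
    exact mul_mem (mul_mem (hU _) (hL _)) (hU _)
  by_cases h : ⇡g 1 0 = 0
  · have hd := det_eq g
    have h1 : g = g * lowerShear 1 * lowerShear (-1) := by
      rw [mul_assoc, lowerShear_mul]
      have : lowerShear (1 + -1) = 1 := by
        apply mat_injective
        rw [mat_lowerShear, mat_one]
        ext i j; fin_cases i <;> fin_cases j <;> simp
      rw [this, mul_one]
    rw [h1]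
    refine mul_mem (hc _ ?_) (hL _)
    rw [mat_mul, mat_lowerShear, mul_apply]
    simp only [Fin.sum_univ_two, h]
    intro h0
    have h11 : ⇡g 1 1 = 0 := by simpa using h0
    rw [h, h11] at hd
    norm_num at hd
  · exact hc g h

lemma Thick.smul {ε : ℝ} {x γ : SL2C} (hx : Thick H ε x) (hγ : γ ∈ H) : Thick H ε (γ * x) := by
  intro δ hδ h
  have e : (γ * x)⁻¹ * δ * (γ * x) = x⁻¹ * (γ⁻¹ * δ * γ) * x := by group
  rw [e] at h
  have := hx _ (mul_mem (mul_mem (inv_mem hγ) hδ) hγ) h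
  rw [mul_assoc, inv_mul_eq_one] at this
  exact (mul_eq_right.1 this.symm)

/-- A torsion-free lattice is finitely generated. -/
lemma Good.fg (hH : Good H) : ∃ R, Subgroup.closure {g : SL2C | g ∈ H ∧ hs ⇡g ≤ R} = H := by
  obtain ⟨ε₀, hε₀, -, hu₀⟩ := hH.exists_unipotent_radius
  obtain ⟨ε, hε, hεle, hε8⟩ : ∃ ε > 0, ε ≤ ε₀ ∧ 4 * ε < 1 / 8 :=
    ⟨min ε₀ (1 / 40), by positivity, min_le_left _ _, by
      linarith [min_le_right ε₀ (1 / 40)]⟩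
  have hu (x : SL2C) (γ) (hγ : γ ∈ H) (h : hs (⇡(x⁻¹ * γ * x) - 1) < ε) : ∃ v, γ = unip v :=
    hu₀ x γ hγ (h.trans_le hεle)
  obtain ⟨b, hb⟩ : ∃ b, Thick H ε b := by
    rcases hH.thick_or_thin hu 1 with h | ⟨w, hw, -⟩
    · exact ⟨1, h⟩
    · have hf := frame_inv_e1 w hw.ne_zero
      have hw' : euc (⇡(frame w hw.ne_zero * dia ((√ε : ℝ) : ℂ)⁻¹
          (by simpa using (Real.sqrt_pos.2 hε).ne'))⁻¹ *ᵥ w) ^ 2 = ε := by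
        rw [_root_.mul_inv_rev, mat_mul, ← mulVec_mulVec, frame_inv_e1, mulVec_e1, mat_inv, mat_dia]
        simp [euc_sq, Real.sq_sqrt hε.le]
      exact ⟨_, hH.thick_of_sphere (by linarith) hu hw hw'⟩
  obtain ⟨R₁, hR₁⟩ := hH.thick ε hε
  set R₀ := max R₁ (hs ⇡b) with hR₀
  have hR₀1 : 1 ≤ R₀ := (one_le_hs b).trans (le_max_right _ _)
  have hthick (x : SL2C) (hx : Thick H ε x) : ∃ γ ∈ H, hs ⇡(γ * x) ≤ R₀ := by
    obtain ⟨γ, h1, h2⟩ := hR₁ x hx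
    exact ⟨γ, h1, h2.trans (le_max_left _ _)⟩
  set ρ := 3 * (4 * ε + ε⁻¹) with hρ
  have hρ2 : 2 ≤ ρ := by
    have : 1 ≤ ε⁻¹ := (one_le_inv₀ hε).2 (by linarith)
    linarith
  have hρ' : 4 * ε + ε⁻¹ ≤ ρ := by
    have : 0 < ε⁻¹ := inv_pos.2 hε
    linarith
  refine ⟨R₀ * ρ * R₀, ?_⟩
  set Γ₀ := Subgroup.closure {g : SL2C | g ∈ H ∧ hs ⇡g ≤ R₀ * ρ * R₀} with hΓ₀
  have hle : Γ₀ ≤ H := (Subgroup.closure_le _).2 fun g hg => hg.1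
  refine le_antisymm hle ?_
  set Near : SL2C → Prop := fun x => ∃ γ ∈ Γ₀, hs ⇡(γ * x) ≤ R₀ with hNear
  have step (x y : SL2C) (hy : Thick H ε y) (hxy : hs ⇡(x⁻¹ * y) ≤ ρ) (hx : Near x) : Near y := by
    obtain ⟨γ, hγ, h1⟩ := hx
    obtain ⟨δ, hδ, h2⟩ := hthick y hy
    have e : δ * γ⁻¹ = (δ * y) * (x⁻¹ * y)⁻¹ * (γ * x)⁻¹ := by group
    have h3 : δ * γ⁻¹ ∈ Γ₀ := by
      refine Subgroup.subset_closure ⟨mul_mem hδ (inv_mem (hle hγ)), ?_⟩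
      rw [e]
      refine (hs_mul_le _ _).trans ?_
      rw [hs_inv]
      refine mul_le_mul ((hs_mul_le _ _).trans ?_) h1 (hs_nonneg _) (by positivity)
      rw [hs_inv]
      exact mul_le_mul h2 hxy (hs_nonneg _) (by positivity)
    refine ⟨δ, ?_, h2⟩
    have := mul_mem h3 hγ
    rwa [inv_mul_cancel_right] at this
  have chain (w : Fin 2 → ℂ) (hw : Shortest H w) (x y : SL2C) (hx : Sphere ε w x)
      (hy : Sphere ε w y) : Near x → Near y :=
    sphere_chain hε hw.ne_zero (fun x y _ hy h => step x y
      (hH.thick_of_sphere (by linarith) hu hw hy) h) hx hy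
  set u : SL2C → Prop := fun x => (Thick H ε x ∧ Near x) ∨
    ∃ w, Shortest H w ∧ euc (⇡x⁻¹ *ᵥ w) ^ 2 < ε ∧ ∀ y, Sphere ε w y → Near y with hudef
  have small (x x' : SL2C) (hg : hs ⇡(x⁻¹ * x') ≤ 2) (w : Fin 2 → ℂ)
      (h : euc (⇡x⁻¹ *ᵥ w) ^ 2 < ε) : euc (⇡x'⁻¹ *ᵥ w) ^ 2 ≤ 4 * ε := by
    have h1 := euc_inv_mul_mulVec x (x⁻¹ * x') w
    rw [mul_inv_cancel_left] at h1
    have h2 : euc (⇡x'⁻¹ *ᵥ w) ≤ 2 * euc (⇡x⁻¹ *ᵥ w) :=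
      h1.trans (mul_le_mul_of_nonneg_right hg (euc_nonneg _))
    have := pow_le_pow_left₀ (euc_nonneg _) h2 2
    rw [mul_pow] at this
    linarith
  have hsym (x y : SL2C) : hs ⇡(x⁻¹ * y) = hs ⇡(y⁻¹ * x) := by
    rw [← hs_inv, _root_.mul_inv_rev, inv_inv]
  have move (x x' : SL2C) (hg : hs ⇡(x⁻¹ * x') ≤ 2) (hx : u x) : u x' := by
    have hg' : hs ⇡(x'⁻¹ * x) ≤ 2 := by rwa [hsym]
    rcases hx with ⟨hxt, hxn⟩ | ⟨w, hw, hlt, hall⟩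
    · rcases hH.thick_or_thin hu x' with h' | ⟨w, hw, hlt⟩
      · exact Or.inl ⟨h', step x x' h' (hg.trans hρ2) hxn⟩
      · refine Or.inr ⟨w, hw, hlt, ?_⟩
        obtain ⟨y, hy, hxy⟩ := exists_sphere_near hε hw.ne_zero (hxt.le hw) (small x' x hg' w hlt)
        have hyn := step x y (hH.thick_of_sphere (by linarith) hu hw hy) (hxy.trans hρ') hxn
        exact fun z hz => chain w hw y z hy hz hyn
    · by_cases hlt' : euc (⇡x'⁻¹ *ᵥ w) ^ 2 < ε
      · exact Or.inr ⟨w, hw, hlt', hall⟩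
      · have hle' := small x x' hg w hlt
        rcases hH.thick_or_thin hu x' with h' | ⟨w', hw', hltw⟩
        · obtain ⟨y, hy, hxy⟩ := exists_sphere_near hε hw.ne_zero (h'.le hw) hle'
          exact Or.inl ⟨h', step y x' h' (by rw [hsym]; exact hxy.trans hρ') (hall y hy)⟩
        · obtain ⟨c, rfl⟩ := hH.parallel hw.mem hw.ne_zero hw'.mem (hle'.trans_lt hε8)
            (by linarith)
          rw [euc_inv_mulVec_smul, hw.eq_of_smul hw', one_mul] at hltw
          exact absurd hltw hlt'
  have hall : ∀ x, u x := by
    let M : Submonoid SL2C :=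
      { carrier := {g | ∀ x, u x → u (x * g)}
        one_mem' := fun x hx => by rwa [mul_one]
        mul_mem' := fun {a b} ha hb x hx => by rw [← mul_assoc]; exact hb _ (ha _ hx) }
    intro x
    have h1 : b⁻¹ * x ∈ M := generated_by_small M (fun g hg y hy =>
      move y (y * g) (by rwa [inv_mul_cancel_left]) hy) _
    have h2 := h1 b (Or.inl ⟨hb, 1, one_mem _, by rw [one_mul]; exact le_max_right _ _⟩)
    rwa [mul_inv_cancel_left] at h2
  intro γ hγ
  have hbt := hb.smul hγ
  rcases hall (γ * b) with ⟨-, δ, hδ, h1⟩ | ⟨w, hw, hlt, -⟩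
  · have h2 : δ * γ ∈ Γ₀ := by
      refine Subgroup.subset_closure ⟨mul_mem (hle hδ) hγ, ?_⟩
      have e : δ * γ = (δ * (γ * b)) * b⁻¹ := by group
      rw [e]
      refine (hs_mul_le _ _).trans ?_
      rw [hs_inv]
      refine mul_le_mul (h1.trans ?_) (le_max_right _ _) (hs_nonneg _) (by positivity)
      nlinarith
    have := mul_mem (inv_mem hδ) h2
    rwa [inv_mul_cancel_left] at this
  · exact absurd (hbt.le hw) (not_le.2 hlt)

lemma Good.fg' (hH : Good H) : H.FG := by
  obtain ⟨R, hR⟩ := hH.fg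
  exact (Subgroup.fg_iff _).2 ⟨_, hR, hH.finite R⟩

/-- The row of least norm which together with `ρ` forms a matrix of determinant one. -/
noncomputable def dualRow (ρ : Fin 2 → ℂ) : Fin 2 → ℂ :=
  ![starRingEnd ℂ (ρ 1) / (euc ρ ^ 2 : ℝ), -starRingEnd ℂ (ρ 0) / (euc ρ ^ 2 : ℝ)]

/-- The determinant of the matrix with rows `α` and `ρ`. -/
def rowDet (α ρ : Fin 2 → ℂ) : ℂ := α 0 * ρ 1 - α 1 * ρ 0

/-- The coefficient of `ρ` in the orthogonal decomposition of `α`. -/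
noncomputable def rowCoeff (α ρ : Fin 2 → ℂ) : ℂ :=
  (α 0 * starRingEnd ℂ (ρ 0) + α 1 * starRingEnd ℂ (ρ 1)) / (euc ρ ^ 2 : ℝ)

lemma euc_sq_complex (ρ : Fin 2 → ℂ) :
    ((euc ρ ^ 2 : ℝ) : ℂ) = ρ 0 * starRingEnd ℂ (ρ 0) + ρ 1 * starRingEnd ℂ (ρ 1) := by
  rw [euc_sq, Complex.mul_conj, Complex.mul_conj, Complex.normSq_eq_norm_sq,
    Complex.normSq_eq_norm_sq]
  push_cast; ring

lemma euc_sq_complex_ne_zero {ρ : Fin 2 → ℂ} (h : ρ ≠ 0) : ((euc ρ ^ 2 : ℝ) : ℂ) ≠ 0 := by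
  exact_mod_cast (pow_pos (euc_pos h) 2).ne'

lemma rowDet_dualRow {ρ : Fin 2 → ℂ} (h : ρ ≠ 0) : rowDet (dualRow ρ) ρ = 1 := by
  have h1 := euc_sq_complex_ne_zero h
  have h2 := euc_sq_complex ρ
  simp only [rowDet, dualRow, cons_val_zero, cons_val_one]
  rw [div_mul_eq_mul_div, div_mul_eq_mul_div, ← sub_div, div_eq_one_iff_eq h1, h2]
  ring

lemma eq_smul_of_rowDet {α ρ : Fin 2 → ℂ} (h : ρ ≠ 0) (hd : rowDet α ρ = 0) :
    α = rowCoeff α ρ • ρ := by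
  have h1 := euc_sq_complex_ne_zero h
  have h2 := euc_sq_complex ρ
  unfold rowDet at hd
  ext i
  rw [Pi.smul_apply, smul_eq_mul, rowCoeff, div_mul_eq_mul_div, eq_div_iff h1, h2]
  fin_cases i
  · simp only [Fin.zero_eta]
    linear_combination (starRingEnd ℂ (ρ 1)) * hd
  · simp only [Fin.mk_one]
    linear_combination -(starRingEnd ℂ (ρ 0)) * hd

lemma eq_add_dualRow {α ρ : Fin 2 → ℂ} (h : ρ ≠ 0) (hd : rowDet α ρ = 1) :
    ∃ z : ℂ, α = z • ρ + dualRow ρ := by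
  have h1 := rowDet_dualRow h
  refine ⟨_, sub_eq_iff_eq_add.1 (eq_smul_of_rowDet (α := α - dualRow ρ) h ?_)⟩
  unfold rowDet at *
  simp only [Pi.sub_apply]
  linear_combination hd - h1

lemma rowDet_vecMul (α ρ : Fin 2 → ℂ) (h : SL2C) :
    rowDet (α ᵥ* ⇡h) (ρ ᵥ* ⇡h) = rowDet α ρ := by
  have hd := det_eq h
  simp only [rowDet, vecMul, dotProduct, Fin.sum_univ_two]
  linear_combination (α 0 * ρ 1 - α 1 * ρ 0) * hd

lemma euc_dualRow {ρ : Fin 2 → ℂ} (h : ρ ≠ 0) : euc (dualRow ρ) = (euc ρ)⁻¹ := by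
  have hp := euc_pos h
  rw [← pow_left_inj₀ (euc_nonneg _) (inv_nonneg.2 hp.le) two_ne_zero, euc_sq]
  simp only [dualRow, cons_val_zero, cons_val_one, norm_div, norm_neg, RCLike.norm_conj,
    Complex.norm_real, Real.norm_of_nonneg (sq_nonneg (euc ρ)), div_pow]
  rw [← add_div, add_comm, ← euc_sq]
  field_simp

lemma norm_dotProduct_le_euc (α u : Fin 2 → ℂ) : ‖α ⬝ᵥ u‖ ≤ euc α * euc u := by
  have h := norm_dotProduct_le (α 0) (α 1) (u 0) (u 1)
  rw [← euc_sq, ← euc_sq, ← mul_pow] at h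
  have := le_of_sq_le_sq h (mul_nonneg (euc_nonneg _) (euc_nonneg _))
  rwa [dotProduct, Fin.sum_univ_two]

lemma norm_rowCoeff_le {α ρ : Fin 2 → ℂ} (h : ρ ≠ 0) : ‖rowCoeff α ρ‖ ≤ euc α / euc ρ := by
  have hp := euc_pos h
  have h1 := norm_dotProduct_le_euc α fun i => starRingEnd ℂ (ρ i)
  have h2 : euc (fun i => starRingEnd ℂ (ρ i)) = euc ρ := by simp [euc]
  rw [h2, dotProduct, Fin.sum_univ_two] at h1
  rw [rowCoeff, norm_div, Complex.norm_real, Real.norm_of_nonneg (by positivity),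
    div_le_div_iff₀ (by positivity) hp]
  calc _ ≤ euc α * euc ρ * euc ρ := by gcongr
    _ = _ := by ring

lemma euc_vecMul (ρ : Fin 2 → ℂ) (A : Matrix (Fin 2) (Fin 2) ℂ) :
    euc (ρ ᵥ* A) ≤ hs A * euc ρ := by
  have h := euc_mulVec Aᵀ ρ
  rw [mulVec_transpose] at h
  have : hs Aᵀ = hs A := by
    simp only [hs, transpose_apply]
    congr 1; ring
  rwa [this] at h

lemma vecMul_inv_vecMul (ρ : Fin 2 → ℂ) (h : SL2C) : (ρ ᵥ* ⇡h⁻¹) ᵥ* ⇡h = ρ := by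
  rw [vecMul_vecMul, mat_inv_mul, vecMul_one]

lemma vecMul_vecMul_inv (ρ : Fin 2 → ℂ) (h : SL2C) : (ρ ᵥ* ⇡h) ᵥ* ⇡h⁻¹ = ρ := by
  rw [vecMul_vecMul, mat_mul_inv, vecMul_one]

lemma vecMul_ne_zero {ρ : Fin 2 → ℂ} (hρ : ρ ≠ 0) (h : SL2C) : ρ ᵥ* ⇡h ≠ 0 := fun h0 => by
  have := vecMul_vecMul_inv ρ h
  rw [h0, zero_vecMul] at this
  exact hρ this.symm

lemma euc_le_vecMul (ρ : Fin 2 → ℂ) (h : SL2C) : euc ρ ≤ hs ⇡h * euc (ρ ᵥ* ⇡h) := by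
  have := euc_vecMul (ρ ᵥ* ⇡h) ⇡h⁻¹
  rwa [vecMul_vecMul_inv, hs_inv] at this

lemma vecMul_dotProduct_inv (ρ u : Fin 2 → ℂ) (h : SL2C) :
    (ρ ᵥ* ⇡h) ⬝ᵥ (⇡h⁻¹ *ᵥ u) = ρ ⬝ᵥ u := by
  rw [dotProduct_mulVec, vecMul_vecMul_inv]

/-- The coefficient by which `dualRow` fails to be equivariant. -/
noncomputable def defect (ρ : Fin 2 → ℂ) (h : SL2C) : ℂ :=
  rowCoeff (dualRow ρ - dualRow (ρ ᵥ* ⇡h) ᵥ* ⇡h⁻¹) ρ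

lemma defect_smul {ρ : Fin 2 → ℂ} (hρ : ρ ≠ 0) (h : SL2C) :
    dualRow ρ - dualRow (ρ ᵥ* ⇡h) ᵥ* ⇡h⁻¹ = defect ρ h • ρ := by
  refine eq_smul_of_rowDet hρ ?_
  have h1 := rowDet_dualRow hρ
  have h2 := rowDet_dualRow (vecMul_ne_zero hρ h)
  rw [← rowDet_vecMul _ _ h⁻¹, vecMul_vecMul_inv] at h2
  unfold rowDet at *
  simp only [Pi.sub_apply]
  linear_combination h1 - h2

lemma defect_mul_dotProduct {ρ : Fin 2 → ℂ} (hρ : ρ ≠ 0) (h : SL2C) (u : Fin 2 → ℂ) :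
    dualRow ρ ⬝ᵥ u - dualRow (ρ ᵥ* ⇡h) ⬝ᵥ (⇡h⁻¹ *ᵥ u) = defect ρ h * (ρ ⬝ᵥ u) := by
  rw [dotProduct_mulVec, ← sub_dotProduct, defect_smul hρ, smul_dotProduct, smul_eq_mul]

lemma euc_dualRow_vecMul_le {ρ : Fin 2 → ℂ} (hρ : ρ ≠ 0) (h : SL2C) :
    euc (dualRow (ρ ᵥ* ⇡h)) ≤ hs ⇡h / euc ρ := by
  have h1 := euc_le_vecMul ρ h
  have h2 := euc_pos hρ
  have h3 := euc_pos (vecMul_ne_zero hρ h)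
  rw [euc_dualRow (vecMul_ne_zero hρ h), inv_eq_one_div, div_le_div_iff₀ h3 h2]
  linarith

lemma euc_dualRow_vecMul_inv_le {ρ : Fin 2 → ℂ} (hρ : ρ ≠ 0) (h : SL2C) :
    euc (dualRow (ρ ᵥ* ⇡h) ᵥ* ⇡h⁻¹) ≤ hs ⇡h ^ 2 / euc ρ := by
  refine (euc_vecMul _ _).trans ?_
  rw [hs_inv, sq, mul_div_assoc]
  exact mul_le_mul_of_nonneg_left (euc_dualRow_vecMul_le hρ h) (hs_nonneg _)

lemma euc_add (α β : Fin 2 → ℂ) : euc (α + β) ≤ 2 * (euc α + euc β) :=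
  euc_le_of_forall fun i => (norm_add_le _ _).trans
    (add_le_add (norm_apply_le_euc α i) (norm_apply_le_euc β i))

lemma euc_neg (α : Fin 2 → ℂ) : euc (-α) = euc α := by simp [euc]

lemma norm_defect_le {ρ : Fin 2 → ℂ} (hρ : ρ ≠ 0) (h : SL2C) :
    ‖defect ρ h‖ ≤ 4 * hs ⇡h ^ 2 / euc ρ ^ 2 := by
  have hp := euc_pos hρ
  refine (norm_rowCoeff_le hρ).trans ?_
  rw [sq (euc ρ), ← div_div]
  refine div_le_div_of_nonneg_right ?_ hp.le
  rw [sub_eq_add_neg]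
  refine (euc_add _ _).trans ?_
  rw [euc_neg, euc_dualRow hρ]
  have h1 := euc_dualRow_vecMul_inv_le hρ h
  have h2 : (euc ρ)⁻¹ ≤ hs ⇡h ^ 2 / euc ρ := by
    rw [inv_eq_one_div]
    exact div_le_div_of_nonneg_right (one_le_pow₀ (one_le_hs h)) hp.le
  rw [mul_div_assoc]
  linarith

lemma defect_mul {ρ : Fin 2 → ℂ} (hρ : ρ ≠ 0) (h k : SL2C) :
    defect ρ (h * k) = defect ρ h + defect (ρ ᵥ* ⇡h) k := by
  obtain ⟨u, hu⟩ : ∃ u, ρ ⬝ᵥ u ≠ 0 := by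
    by_contra! h0
    exact hρ (dotProduct_eq_zero ρ h0)
  have h1 := defect_mul_dotProduct hρ (h * k) u
  have h2 := defect_mul_dotProduct hρ h u
  have h3 := defect_mul_dotProduct (vecMul_ne_zero hρ h) k (⇡h⁻¹ *ᵥ u)
  rw [vecMul_dotProduct_inv] at h3
  rw [_root_.mul_inv_rev, mat_mul, mat_mul, ← vecMul_vecMul, ← mulVec_mulVec] at h1
  refine mul_right_cancel₀ hu ?_
  linear_combination -h1 + h2 + h3

/-- The terms of the series defining the cocycle. -/
noncomputable def term (n : ℕ) (ρ : Fin 2 → ℂ) (h : SL2C) (u : Fin 2 → ℂ) : ℂ :=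
  defect ρ h * ∑ i ∈ Finset.range n,
    (dualRow ρ ⬝ᵥ u) ^ i * (dualRow (ρ ᵥ* ⇡h) ⬝ᵥ (⇡h⁻¹ *ᵥ u)) ^ (n - 1 - i)

lemma term_mul_dotProduct (n : ℕ) {ρ : Fin 2 → ℂ} (hρ : ρ ≠ 0) (h : SL2C) (u : Fin 2 → ℂ) :
    term n ρ h u * (ρ ⬝ᵥ u) =
      (dualRow ρ ⬝ᵥ u) ^ n - (dualRow (ρ ᵥ* ⇡h) ⬝ᵥ (⇡h⁻¹ *ᵥ u)) ^ n := by
  rw [← geom_sum₂_mul, defect_mul_dotProduct hρ, term]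
  ring

lemma term_of_dotProduct_eq_zero (n : ℕ) {ρ : Fin 2 → ℂ} (hρ : ρ ≠ 0) (h : SL2C)
    {u : Fin 2 → ℂ} (hu : ρ ⬝ᵥ u = 0) :
    term n ρ h u = defect ρ h * (n * (dualRow ρ ⬝ᵥ u) ^ (n - 1)) := by
  have h1 := defect_mul_dotProduct hρ h u
  rw [hu, mul_zero, sub_eq_zero] at h1
  rw [term, ← h1, Finset.sum_congr rfl (g := fun _ => (dualRow ρ ⬝ᵥ u) ^ (n - 1))]
  · simp
  · intro i hi
    rw [← pow_add]
    congr 1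
    have := Finset.mem_range.1 hi
    omega

lemma term_mul (n : ℕ) {ρ : Fin 2 → ℂ} (hρ : ρ ≠ 0) (h k : SL2C) (u : Fin 2 → ℂ) :
    term n ρ (h * k) u = term n ρ h u + term n (ρ ᵥ* ⇡h) k (⇡h⁻¹ *ᵥ u) := by
  have hρ' := vecMul_ne_zero hρ h
  by_cases hu : ρ ⬝ᵥ u = 0
  · have h1 := defect_mul_dotProduct hρ h u
    rw [hu, mul_zero, sub_eq_zero] at h1
    rw [term_of_dotProduct_eq_zero n hρ _ hu, term_of_dotProduct_eq_zero n hρ _ hu,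
      term_of_dotProduct_eq_zero n hρ' _ (by rw [vecMul_dotProduct_inv, hu]), ← h1,
      defect_mul hρ, add_mul]
  · refine mul_right_cancel₀ hu ?_
    rw [add_mul, term_mul_dotProduct n hρ, term_mul_dotProduct n hρ]
    have h2 := term_mul_dotProduct n hρ' k (⇡h⁻¹ *ᵥ u)
    rw [vecMul_dotProduct_inv] at h2
    rw [h2, _root_.mul_inv_rev, mat_mul, mat_mul, ← vecMul_vecMul, ← mulVec_mulVec]
    ring

lemma norm_term_le (n : ℕ) {ρ : Fin 2 → ℂ} (hρ : ρ ≠ 0) (h : SL2C) (u : Fin 2 → ℂ) :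
    ‖term n ρ h u‖ ≤
      4 * hs ⇡h ^ 2 / euc ρ ^ 2 * (n * (hs ⇡h ^ 2 * euc u / euc ρ) ^ (n - 1)) := by
  have hp := euc_pos hρ
  have h1 : ‖dualRow ρ ⬝ᵥ u‖ ≤ hs ⇡h ^ 2 * euc u / euc ρ := by
    refine (norm_dotProduct_le_euc _ _).trans ?_
    rw [euc_dualRow hρ, mul_div_right_comm, inv_eq_one_div]
    have := one_le_pow₀ (one_le_hs h) (n := 2)
    have := euc_nonneg u
    gcongr
  have h2 : ‖dualRow (ρ ᵥ* ⇡h) ⬝ᵥ (⇡h⁻¹ *ᵥ u)‖ ≤ hs ⇡h ^ 2 * euc u / euc ρ := by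
    rw [dotProduct_mulVec]
    refine (norm_dotProduct_le_euc _ _).trans ?_
    rw [mul_div_right_comm]
    exact mul_le_mul_of_nonneg_right (euc_dualRow_vecMul_inv_le hρ h) (euc_nonneg u)
  rw [term, norm_mul]
  refine mul_le_mul (norm_defect_le hρ h) ?_ (norm_nonneg _) (by positivity)
  refine (norm_sum_le _ _).trans ?_
  have h0 : 0 ≤ hs ⇡h ^ 2 * euc u / euc ρ := (norm_nonneg _).trans h1
  calc _ ≤ ∑ i ∈ Finset.range n, (hs ⇡h ^ 2 * euc u / euc ρ) ^ (n - 1) := by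
        refine Finset.sum_le_sum fun i hi => ?_
        rw [norm_mul, norm_pow, norm_pow]
        have hi' : n - 1 = i + (n - 1 - i) := by
          have := Finset.mem_range.1 hi
          omega
        calc _ ≤ (hs ⇡h ^ 2 * euc u / euc ρ) ^ i * (hs ⇡h ^ 2 * euc u / euc ρ) ^ (n - 1 - i) := by
              gcongr
          _ = _ := by rw [← pow_add, ← hi']
    _ = _ := by simp

lemma dualRow_neg (ρ : Fin 2 → ℂ) : dualRow (-ρ) = -dualRow ρ := by
  ext i
  fin_cases i <;> simp [dualRow, euc_neg, neg_div]

lemma mat_neg_one : ⇡(-1 : SL2C) = -1 := by rw [mat_neg, mat_one]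

lemma neg_one_inv : (-1 : SL2C)⁻¹ = -1 := by
  rw [inv_eq_iff_mul_eq_one]; simp

lemma term_neg_one (n : ℕ) (ρ : Fin 2 → ℂ) (u : Fin 2 → ℂ) :
    term n ρ (-1) u = 0 := by
  have : defect ρ (-1) = 0 := by
    rw [defect, neg_one_inv, mat_neg_one]
    simp [vecMul_neg, dualRow_neg, rowCoeff]
  rw [term, this, zero_mul]

lemma term_smul (n : ℕ) (ρ : Fin 2 → ℂ) (h : SL2C) (c : ℂ) (u : Fin 2 → ℂ) :
    term n ρ h (c • u) = c ^ (n - 1) * term n ρ h u := by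
  rw [term, term, mul_left_comm, Finset.mul_sum _ _ (c ^ (n - 1))]
  refine congrArg (defect ρ h * ·) (Finset.sum_congr rfl fun i hi => ?_)
  have hi' : n - 1 = i + (n - 1 - i) := by
    have := Finset.mem_range.1 hi
    omega
  rw [mulVec_smul, dotProduct_smul, dotProduct_smul, smul_eq_mul, smul_eq_mul, mul_pow, mul_pow]
  nth_rw 3 [hi']
  rw [pow_add]
  ring

/-- The lower rows of the elements of `H`. -/
abbrev Row (H : Subgroup SL2C) := {ρ : Fin 2 → ℂ // ∃ g ∈ H, ⇡g 1 = ρ}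

lemma row_ne_zero (g : SL2C) : ⇡g 1 ≠ 0 := fun h => by
  have hd := det_eq g
  rw [congrFun h 0, congrFun h 1] at hd
  simp at hd

lemma Row.ne_zero (ρ : Row H) : (ρ : Fin 2 → ℂ) ≠ 0 := by
  obtain ⟨_, g, -, rfl⟩ := ρ
  exact row_ne_zero g

lemma mat_mul_row (g h : SL2C) (i : Fin 2) : ⇡(g * h) i = ⇡g i ᵥ* ⇡h := by
  rw [mat_mul]; rfl

/-- Elements of `H` permute the lower rows. -/
def Row.mulEquiv {h : SL2C} (hh : h ∈ H) : Row H ≃ Row H where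
  toFun ρ := ⟨ρ.1 ᵥ* ⇡h, by
    obtain ⟨_, g, hg, rfl⟩ := ρ
    exact ⟨g * h, mul_mem hg hh, mat_mul_row g h 1⟩⟩
  invFun ρ := ⟨ρ.1 ᵥ* ⇡h⁻¹, by
    obtain ⟨_, g, hg, rfl⟩ := ρ
    exact ⟨g * h⁻¹, mul_mem hg (inv_mem hh), mat_mul_row g h⁻¹ 1⟩⟩
  left_inv ρ := Subtype.ext (vecMul_vecMul_inv _ _)
  right_inv ρ := Subtype.ext (vecMul_inv_vecMul _ _)

lemma exists_sq_smul_e1 (t : ℂ) : ∃ s : ℂ, s ^ 2 = t ∧ shear t = unip (s • ![1, 0]) := by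
  obtain ⟨s, hs⟩ := IsAlgClosed.exists_pow_nat_eq t (n := 2) (by norm_num)
  refine ⟨s, hs, mat_injective ?_⟩
  rw [mat_shear, unip_val]
  ext i j; fin_cases i <;> fin_cases j <;> simp [nilp, ← hs, sq]

lemma Good.exists_row_lower (hH : Good H) {t₀ : ℂ} (ht₀ : t₀ ≠ 0) (h₀ : shear t₀ ∈ H) :
    ∃ m > 0, ∀ ρ : Row H, m ≤ euc ρ.1 := by
  obtain ⟨ε, hε, hdisc⟩ := hH.disc
  have hn : 0 < ‖t₀‖ := norm_pos_iff.2 ht₀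
  refine ⟨√(ε / ‖t₀‖), Real.sqrt_pos.2 (div_pos hε hn), fun ρ => ?_⟩
  obtain ⟨_, g, hg, rfl⟩ := ρ
  rw [Real.sqrt_le_left (euc_nonneg _), div_le_iff₀ hn]
  by_contra! hlt
  obtain ⟨s, hs, hsu⟩ := exists_sq_smul_e1 t₀
  have h1 := hdisc (g⁻¹ * shear t₀ * g) (mul_mem (mul_mem (inv_mem hg) h₀) hg) (by
    rw [hsu, hs_conj_unip_sub_one, euc_inv_mulVec_smul, mul_pow, ← norm_pow, hs, mulVec_e1, mat_inv,
      mul_comm]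
    refine lt_of_eq_of_lt ?_ hlt
    simp [euc_sq, add_comm])
  have h2 : shear t₀ = shear 0 := by
    rw [mul_assoc, inv_mul_eq_one] at h1
    rw [shear_zero]
    exact mul_eq_right.1 h1.symm
  exact ht₀ (shear_injective h2)

lemma hs_sq_eq_rows (A : Matrix (Fin 2) (Fin 2) ℂ) : hs A ^ 2 = euc (A 0) ^ 2 + euc (A 1) ^ 2 := by
  rw [hs_sq, euc_sq, euc_sq]; ring

lemma hs_le_rows (A : Matrix (Fin 2) (Fin 2) ℂ) : hs A ≤ euc (A 0) + euc (A 1) := by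
  refine le_of_sq_le_sq ?_ (add_nonneg (euc_nonneg _) (euc_nonneg _))
  rw [hs_sq_eq_rows]
  nlinarith [mul_nonneg (euc_nonneg (A 0)) (euc_nonneg (A 1))]

lemma shear_mul_row_zero (t : ℂ) (g : SL2C) : ⇡(shear t * g) 0 = ⇡g 0 + t • ⇡g 1 := by
  rw [mat_mul_row, mat_shear]
  ext j
  simp [vecMul, dotProduct, Fin.sum_univ_two]

lemma shear_mul_row_one (t : ℂ) (g : SL2C) : ⇡(shear t * g) 1 = ⇡g 1 := by
  rw [mat_mul_row, mat_shear]
  ext j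
  simp [vecMul, dotProduct, Fin.sum_univ_two]

lemma Good.exists_small_rep (hH : Good H) {t₀ : ℂ} (ht₀ : t₀ ≠ 0) (h₀ : shear t₀ ∈ H) :
    ∃ C > 0, ∀ ρ : Row H, ∃ g ∈ H, ⇡g 1 = ρ.1 ∧ hs ⇡g ≤ C * euc ρ.1 := by
  obtain ⟨m, hm, hlow⟩ := hH.exists_row_lower ht₀ h₀
  obtain ⟨R, hR⟩ := hH.exists_shear_near ht₀ h₀
  have hR0 : 0 ≤ R := by
    obtain ⟨t, -, h⟩ := hR 0
    exact (norm_nonneg _).trans h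
  refine ⟨2 * (R + (m ^ 2)⁻¹) + 1, by positivity, fun ρ => ?_⟩
  have hρ := ρ.ne_zero
  have hmρ := hlow ρ
  have hpos := euc_pos hρ
  obtain ⟨g, hg, hgρ⟩ := ρ.2
  have hd : rowDet (⇡g 0) (⇡g 1) = 1 := by
    rw [← det_eq g]; rfl
  rw [hgρ] at hd
  obtain ⟨z, hz⟩ := eq_add_dualRow hρ hd
  obtain ⟨t, ht, hzt⟩ := hR z
  refine ⟨shear (-t) * g, mul_mem ?_ hg, ?_, ?_⟩
  · rw [← shear_inv]; exact inv_mem ht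
  · rw [shear_mul_row_one, hgρ]
  · refine (hs_le_rows _).trans ?_
    rw [shear_mul_row_one, shear_mul_row_zero, hgρ, hz]
    have e : z • (ρ : Fin 2 → ℂ) + dualRow ρ + -t • (ρ : Fin 2 → ℂ)
        = (z - t) • (ρ : Fin 2 → ℂ) + dualRow ρ := by
      rw [sub_smul, neg_smul]; abel
    rw [e]
    have h1 := euc_add ((z - t) • (ρ : Fin 2 → ℂ)) (dualRow ρ)
    rw [euc_smul, euc_dualRow hρ] at h1
    have h2 : (euc ρ.1)⁻¹ ≤ (m ^ 2)⁻¹ * euc ρ.1 := by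
      rw [inv_mul_eq_div, inv_eq_one_div, div_le_div_iff₀ hpos (by positivity)]
      nlinarith
    have h3 : ‖z - t‖ * euc ρ.1 ≤ R * euc ρ.1 := by gcongr
    linarith

lemma Good.summable_rows (hH : Good H) {t₀ : ℂ} (ht₀ : t₀ ≠ 0) (h₀ : shear t₀ ∈ H) {k : ℕ}
    (hk : 36 ≤ k) : Summable fun ρ : Row H => (euc ρ.1 ^ k)⁻¹ := by
  obtain ⟨C, hC, hrep⟩ := hH.exists_small_rep ht₀ h₀
  choose g hg hgρ hgC using hrep
  have hinj : Function.Injective fun ρ : Row H => (⟨g ρ, hg ρ⟩ : H) := fun ρ σ h => by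
    have h1 : g ρ = g σ := congrArg Subtype.val h
    exact Subtype.ext (by rw [← hgρ ρ, ← hgρ σ, h1])
  refine ((hH.summable.comp_injective hinj).mul_left (C ^ k)).of_nonneg_of_le
    (fun ρ => inv_nonneg.2 (pow_nonneg (euc_nonneg _) _)) fun ρ => ?_
  have hpos := euc_pos ρ.ne_zero
  have h1 : hs ⇡(g ρ) ^ 36 ≤ C ^ k * euc ρ.1 ^ k := by
    rw [← mul_pow]
    exact (pow_le_pow_right₀ (one_le_hs _) hk).trans (pow_le_pow_left₀ (hs_nonneg _) (hgC ρ) k)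
  simp only [Function.comp_apply]
  rw [← div_eq_mul_inv, inv_eq_one_div, div_le_div_iff₀ (by positivity) (pow_pos (hs_pos _) _)]
  linarith

/-- The sum of `term` over all lower rows. -/
noncomputable def cocycle (H : Subgroup SL2C) (n : ℕ) (h : SL2C) (u : Fin 2 → ℂ) : ℂ :=
  ∑' ρ : Row H, term n ρ.1 h u

lemma Good.summable_term (hH : Good H) {t₀ : ℂ} (ht₀ : t₀ ≠ 0) (h₀ : shear t₀ ∈ H) {n : ℕ}
    (hn : 36 ≤ n) (h : SL2C) (u : Fin 2 → ℂ) : Summable fun ρ : Row H => term n ρ.1 h u := by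
  have h1 : 36 ≤ 2 + (n - 1) := by omega
  refine Summable.of_norm_bounded ((hH.summable_rows ht₀ h₀ h1).mul_left
    (4 * hs ⇡h ^ 2 * (n * (hs ⇡h ^ 2 * euc u) ^ (n - 1)))) fun ρ => ?_
  refine (norm_term_le n ρ.ne_zero h u).trans_eq ?_
  have := (euc_pos ρ.ne_zero).ne'
  rw [div_pow, pow_add]
  field_simp

lemma Good.cocycle_mul (hH : Good H) {t₀ : ℂ} (ht₀ : t₀ ≠ 0) (h₀ : shear t₀ ∈ H) {n : ℕ}
    (hn : 36 ≤ n) {h : SL2C} (hh : h ∈ H) (k : SL2C) (u : Fin 2 → ℂ) :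
    cocycle H n (h * k) u = cocycle H n h u + cocycle H n k (⇡h⁻¹ *ᵥ u) := by
  have h1 := hH.summable_term ht₀ h₀ hn h u
  have h2 := hH.summable_term ht₀ h₀ hn k (⇡h⁻¹ *ᵥ u)
  have h3 : Summable fun ρ => term n (Row.mulEquiv hh ρ).1 k (⇡h⁻¹ *ᵥ u) :=
    h2.comp_injective (Row.mulEquiv hh).injective
  have h4 : ∑' ρ, term n (Row.mulEquiv hh ρ).1 k (⇡h⁻¹ *ᵥ u) = cocycle H n k (⇡h⁻¹ *ᵥ u) :=
    (Row.mulEquiv hh).tsum_eq fun ρ => term n ρ.1 k (⇡h⁻¹ *ᵥ u)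
  have h5 (ρ : Row H) : term n ρ.1 (h * k) u
      = term n ρ.1 h u + term n (Row.mulEquiv hh ρ).1 k (⇡h⁻¹ *ᵥ u) :=
    term_mul n ρ.ne_zero h k u
  rw [← h4]
  unfold cocycle
  rw [← h1.tsum_add h3]
  exact tsum_congr h5

lemma cocycle_neg_one (n : ℕ) (u : Fin 2 → ℂ) : cocycle H n (-1) u = 0 := by
  simp [cocycle, term_neg_one]

lemma cocycle_smul (n : ℕ) (h : SL2C) (c : ℂ) (u : Fin 2 → ℂ) :
    cocycle H n h (c • u) = c ^ (n - 1) * cocycle H n h u := by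
  simp only [cocycle, term_smul, tsum_mul_left]

lemma Good.exists_lower (hH : Good H) {t₀ : ℂ} (ht₀ : t₀ ≠ 0) (h₀ : shear t₀ ∈ H) :
    ∃ δ > 0, ∀ v, unip v ∈ H → v 1 ≠ 0 → δ ≤ ‖v 1‖ := by
  obtain ⟨ε, hε, hdisc⟩ := hH.disc
  obtain ⟨R, hR⟩ := hH.exists_shear_near ht₀ h₀
  refine ⟨√(ε / (R ^ 2 + 1)), Real.sqrt_pos.2 (by positivity), fun v hv hv1 => ?_⟩
  rw [Real.sqrt_le_left (norm_nonneg _), div_le_iff₀ (by positivity)]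
  obtain ⟨t, ht, hzt⟩ := hR (v 0 / v 1)
  have hv' : v ≠ 0 := fun h => hv1 (congrFun h 1)
  have hmem : unip (⇡(shear t)⁻¹ *ᵥ v) ∈ H := by
    rw [← conj_unip']
    exact mul_mem (mul_mem (inv_mem ht) hv) ht
  have h1 : ⇡(shear t)⁻¹ *ᵥ v = ![v 0 - t * v 1, v 1] := by
    rw [shear_inv, mat_shear]
    ext i; fin_cases i <;> simp [mulVec, dotProduct, Fin.sum_univ_two, sub_eq_add_neg]
  by_contra! hlt
  refine unip_ne_one (mulVec_ne_zero _ hv') (hdisc _ hmem ?_)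
  rw [hs_unip_sub_one, h1, euc_sq]
  simp only [cons_val_zero, cons_val_one]
  refine lt_of_le_of_lt ?_ hlt
  have h2 : ‖v 0 - t * v 1‖ ≤ R * ‖v 1‖ := by
    have : v 0 - t * v 1 = (v 0 / v 1 - t) * v 1 := by field_simp
    rw [this, norm_mul]
    gcongr
  have := pow_le_pow_left₀ (norm_nonneg _) h2 2
  linarith [mul_pow R ‖v 1‖ 2]

open Classical in
/-- The contribution of the rows that do not vanish on a fixed vector telescopes. -/
lemma Good.cocycle_fixed (hH : Good H) {t₀ : ℂ} (ht₀ : t₀ ≠ 0) (h₀ : shear t₀ ∈ H) {n : ℕ}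
    (hn : 36 ≤ n) {v : Fin 2 → ℂ} (hv : unip v ∈ H) {h : SL2C} (hh : h ∈ H)
    (hfix : ⇡h⁻¹ *ᵥ v = v) :
    cocycle H n h v = ∑' ρ : Row H, if ρ.1 ⬝ᵥ v = 0 then term n ρ.1 h v else 0 := by
  obtain ⟨δ, hδ, hlow⟩ := hH.exists_lower ht₀ h₀
  have hlow' (ρ : Row H) (h0 : ρ.1 ⬝ᵥ v ≠ 0) : δ ≤ ‖ρ.1 ⬝ᵥ v‖ := by
    obtain ⟨_, g, hg, rfl⟩ := ρ
    refine hlow (⇡g *ᵥ v) ?_ h0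
    rw [← conj_unip]
    exact mul_mem (mul_mem hg hv) (inv_mem hg)
  set b : Row H → ℂ := fun ρ =>
    if ρ.1 ⬝ᵥ v = 0 then 0 else (dualRow ρ.1 ⬝ᵥ v) ^ n / (ρ.1 ⬝ᵥ v) with hb
  have hbs : Summable b := by
    refine Summable.of_norm_bounded ((hH.summable_rows ht₀ h₀ hn).mul_left (euc v ^ n / δ))
      fun ρ => ?_
    have hp := euc_pos ρ.ne_zero
    have hv0 := euc_nonneg v
    rw [hb]
    dsimp only
    split_ifs with h0
    · rw [norm_zero]; positivity
    · rw [norm_div, norm_pow, div_mul_eq_mul_div]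
      refine div_le_div₀ (by positivity) ?_ hδ (hlow' ρ h0)
      have := norm_dotProduct_le_euc (dualRow ρ.1) v
      rw [euc_dualRow ρ.ne_zero] at this
      calc _ ≤ ((euc ρ.1)⁻¹ * euc v) ^ n := by gcongr
        _ = _ := by rw [mul_pow, inv_pow, mul_comm]
  have hbs' : Summable fun ρ => b (Row.mulEquiv hh ρ) := (Row.mulEquiv hh).summable_iff.2 hbs
  have hterm (ρ : Row H) : (if ρ.1 ⬝ᵥ v = 0 then term n ρ.1 h v else 0)
      = term n ρ.1 h v - (b ρ - b (Row.mulEquiv hh ρ)) := by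
    have h1 : (Row.mulEquiv hh ρ).1 ⬝ᵥ v = ρ.1 ⬝ᵥ v := by
      have := vecMul_dotProduct_inv ρ.1 v h
      rwa [hfix] at this
    have h2 := term_mul_dotProduct n ρ.ne_zero h v
    rw [hfix] at h2
    simp only [hb, h1]
    split_ifs with h0
    · simp
    · rw [← sub_div, eq_comm, sub_eq_zero, eq_div_iff h0, h2]
      rfl
  rw [tsum_congr hterm, (hH.summable_term ht₀ h₀ hn h v).tsum_sub (hbs.sub hbs'),
    hbs.tsum_sub hbs', (Row.mulEquiv hh).tsum_eq b, sub_self, sub_zero, cocycle]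

lemma Good.cocycle_eq_zero (hH : Good H) {t₀ : ℂ} (ht₀ : t₀ ≠ 0) (h₀ : shear t₀ ∈ H) {n : ℕ}
    (hn : 36 ≤ n) {v : Fin 2 → ℂ} (hv : unip v ∈ H) {h : SL2C} (hh : h ∈ H)
    (hfix : ⇡h⁻¹ *ᵥ v = v) (hne : ∀ g ∈ H, (⇡g *ᵥ v) 1 ≠ 0) : cocycle H n h v = 0 := by
  classical
  rw [hH.cocycle_fixed ht₀ h₀ hn hv hh hfix]
  refine (tsum_congr fun ρ => ?_).trans tsum_zero
  obtain ⟨_, g, hg, rfl⟩ := ρ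
  exact if_neg (hne g hg)

lemma Good.cocycle_shear (hH : Good H) {t₀ : ℂ} (ht₀ : t₀ ≠ 0) (h₀ : shear t₀ ∈ H) {n : ℕ}
    (hn : 36 ≤ n) (hodd : Odd n) : cocycle H n (shear t₀) ![1, 0] ≠ 0 := by
  classical
  obtain ⟨s, hs, hsu⟩ := exists_sq_smul_e1 t₀
  have hs0 : s ≠ 0 := by
    rintro rfl; exact ht₀ (by simpa using hs.symm)
  have hfix : ⇡(shear t₀)⁻¹ *ᵥ (s • ![1, 0]) = s • ![1, 0] := by
    rw [mulVec_smul, shear_inv, shear_e1]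
  have h1 := hH.cocycle_fixed ht₀ h₀ hn (hsu ▸ h₀) h₀ hfix
  intro h0
  rw [cocycle_smul, h0, mul_zero] at h1
  have hrow (ρ : Row H) (hρ : ρ.1 ⬝ᵥ (s • ![1, 0]) = 0) : ρ.1 = ![0, 1] ∨ ρ.1 = ![0, -1] := by
    obtain ⟨_, g, hg, rfl⟩ := ρ
    have hg0 : ⇡g 1 0 = 0 := by simpa [dotProduct, Fin.sum_univ_two, hs0] using hρ
    obtain ⟨t, rfl | rfl⟩ := hH.eq_shear_of_triangular ht₀ h₀ hg hg0
    · left; ext i; fin_cases i <;> simp [mat_shear]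
    · right; ext i; fin_cases i <;> simp [mat_shear, mat_neg]
  have heven : Even (n - 1) := Nat.Odd.sub_odd hodd odd_one
  have hterm (d : ℂ) (hd : d ^ 2 = 1) :
      term n ![0, d] (shear t₀) (s • ![1, 0]) = t₀ * n * s ^ (n - 1) := by
    have hd0 : d ≠ 0 := by
      rintro rfl; norm_num at hd
    have hdn : (![0, d] : Fin 2 → ℂ) ≠ 0 := fun h => hd0 (congrFun h 1)
    have hdd : ‖d‖ = 1 := by
      have : ‖d‖ ^ 2 = 1 := by rw [← norm_pow, hd, norm_one]
      exact (pow_eq_one_iff_of_nonneg (norm_nonneg _) two_ne_zero).1 this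
    have he : euc ![0, d] = 1 := by simp [euc, hdd]
    have hv : (![0, d] : Fin 2 → ℂ) ᵥ* ⇡(shear t₀) = ![0, d] := by
      rw [mat_shear]; ext i; fin_cases i <;> simp [vecMul, dotProduct, Fin.sum_univ_two]
    have hc : starRingEnd ℂ d = d := by
      rcases mul_self_eq_one_iff.1 ((sq d).symm.trans hd) with rfl | rfl <;> simp
    have hdr : dualRow ![0, d] = ![d, 0] := by
      ext i; fin_cases i <;> simp [dualRow, he, hc]
    have hdef := defect_mul_dotProduct hdn (shear t₀) ![0, 1]
    rw [hv, hdr, shear_inv, mat_shear] at hdef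
    simp only [dotProduct, mulVec, Fin.sum_univ_two] at hdef
    simp at hdef
    have hdef' : defect ![0, d] (shear t₀) = t₀ :=
      mul_right_cancel₀ hd0 (by linear_combination -hdef)
    have hdp : dualRow ![0, d] ⬝ᵥ (s • ![1, 0]) = d * s := by
      rw [hdr]; simp [dotProduct, Fin.sum_univ_two]
    rw [term_of_dotProduct_eq_zero n hdn _ (by simp [dotProduct, Fin.sum_univ_two]), hdef', hdp,
      mul_pow]
    obtain ⟨k, hk⟩ := heven.two_dvd
    rw [hk, pow_mul, hd, one_pow]
    ring
  have hm1 : ∃ g ∈ H, ⇡g 1 = ![0, 1] := ⟨1, one_mem _, by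
    rw [mat_one]
    ext i
    fin_cases i
    · exact one_apply_ne (by decide)
    · exact one_apply_eq 1⟩
  have hm2 : ∃ g ∈ H, ⇡g 1 = ![0, -1] := ⟨-1, hH.neg, by
    rw [mat_neg_one]
    ext i
    fin_cases i
    · exact neg_eq_zero.2 (one_apply_ne (by decide))
    · exact congrArg Neg.neg (one_apply_eq 1)⟩
  rw [tsum_eq_sum (s := {⟨_, hm1⟩, ⟨_, hm2⟩})] at h1
  · rw [Finset.sum_pair, if_pos, if_pos, hterm 1 (by norm_num), hterm (-1) (by norm_num)] at h1
    · have hn0 : (n : ℂ) ≠ 0 := by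
        have : n ≠ 0 := by omega
        exact_mod_cast this
      have h2 : t₀ * n * s ^ (n - 1) ≠ 0 :=
        mul_ne_zero (mul_ne_zero ht₀ hn0) (pow_ne_zero _ hs0)
      exact h2 (by linear_combination -(1 / 2 : ℂ) * h1)
    · simp [dotProduct, Fin.sum_univ_two]
    · simp [dotProduct, Fin.sum_univ_two]
    · intro h
      have := congrFun (congrArg Subtype.val h) 1
      norm_num at this
  · intro ρ hρ
    refine if_neg fun hz => hρ ?_
    rw [Finset.mem_insert, Finset.mem_singleton, Subtype.ext_iff, Subtype.ext_iff]
    exact hrow ρ hz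

/-- The linear forms on `ℂ²`. -/
def linForms : Submodule ℂ ((Fin 2 → ℂ) → ℂ) :=
  Submodule.span ℂ (Set.range fun i u => u i)

lemma linForms_fg : linForms.FG := Submodule.fg_span (Set.finite_range _)

lemma linForms_add_smul {f : (Fin 2 → ℂ) → ℂ} (hf : f ∈ linForms) (u v : Fin 2 → ℂ) (r : ℂ) :
    f (u + r • v) = f u + r * f v := by
  induction hf using Submodule.span_induction with
  | mem f h => obtain ⟨i, rfl⟩ := h; simp
  | zero => simp
  | add f g _ _ hf hg => simp only [Pi.add_apply, hf, hg]; ring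
  | smul c f _ hf => simp only [Pi.smul_apply, smul_eq_mul, hf]; ring

lemma dotProduct_mem_linForms (ρ : Fin 2 → ℂ) : (fun u => ρ ⬝ᵥ u) ∈ linForms := by
  have : (fun u : Fin 2 → ℂ => ρ ⬝ᵥ u) = ∑ i, ρ i • fun u : Fin 2 → ℂ => u i := by
    ext u; simp [dotProduct]
  rw [this]
  exact Submodule.sum_mem _ fun i _ =>
    Submodule.smul_mem _ _ (Submodule.subset_span ⟨i, rfl⟩)

/-- The action of `SL(2, ℂ)` on functions on `ℂ²`. -/
def pull (h : SL2C) : ((Fin 2 → ℂ) → ℂ) →ₐ[ℂ] ((Fin 2 → ℂ) → ℂ) where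
  toFun f u := f (⇡h⁻¹ *ᵥ u)
  map_one' := rfl
  map_mul' _ _ := rfl
  map_zero' := rfl
  map_add' _ _ := rfl
  commutes' _ := rfl

lemma pull_apply (h : SL2C) (f : (Fin 2 → ℂ) → ℂ) (u : Fin 2 → ℂ) :
    pull h f u = f (⇡h⁻¹ *ᵥ u) := rfl

lemma pull_mul (h k : SL2C) (f : (Fin 2 → ℂ) → ℂ) : pull (h * k) f = pull h (pull k f) := by
  ext u
  rw [pull_apply, pull_apply, pull_apply, _root_.mul_inv_rev, mat_mul, mulVec_mulVec]

lemma pull_one (f : (Fin 2 → ℂ) → ℂ) : pull 1 f = f := by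
  ext u
  rw [pull_apply, inv_one, mat_one, one_mulVec]

lemma pull_mem_forms (h : SL2C) {a : ℕ} {f : (Fin 2 → ℂ) → ℂ} (hf : f ∈ linForms ^ a) :
    pull h f ∈ linForms ^ a := by
  have h1 : linForms.map (pull h).toLinearMap ≤ linForms := by
    rw [linForms, Submodule.map_span, Submodule.span_le]
    rintro _ ⟨_, ⟨i, rfl⟩, rfl⟩
    exact dotProduct_mem_linForms (⇡h⁻¹ i)
  have h2 : pull h f ∈ (linForms ^ a).map (pull h).toLinearMap := ⟨f, hf, rfl⟩
  rw [Submodule.map_pow] at h2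
  exact pow_le_pow_left' h1 a h2

lemma exists_polynomial {a : ℕ} {f : (Fin 2 → ℂ) → ℂ} (hf : f ∈ linForms ^ a)
    (u v : Fin 2 → ℂ) : ∃ q : Polynomial ℂ, q.natDegree ≤ a ∧ q.coeff a = f v ∧
      ∀ r : ℂ, q.eval r = f (u + r • v) := by
  induction hf using Submodule.pow_induction_on_left' with
  | algebraMap r => exact ⟨Polynomial.C r, by simp, by simp, fun _ => by simp⟩
  | add f g i _ _ hf hg =>
    obtain ⟨p, hp, hp', hp''⟩ := hf
    obtain ⟨q, hq, hq', hq''⟩ := hg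
    exact ⟨p + q, (Polynomial.natDegree_add_le_of_degree_le hp hq), by simp [hp', hq'],
      fun r => by simp [hp'', hq'']⟩
  | mem_mul l hl i g _ hg =>
    obtain ⟨q, hq, hq', hq''⟩ := hg
    have hd : (Polynomial.C (l v) * Polynomial.X + Polynomial.C (l u)).natDegree ≤ 1 :=
      Polynomial.natDegree_linear_le
    refine ⟨(Polynomial.C (l v) * Polynomial.X + Polynomial.C (l u)) * q, ?_, ?_, fun r => ?_⟩
    · exact (Polynomial.natDegree_mul_le_of_le hd hq).trans (by omega)
    · rw [Nat.succ_eq_add_one, add_comm i, Polynomial.coeff_mul_add_eq_of_natDegree_le hd hq, hq']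
      simp
    · rw [Polynomial.eval_mul, hq'', Pi.mul_apply, linForms_add_smul hl]
      simp only [Polynomial.eval_add, Polynomial.eval_mul, Polynomial.eval_C, Polynomial.eval_X]
      ring

lemma fwdDiff_iter_eval {q : Polynomial ℂ} {a : ℕ} (h : q.natDegree ≤ a) :
    (fwdDiff 1)^[a] q.eval = fun _ => q.coeff a * a.factorial := by
  rcases h.lt_or_eq with h | rfl
  · rw [Polynomial.fwdDiff_iter_eq_zero_of_degree_lt h, Polynomial.coeff_eq_zero_of_natDegree_lt h]
    ext; simp
  · rw [Polynomial.fwdDiff_iter_degree_eq_factorial]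
    ext; simp

lemma pull_sub_one_mul_apply (p : SL2C) (D : Module.End ℂ ((Fin 2 → ℂ) → ℂ))
    (f : (Fin 2 → ℂ) → ℂ) (u : Fin 2 → ℂ) :
    (((pull p).toLinearMap - 1) * D) f u = D f (⇡p⁻¹ *ᵥ u) - D f u := rfl

lemma pull_sub_one_pow (p : SL2C) (u : Fin 2 → ℂ)
    (hp : ⇡p⁻¹ *ᵥ (⇡p⁻¹ *ᵥ u - u) = ⇡p⁻¹ *ᵥ u - u) (f : (Fin 2 → ℂ) → ℂ) (k : ℕ) (r : ℂ) :
    (((pull p).toLinearMap - 1) ^ k) f (u + r • (⇡p⁻¹ *ᵥ u - u)) =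
      (fwdDiff 1)^[k] (fun r => f (u + r • (⇡p⁻¹ *ᵥ u - u))) r := by
  induction k generalizing r with
  | zero => rfl
  | succ k ih =>
    rw [Function.iterate_succ_apply', fwdDiff, ← ih, ← ih, pow_succ', pull_sub_one_mul_apply,
      mulVec_add, mulVec_smul, hp]
    have : ⇡p⁻¹ *ᵥ u + r • (⇡p⁻¹ *ᵥ u - u) = u + (r + 1) • (⇡p⁻¹ *ᵥ u - u) := by
      rw [add_smul, one_smul]; abel
    rw [this]

lemma unip_inv (v : Fin 2 → ℂ) : ⇡(unip v)⁻¹ = 1 - nilp v := by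
  rw [mat_inv, unip_val]
  ext i j; fin_cases i <;> fin_cases j <;> simp [nilp, sub_eq_add_neg]

lemma unip_inv_mulVec_sub (w u : Fin 2 → ℂ) :
    ∃ c : ℂ, ⇡(unip w)⁻¹ *ᵥ u - u = c • w := by
  refine ⟨w 1 * u 0 - w 0 * u 1, ?_⟩
  rw [unip_inv, sub_mulVec, one_mulVec, sub_sub_cancel_left]
  ext i; fin_cases i <;> simp [nilp, dotProduct, Fin.sum_univ_two] <;> ring

lemma unip_inv_mulVec_self (w : Fin 2 → ℂ) (c : ℂ) : ⇡(unip w)⁻¹ *ᵥ (c • w) = c • w := by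
  conv_lhs => rw [← unip_mulVec_smul c w]
  exact inv_mulVec_mulVec _ _

lemma pull_unip_sub_one_pow (w : Fin 2 → ℂ) {a : ℕ} {f : (Fin 2 → ℂ) → ℂ}
    (hf : f ∈ linForms ^ a) (u : Fin 2 → ℂ) :
    (((pull (unip w)).toLinearMap - 1) ^ a) f u =
      f (⇡(unip w)⁻¹ *ᵥ u - u) * a.factorial := by
  obtain ⟨c, hc⟩ := unip_inv_mulVec_sub w u
  obtain ⟨q, hq, hq', hq''⟩ := exists_polynomial hf u (⇡(unip w)⁻¹ *ᵥ u - u)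
  have h := pull_sub_one_pow (unip w) u (by rw [hc, unip_inv_mulVec_self]) f a 0
  rw [← funext hq'', fwdDiff_iter_eval hq, zero_smul, add_zero, hq'] at h
  exact h

lemma pull_unip_sub_one_pow_succ (w : Fin 2 → ℂ) {a : ℕ} {f : (Fin 2 → ℂ) → ℂ}
    (hf : f ∈ linForms ^ a) : (((pull (unip w)).toLinearMap - 1) ^ (a + 1)) f = 0 := by
  ext u
  obtain ⟨c, hc⟩ := unip_inv_mulVec_sub w u
  rw [pow_succ', pull_sub_one_mul_apply, pull_unip_sub_one_pow w hf, pull_unip_sub_one_pow w hf,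
    ← mulVec_sub, hc, unip_inv_mulVec_self, sub_self, Pi.zero_apply]

lemma term_mem_forms (n : ℕ) (ρ : Fin 2 → ℂ) (h : SL2C) :
    term n ρ h ∈ linForms ^ (n - 1) := by
  have : term n ρ h = defect ρ h • ∑ i ∈ Finset.range n, (fun u => dualRow ρ ⬝ᵥ u) ^ i *
      pull h (fun u => dualRow (ρ ᵥ* ⇡h) ⬝ᵥ u) ^ (n - 1 - i) := by
    ext u
    simp only [term, Pi.smul_apply, Finset.sum_apply, Pi.mul_apply, Pi.pow_apply, pull_apply,
      smul_eq_mul]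
  rw [this]
  refine Submodule.smul_mem _ _ (Submodule.sum_mem _ fun i hi => ?_)
  have hi' : n - 1 = i + (n - 1 - i) := by
    have := Finset.mem_range.1 hi
    omega
  conv => enter [1, 2]; rw [hi']
  rw [pow_add]
  refine Submodule.mul_mem_mul (Submodule.pow_mem_pow _ (dotProduct_mem_linForms _) _) ?_
  refine Submodule.pow_mem_pow _ ?_ _
  have := pull_mem_forms h (a := 1) (f := fun u => dualRow (ρ ᵥ* ⇡h) ⬝ᵥ u)
  rw [pow_one] at this
  exact this (dotProduct_mem_linForms _)

lemma Good.cocycle_mem_forms (hH : Good H) {t₀ : ℂ} (ht₀ : t₀ ≠ 0) (h₀ : shear t₀ ∈ H) {n : ℕ}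
    (hn : 36 ≤ n) (h : SL2C) : cocycle H n h ∈ linForms ^ (n - 1) := by
  have hfg : FiniteDimensional ℂ ↥(linForms ^ (n - 1)) :=
    Module.Finite.iff_fg.2 (linForms_fg.pow _)
  have hs : HasSum (fun ρ : Row H => term n ρ.1 h) (cocycle H n h) :=
    Pi.hasSum.2 fun u => (hH.summable_term ht₀ h₀ hn h u).hasSum
  refine (Submodule.closed_of_finiteDimensional (linForms ^ (n - 1))).mem_of_tendsto hs
    (Filter.Eventually.of_forall fun s => ?_)
  exact Submodule.sum_mem _ fun ρ _ => term_mem_forms n ρ.1 h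

/-- The affine representation attached to the cocycle. -/
noncomputable def Good.affineRep (hH : Good H) {t₀ : ℂ} (ht₀ : t₀ ≠ 0) (h₀ : shear t₀ ∈ H) {n : ℕ}
    (hn : 36 ≤ n) : H →* Module.End ℂ (((Fin 2 → ℂ) → ℂ) × ℂ) where
  toFun h :=
    { toFun := fun x => (pull h x.1 + x.2 • cocycle H n h, x.2)
      map_add' := fun x y => by
        ext
        · simp only [Prod.fst_add, Prod.snd_add, map_add, Pi.add_apply, Pi.smul_apply, smul_eq_mul]
          ring
        · rfl
      map_smul' := fun c x => by
        ext
        · simp only [Prod.smul_fst, Prod.smul_snd, map_smul, Pi.add_apply, Pi.smul_apply,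
            smul_eq_mul, RingHom.id_apply]
          ring
        · rfl }
  map_one' := by
    have h1 : cocycle H n 1 = 0 := by
      ext u
      have := hH.cocycle_mul ht₀ h₀ hn (one_mem H) 1 u
      rw [mul_one, inv_one, mat_one, one_mulVec] at this
      exact left_eq_add.1 this
    refine LinearMap.ext fun x => ?_
    change (pull 1 x.1 + x.2 • cocycle H n 1, x.2) = x
    rw [pull_one, h1, smul_zero, add_zero]
  map_mul' h k := by
    refine LinearMap.ext fun x => ?_
    change (pull (h * k : SL2C) x.1 + x.2 • cocycle H n (h * k), x.2) =
      (pull h (pull k x.1 + x.2 • cocycle H n k) + x.2 • cocycle H n h, x.2)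
    have h1 : cocycle H n (h * k) = cocycle H n h + pull h (cocycle H n k) :=
      funext fun u => hH.cocycle_mul ht₀ h₀ hn h.2 k u
    rw [pull_mul, map_add, map_smul, h1, smul_add]
    congr 1
    abel

lemma Good.affineRep_apply (hH : Good H) {t₀ : ℂ} (ht₀ : t₀ ≠ 0) (h₀ : shear t₀ ∈ H) {n : ℕ}
    (hn : 36 ≤ n) (h : H) (x : ((Fin 2 → ℂ) → ℂ) × ℂ) :
    hH.affineRep ht₀ h₀ hn h x = (pull h x.1 + x.2 • cocycle H n h, x.2) := rfl

lemma Good.affineRep_sub_one_pow (hH : Good H) {t₀ : ℂ} (ht₀ : t₀ ≠ 0) (h₀ : shear t₀ ∈ H) {n : ℕ}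
    (hn : 36 ≤ n) (h : H) (k : ℕ) (x : ((Fin 2 → ℂ) → ℂ) × ℂ) :
    ((hH.affineRep ht₀ h₀ hn h - 1) ^ (k + 1)) x =
      ((((pull h).toLinearMap - 1) ^ (k + 1)) x.1 +
        x.2 • (((pull h).toLinearMap - 1) ^ k) (cocycle H n h), 0) := by
  induction k with
  | zero =>
    rw [zero_add, pow_one, pow_one, pow_zero]
    change hH.affineRep ht₀ h₀ hn h x - x = _
    rw [affineRep_apply]
    ext
    · change _ = (pull h x.1 - x.1) _ + _
      simp only [Prod.fst_sub, Pi.sub_apply, Pi.add_apply]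
      change _ - _ = _ - _ + (x.2 • cocycle H n h) _
      ring
    · exact sub_self _
  | succ k ih =>
    rw [pow_succ']
    change hH.affineRep ht₀ h₀ hn h (((hH.affineRep ht₀ h₀ hn h - 1) ^ (k + 1)) x) -
      ((hH.affineRep ht₀ h₀ hn h - 1) ^ (k + 1)) x = _
    have h1 (y : (Fin 2 → ℂ) → ℂ) : pull h y = ((pull h).toLinearMap - 1) y + y :=
      (sub_add_cancel _ _).symm
    have h2 (j : ℕ) (y : (Fin 2 → ℂ) → ℂ) : (((pull h).toLinearMap - 1) ^ (j + 1)) y =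
        ((pull h).toLinearMap - 1) ((((pull h).toLinearMap - 1) ^ j) y) := by
      rw [pow_succ']; rfl
    rw [ih, affineRep_apply, zero_smul, add_zero]
    refine Prod.ext ?_ (sub_self _)
    rw [Prod.fst_sub, h1, add_sub_cancel_right, map_add, map_smul, ← h2, ← h2]

/-- The module of the affine representation. -/
def affineForms (n : ℕ) : Submodule ℂ (((Fin 2 → ℂ) → ℂ) × ℂ) := (linForms ^ (n - 1)).prod ⊤

lemma affineForms_fg (n : ℕ) : (affineForms n).FG :=
  (linForms_fg.pow _).prod Module.Finite.fg_top

lemma Good.affineRep_mem (hH : Good H) {t₀ : ℂ} (ht₀ : t₀ ≠ 0) (h₀ : shear t₀ ∈ H) {n : ℕ}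
    (hn : 36 ≤ n) (h : H) {x : ((Fin 2 → ℂ) → ℂ) × ℂ} (hx : x ∈ affineForms n) :
    hH.affineRep ht₀ h₀ hn h x ∈ affineForms n :=
  ⟨Submodule.add_mem _ (pull_mem_forms _ hx.1)
    (Submodule.smul_mem _ _ (hH.cocycle_mem_forms ht₀ h₀ hn _)), trivial⟩

lemma forms_neg {a : ℕ} (ha : Even a) {f : (Fin 2 → ℂ) → ℂ} (hf : f ∈ linForms ^ a)
    (u : Fin 2 → ℂ) : f (-u) = f u := by
  suffices h : f (-u) = (-1) ^ a * f u by rw [h, ha.neg_one_pow, one_mul]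
  clear ha
  induction hf using Submodule.pow_induction_on_left' with
  | algebraMap r => simp
  | add f g i _ _ hf hg => rw [Pi.add_apply, Pi.add_apply, hf, hg, mul_add]
  | mem_mul l hl i g _ hg =>
    have := linForms_add_smul hl 0 u (-1)
    have h0 := linForms_add_smul hl 0 0 1
    simp only [smul_zero, add_zero, zero_add, neg_smul, one_smul, one_mul] at this h0
    rw [Pi.mul_apply, Pi.mul_apply, hg, this, left_eq_add.1 h0, pow_succ]
    ring

lemma Good.affineRep_neg_one (hH : Good H) {t₀ : ℂ} (ht₀ : t₀ ≠ 0) (h₀ : shear t₀ ∈ H) {n : ℕ}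
    (hn : 36 ≤ n) (hodd : Odd n) {h : H} (hh : (h : SL2C) = -1)
    {x : ((Fin 2 → ℂ) → ℂ) × ℂ} (hx : x ∈ affineForms n) :
    hH.affineRep ht₀ h₀ hn h x = x := by
  have h2 : cocycle H n (-1) = 0 := funext fun u => cocycle_neg_one n u
  have h3 : pull (-1) x.1 = x.1 := by
    ext u
    rw [pull_apply, neg_one_inv, mat_neg_one, neg_mulVec, one_mulVec]
    exact forms_neg (Nat.Odd.sub_odd hodd odd_one) hx.1 u
  rw [affineRep_apply, hh, h2, h3, smul_zero, add_zero]

lemma Good.affineRep_unip (hH : Good H) {t₀ : ℂ} (ht₀ : t₀ ≠ 0) (h₀ : shear t₀ ∈ H) {n : ℕ}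
    (hn : 36 ≤ n) {h : H} {w : Fin 2 → ℂ} (hw : (h : SL2C) = unip w)
    (hne : ∀ g ∈ H, (⇡g *ᵥ w) 1 ≠ 0) {x : ((Fin 2 → ℂ) → ℂ) × ℂ} (hx : x ∈ affineForms n) :
    ((hH.affineRep ht₀ h₀ hn h - 1) ^ (n - 1 + 1)) x = 0 := by
  have hc := hH.cocycle_mem_forms ht₀ h₀ hn (unip w)
  have hwH : unip w ∈ H := hw ▸ h.2
  have h1 : (((pull (unip w)).toLinearMap - 1) ^ (n - 1)) (cocycle H n (unip w)) = 0 := by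
    ext u
    obtain ⟨c, hc'⟩ := unip_inv_mulVec_sub w u
    have hfix := unip_inv_mulVec_self w 1
    rw [one_smul] at hfix
    rw [pull_unip_sub_one_pow w hc, hc', cocycle_smul,
      hH.cocycle_eq_zero ht₀ h₀ hn hwH hwH hfix hne]
    simp
  rw [affineRep_sub_one_pow, hw, h1, pull_unip_sub_one_pow_succ w hx.1, smul_zero, add_zero]
  rfl

lemma Good.affineRep_shear (hH : Good H) {t₀ : ℂ} (ht₀ : t₀ ≠ 0) (h₀ : shear t₀ ∈ H) {n : ℕ}
    (hn : 36 ≤ n) (hodd : Odd n) {h : H} (hh : (h : SL2C) = shear t₀) :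
    ((hH.affineRep ht₀ h₀ hn h - 1) ^ (n - 1 + 1)) (0, 1) ≠ 0 := by
  intro h0
  obtain ⟨s, -, hsu⟩ := exists_sq_smul_e1 t₀
  have hc := hH.cocycle_mem_forms ht₀ h₀ hn (shear t₀)
  rw [affineRep_sub_one_pow, map_zero, zero_add, one_smul, hh] at h0
  have h1 := congrFun (congrArg Prod.fst h0) ![0, 1]
  have h3 : ⇡(shear t₀)⁻¹ *ᵥ ![0, 1] - ![0, 1] = (-t₀) • ![1, 0] := by
    rw [shear_inv, mat_shear]
    ext i; fin_cases i <;> simp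
  have h4 := pull_unip_sub_one_pow (s • ![1, 0]) (hsu ▸ hc) ![0, 1]
  rw [← hsu, h3, cocycle_smul] at h4
  change (((pull (shear t₀)).toLinearMap - 1) ^ (n - 1)) (cocycle H n (shear t₀)) ![0, 1] = 0 at h1
  rw [h1] at h4
  have h5 := hH.cocycle_shear ht₀ h₀ hn hodd
  have h6 : (-t₀) ^ (n - 1) ≠ 0 := pow_ne_zero _ (neg_ne_zero.2 ht₀)
  have h7 : ((n - 1).factorial : ℂ) ≠ 0 := Nat.cast_ne_zero.2 (Nat.factorial_ne_zero _)
  exact mul_ne_zero (mul_ne_zero h6 h5) h7 h4.symm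

end SL2C

lemma Int.isJacobsonRing : IsJacobsonRing ℤ := by
  refine isJacobsonRing_iff_prime_eq.2 fun P hP => ?_
  rcases eq_or_ne P ⊥ with rfl | h
  · refine le_antisymm (fun x hx => ?_) Ideal.le_jacobson
    have h1 := Int.isUnit_iff.1 (Ideal.mem_jacobson_bot.1 hx x)
    rw [Ideal.mem_bot]
    rcases h1 with h1 | h1
    · exact mul_self_eq_zero.1 (by linarith)
    · linarith [mul_self_nonneg x]
  · have := hP.isMaximal h
    exact Ideal.jacobson_eq_self_of_isMaximal

lemma finite_of_finiteType_int (K : Type) [Field K] [hA : Algebra ℤ K] [Algebra.FiniteType ℤ K] :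
    Finite K := by
  have hjac := Int.isJacobsonRing
  obtain rfl : hA = Ring.toIntAlgebra K := Subsingleton.elim _ _
  have hfin : Module.Finite ℤ K := finite_of_finite_type_of_isJacobsonRing ℤ K
  have hinj : ¬Function.Injective (algebraMap ℤ K) := fun h =>
    Int.not_isField (isField_of_isIntegral_of_isField h (Field.toIsField K))
  rw [injective_iff_map_eq_zero] at hinj
  push Not at hinj
  obtain ⟨n, hn, hn0⟩ := hinj
  refine Module.finite_of_fg_torsion K fun x => ⟨⟨n, mem_nonZeroDivisors_of_ne_zero hn0⟩, ?_⟩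
  change n • x = 0
  rw [zsmul_eq_mul, ← eq_intCast (algebraMap ℤ K), hn, zero_mul]

lemma exists_finite_residue {S : Set ℂ} (hS : S.Finite) {x : ℂ} (hx : x ≠ 0) :
    ∃ (R : Subalgebra ℤ ℂ) (K : Type) (_ : Field K) (_ : Finite K) (f : R →+* K),
      S ⊆ R ∧ ∀ y : R, (y : ℂ) = x → f y ≠ 0 := by
  let R := Algebra.adjoin ℤ (insert x⁻¹ S)
  have hSR : S ⊆ R := (Set.subset_insert _ _).trans Algebra.subset_adjoin
  have hfg : Algebra.FiniteType ℤ R := .adjoin_of_finite (hS.insert _)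
  obtain ⟨m, hm⟩ := Ideal.exists_maximal R
  let _ : Field (R ⧸ m) := Ideal.Quotient.field m
  have hfq : Algebra.FiniteType ℤ (R ⧸ m) :=
    Algebra.FiniteType.of_surjective (Ideal.Quotient.mkₐ ℤ m) (Ideal.Quotient.mkₐ_surjective ℤ m)
  refine ⟨R, R ⧸ m, inferInstance, @finite_of_finiteType_int (R ⧸ m) _ _ hfq, Ideal.Quotient.mk m,
    hSR, fun y hy h0 => ?_⟩
  let z : R := ⟨x⁻¹, Algebra.subset_adjoin (Set.mem_insert _ _)⟩
  have h1 : y * z = 1 := Subtype.ext (by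
    change (y : ℂ) * x⁻¹ = 1
    rw [hy, mul_inv_cancel₀ hx])
  have h2 := congrArg (Ideal.Quotient.mk m) h1
  rw [map_mul, h0, zero_mul, map_one] at h2
  exact zero_ne_one h2

lemma sub_one_pow_of_isConj {R : Type} [Ring R] {k : ℕ} {x y : Rˣ} (h : IsConj x y)
    (hy : ((y : R) - 1) ^ k = 0) : ((x : R) - 1) ^ k = 0 := by
  obtain ⟨c, hc⟩ := isConj_iff.1 h.symm
  have h1 : (x : R) - 1 = c * ((y : R) - 1) * ((c⁻¹ : Rˣ) : R) := by
    rw [← hc, mul_sub, sub_mul, mul_one, Units.val_mul, Units.val_mul, Units.mul_inv]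
  rw [h1, Units.conj_pow, hy, mul_zero, zero_mul]

/-- A matrix representation of a finitely generated group in which `γ - 1` is not nilpotent of
order `k` separates `γ` from the elements unipotent of order `k` in a finite quotient. -/
lemma exists_finite_quotient_of_matrix {G : Type} [Group G] (hG : Group.FG G) {ι : Type} [Fintype ι]
    [DecidableEq ι] (ρ : G →* Matrix ι ι ℂ) (k : ℕ) {γ : G} (hγ : (ρ γ - 1) ^ k ≠ 0) :
    ∃ (F : Type) (_ : Group F) (_ : Finite F) (φ : G →* F), (∀ g, ρ g = 1 → φ g = 1) ∧
      ∀ p, (ρ p - 1) ^ k = 0 → ¬IsConj (φ γ) (φ p) := by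
  obtain ⟨T, hT, hTfin⟩ := Monoid.fg_iff.1 (Group.fg_iff_monoid_fg.1 hG)
  obtain ⟨a, b, hab⟩ : ∃ a b, ((ρ γ - 1) ^ k) a b ≠ 0 := by
    by_contra! h
    exact hγ (Matrix.ext h)
  let S : Set ℂ := (⋃ t ∈ T, Set.range fun ij : ι × ι => ρ t ij.1 ij.2)
  have hS : S.Finite := hTfin.biUnion fun t _ => Set.finite_range _
  obtain ⟨R, K, _, _, f, hSR, hf⟩ := exists_finite_residue hS hab
  let incl : Matrix ι ι R →+* Matrix ι ι ℂ := R.val.toRingHom.mapMatrix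
  have hincl : Function.Injective incl := Matrix.map_injective Subtype.val_injective
  have hmem (g : G) : ρ g ∈ MonoidHom.mrange incl.toMonoidHom := by
    have : (⊤ : Submonoid G) ≤ (MonoidHom.mrange incl.toMonoidHom).comap ρ := by
      rw [← hT, Submonoid.closure_le]
      intro t ht
      refine ⟨Matrix.of fun i j => ⟨ρ t i j, hSR (Set.mem_biUnion ht ⟨(i, j), rfl⟩)⟩, ?_⟩
      ext i j
      rfl
    exact this trivial
  choose r hr using hmem
  let ρ' : G →* Matrix ι ι R :=
    { toFun := r
      map_one' := hincl (by
        rw [map_one]; exact (hr 1).trans (map_one ρ))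
      map_mul' := fun g h => hincl (by
        rw [map_mul]
        exact (hr _).trans ((map_mul ρ g h).trans (congrArg₂ _ (hr g).symm (hr h).symm))) }
  have hρ' (g : G) : incl (ρ' g) = ρ g := hr g
  let φ : G →* (Matrix ι ι K)ˣ := ((f.mapMatrix : Matrix ι ι R →+* Matrix ι ι K).toMonoidHom.comp
    ρ').toHomUnits
  have hφ (g : G) : (φ g : Matrix ι ι K) = f.mapMatrix (ρ' g) := rfl
  have hφk (g : G) : ((φ g : Matrix ι ι K) - 1) ^ k = f.mapMatrix ((ρ' g - 1) ^ k) := by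
    rw [hφ, map_pow, map_sub, map_one]
  have hρk (g : G) : incl ((ρ' g - 1) ^ k) = (ρ g - 1) ^ k := by
    rw [← hρ', map_pow, map_sub, map_one]
  refine ⟨(Matrix ι ι K)ˣ, inferInstance, inferInstance, φ, fun g hg => ?_, fun p hp hc => ?_⟩
  · refine Units.ext ?_
    have : ρ' g = 1 := hincl (by rw [hρ', hg, map_one])
    rw [hφ, this, map_one, Units.val_one]
  · have h1 : (ρ' p - 1) ^ k = 0 := hincl (by rw [hρk, hp, map_zero])
    have h2 := sub_one_pow_of_isConj hc (by rw [hφk, h1, map_zero])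
    rw [hφk] at h2
    have h3 : f (((ρ' γ - 1) ^ k) a b) = 0 := congrFun (congrFun h2 a) b
    exact hf _ (congrFun (congrFun (hρk γ) a) b) h3

/-- A representation of a finitely generated group with an invariant finite-dimensional subspace
on which `γ - 1` is not nilpotent of order `k` separates `γ` from the elements which are unipotent
of order `k` there in a finite quotient. -/
lemma exists_finite_quotient_of_rep {G : Type} [Group G] (hG : Group.FG G) {V : Type}
    [AddCommGroup V] [Module ℂ V] (ρ : G →* Module.End ℂ V) {U : Submodule ℂ V} (hU : U.FG)
    (hinv : ∀ g, ∀ x ∈ U, ρ g x ∈ U) (k : ℕ) {γ : G} {x : V} (hx : x ∈ U)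
    (hγ : ((ρ γ - 1) ^ k) x ≠ 0) :
    ∃ (F : Type) (_ : Group F) (_ : Finite F) (φ : G →* F), (∀ g, (∀ y ∈ U, ρ g y = y) → φ g = 1) ∧
      ∀ p, (∀ y ∈ U, ((ρ p - 1) ^ k) y = 0) → ¬IsConj (φ γ) (φ p) := by
  have hfin : FiniteDimensional ℂ U := Module.Finite.iff_fg.2 hU
  let ρU : G →* Module.End ℂ U :=
    { toFun := fun g => (ρ g).restrict (hinv g)
      map_one' := LinearMap.ext fun y => Subtype.ext (by
        change ρ 1 (y : V) = y
        rw [map_one]; rfl)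
      map_mul' := fun g h => LinearMap.ext fun y => Subtype.ext (by
        change ρ (g * h) (y : V) = ρ g (ρ h y)
        rw [map_mul]; rfl) }
  have hpow (g : G) (y : U) : (((ρU g - 1) ^ k) y : V) = ((ρ g - 1) ^ k) (y : V) := by
    induction k with
    | zero => rfl
    | succ k ih =>
      rw [pow_succ', pow_succ']
      change ρ g (((ρU g - 1) ^ k) y : V) - (((ρU g - 1) ^ k) y : V) =
        ρ g (((ρ g - 1) ^ k) (y : V)) - ((ρ g - 1) ^ k) (y : V)
      by_cases hk : ((ρ γ - 1) ^ k) x = 0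
      · refine absurd ?_ hγ
        rw [pow_succ']
        change (ρ γ - 1) (((ρ γ - 1) ^ k) x) = 0
        rw [hk, map_zero]
      · rw [ih hk]
  let e := LinearMap.toMatrixAlgEquiv (Module.finBasis ℂ U)
  let ρM : G →* Matrix (Fin (Module.finrank ℂ U)) (Fin (Module.finrank ℂ U)) ℂ :=
    (e : Module.End ℂ U →* Matrix _ _ ℂ).comp ρU
  have hk (g : G) : (ρM g - 1) ^ k = e ((ρU g - 1) ^ k) := by
    rw [map_pow, map_sub, map_one]; rfl
  obtain ⟨F, i1, i2, φ, h1, h2⟩ := exists_finite_quotient_of_matrix hG ρM k (γ := γ) fun h => by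
    rw [hk, map_eq_zero_iff e e.injective] at h
    have := hpow γ ⟨x, hx⟩
    rw [h] at this
    exact hγ this.symm
  refine ⟨F, i1, i2, φ, fun g hg => h1 g ?_, fun p hp => h2 p ?_⟩
  · have : ρU g = 1 := LinearMap.ext fun y => Subtype.ext (hg y y.2)
    change e (ρU g) = 1
    rw [this, map_one]
  · have : (ρU p - 1) ^ k = 0 := LinearMap.ext fun y => Subtype.ext ((hpow p y).trans (hp y y.2))
    rw [hk, this, map_zero]

namespace SL2C

instance : IsTopologicalGroup SL2C := Matrix.SpecialLinearGroup.topologicalGroup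

instance : SecondCountableTopology SL2C :=
  inferInstanceAs (SecondCountableTopology (Subtype fun A : Fin 2 → Fin 2 → ℂ => Matrix.det A = 1))

instance : BorelSpace PSL2C := ⟨rfl⟩

lemma continuous_mat : Continuous fun g : SL2C => (⇡g : Matrix (Fin 2) (Fin 2) ℂ) :=
  continuous_subtype_val

lemma mem_center_iff_eq {g : SL2C} : g ∈ Subgroup.center SL2C ↔ g = 1 ∨ g = -1 := by
  rw [Matrix.SpecialLinearGroup.mem_center_iff]
  constructor
  · rintro ⟨r, hr, hg⟩
    rw [Fintype.card_fin, sq_eq_one_iff] at hr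
    rcases hr with rfl | rfl
    · exact Or.inl (mat_injective (hg.symm.trans ((map_one _).trans mat_one.symm)))
    · exact Or.inr (mat_injective (hg.symm.trans (by
        rw [map_neg, map_one, mat_neg, mat_one])))
  · rintro (rfl | rfl)
    · exact ⟨1, one_pow _, (map_one _).trans mat_one.symm⟩
    · exact ⟨-1, by simp, by
        rw [map_neg, map_one]; exact ((mat_neg 1).trans (by rw [mat_one])).symm⟩

lemma continuous_hs_sub_one : Continuous fun g : SL2C => hs (⇡g - 1) := by
  have h (i j : Fin 2) : Continuous fun g : SL2C => ⇡g i j := continuous_mat.matrix_elem i j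
  unfold hs
  simp only [Matrix.sub_apply]
  fun_prop

lemma exists_hs_lt_of_mem_nhds {V : Set SL2C} (hV : V ∈ nhds (1 : SL2C)) :
    ∃ ε > 0, ∀ g : SL2C, hs (⇡g - 1) < ε → g ∈ V := by
  obtain ⟨W, hW, hWV⟩ := (mem_nhds_induced (fun g : SL2C => (⇡g : Fin 2 → Fin 2 → ℂ)) 1 V).1 hV
  obtain ⟨ε, hε, hball⟩ := Metric.mem_nhds_iff.1
    (show (W : Set (Fin 2 → Fin 2 → ℂ)) ∈ nhds (fun i j => ⇡(1 : SL2C) i j) from hW)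
  refine ⟨ε, hε, fun g hg => hWV (hball ?_)⟩
  rw [← mat_one] at hg
  refine (dist_pi_lt_iff hε).2 fun i => (dist_pi_lt_iff hε).2 fun j => ?_
  refine lt_of_le_of_lt ?_ hg
  rw [dist_eq_norm]
  exact norm_apply_le_hs (⇡g - ⇡(1 : SL2C)) i j

lemma hs_inv_sub_one (b : SL2C) : hs (⇡b⁻¹ - 1) = hs (⇡b - 1) := by
  simp only [hs, mat_inv]
  simp; congr 1; ring

/-- The preimage in `SL(2, ℂ)` of a subgroup of `PSL(2, ℂ)`. -/
def lift (Γ : Subgroup PSL2C) : Subgroup SL2C := Γ.comap (QuotientGroup.mk' (Subgroup.center SL2C))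

lemma mem_lift {Γ : Subgroup PSL2C} {g : SL2C} : g ∈ lift Γ ↔ (QuotientGroup.mk g : PSL2C) ∈ Γ :=
  Iff.rfl

lemma mk_eq_one_iff {g : SL2C} : (QuotientGroup.mk g : PSL2C) = 1 ↔ g = 1 ∨ g = -1 := by
  rw [QuotientGroup.eq_one_iff, mem_center_iff_eq]

lemma mk_neg (g : SL2C) : (QuotientGroup.mk (-g) : PSL2C) = QuotientGroup.mk g := by
  rw [QuotientGroup.eq]
  refine mem_center_iff_eq.2 (Or.inr ?_)
  rw [inv_mul_eq_iff_eq_mul]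
  simp

lemma mk_eq_mk_iff {g h : SL2C} : (QuotientGroup.mk g : PSL2C) = QuotientGroup.mk h ↔
    g = h ∨ g = -h := by
  constructor
  · intro h1
    rw [eq_comm, QuotientGroup.eq, mem_center_iff_eq, inv_mul_eq_one, inv_mul_eq_iff_eq_mul] at h1
    rcases h1 with h1 | h1
    · exact Or.inl h1.symm
    · exact Or.inr (by rw [h1]; simp)
  · rintro (rfl | rfl)
    · rfl
    · exact mk_neg h

lemma lift_disc {Γ : Subgroup PSL2C} (hΓ : DiscreteTopology Γ) :
    ∃ ε > 0, ∀ g ∈ lift Γ, hs (⇡g - 1) < ε → g = 1 := by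
  obtain ⟨U, hU, hU1⟩ := isOpen_induced_iff.1 (isOpen_discrete ({1} : Set Γ))
  have h1 : (1 : PSL2C) ∈ U := by
    have : (1 : Γ) ∈ (Subtype.val ⁻¹' U : Set Γ) := by rw [hU1]; rfl
    exact this
  have hV : (fun g : SL2C => (QuotientGroup.mk g : PSL2C)) ⁻¹' U ∈ nhds (1 : SL2C) :=
    (hU.preimage QuotientGroup.continuous_mk).mem_nhds h1
  obtain ⟨ε, hε, hεV⟩ := exists_hs_lt_of_mem_nhds hV
  refine ⟨min ε 1, lt_min hε one_pos, fun g hg hlt => ?_⟩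
  have h2 : (⟨QuotientGroup.mk g, hg⟩ : Γ) ∈ (Subtype.val ⁻¹' U : Set Γ) :=
    hεV g (hlt.trans_le (min_le_left _ _))
  rw [hU1] at h2
  have h3 : (QuotientGroup.mk g : PSL2C) = 1 := congrArg Subtype.val h2
  refine (mk_eq_one_iff.1 h3).resolve_right fun h4 => ?_
  have h5 := (norm_apply_le_hs (⇡g - 1) 0 0).trans_lt (hlt.trans_le (min_le_right _ _))
  rw [h4, mat_neg, mat_one] at h5
  norm_num [Matrix.sub_apply] at h5

lemma lift_tf {Γ : Subgroup PSL2C} (htf : ∀ x : Γ, IsOfFinOrder x → x = 1) :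
    ∀ g ∈ lift Γ, ∀ n : ℕ, n ≠ 0 → g ^ n = 1 → g = 1 ∨ g = -1 := by
  intro g hg n hn h
  refine mk_eq_one_iff.1 (congrArg Subtype.val (htf ⟨QuotientGroup.mk g, hg⟩ ?_))
  refine isOfFinOrder_iff_pow_eq_one.2 ⟨n, Nat.pos_of_ne_zero hn, Subtype.ext ?_⟩
  change (QuotientGroup.mk (g ^ n) : PSL2C) = 1
  rw [h]; rfl

lemma exists_separated_seq {H : Subgroup SL2C} {ε : ℝ} (P : SL2C → Prop)
    (hP : ∀ R, ∃ x, P x ∧ ∀ γ ∈ H, R < hs ⇡(γ * x)) :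
    ∃ x : ℕ → SL2C, (∀ n, P (x n)) ∧
      ∀ m n, m ≠ n → ∀ γ ∈ H, ε ≤ hs (⇡((x m)⁻¹ * γ * x n) - 1) := by
  have hsymm : Std.Symm fun x y : SL2C => ∀ γ ∈ H, ε ≤ hs (⇡(x⁻¹ * γ * y) - 1) := by
    refine ⟨fun x y h γ hγ => ?_⟩
    have := h γ⁻¹ (inv_mem hγ)
    rw [← hs_inv_sub_one] at this
    have e : (x⁻¹ * γ⁻¹ * y)⁻¹ = y⁻¹ * γ * x := by group
    rwa [e] at this
  have hstep (s : Finset SL2C) : ∃ y, P y ∧ ∀ x ∈ s, ∀ γ ∈ H, ε ≤ hs (⇡(x⁻¹ * γ * y) - 1) := by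
    obtain ⟨y, hy, hfar⟩ := hP (∑ x ∈ s, hs ⇡x * (3 / 2 + |ε|))
    refine ⟨y, hy, fun x hx γ hγ => ?_⟩
    by_contra! hlt
    have h1 : hs ⇡(x⁻¹ * γ * y) ≤ 3 / 2 + |ε| := by
      have h2 := hs_add (⇡(x⁻¹ * γ * y) - 1) 1
      rw [sub_add_cancel] at h2
      linarith [hs_one_le, le_abs_self ε]
    have h2 : hs ⇡(γ * y) ≤ hs ⇡x * (3 / 2 + |ε|) := by
      have e : γ * y = x * (x⁻¹ * γ * y) := by group
      rw [e]
      exact (hs_mul_le _ _).trans (mul_le_mul_of_nonneg_left h1 (hs_nonneg _))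
    have h3 : hs ⇡x * (3 / 2 + |ε|) ≤ ∑ x ∈ s, hs ⇡x * (3 / 2 + |ε|) :=
      Finset.single_le_sum (f := fun x : SL2C => hs ⇡x * (3 / 2 + |ε|))
        (fun i _ => mul_nonneg (hs_nonneg _) (by positivity)) hx
    exact absurd (hfar γ hγ) (not_lt.2 (h2.trans h3))
  obtain ⟨x, hx, hr⟩ := exists_seq_of_forall_finset_exists' P
    (fun x y : SL2C => ∀ γ ∈ H, ε ≤ hs (⇡(x⁻¹ * γ * y) - 1)) fun s _ => hstep s
  exact ⟨x, hx, fun m n hmn => hr hmn⟩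

lemma exists_small_nhds {ε : ℝ} (hε : 0 < ε) : ∃ U : Set SL2C, IsOpen U ∧ 1 ∈ U ∧
    ∀ u ∈ U, ∀ v ∈ U, hs (⇡(u * v⁻¹) - 1) < ε := by
  have hV : {g : SL2C | hs (⇡g - 1) < ε} ∈ nhds (1 : SL2C) := by
    refine (isOpen_lt continuous_hs_sub_one continuous_const).mem_nhds ?_
    change hs (⇡(1 : SL2C) - 1) < ε
    rw [mat_one, sub_self]
    simpa [hs] using hε
  obtain ⟨U, hU, hUV⟩ := exists_nhds_split_inv hV
  obtain ⟨W, hWU, hWo, hW1⟩ := mem_nhds_iff.1 hU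
  refine ⟨W, hWo, hW1, fun u hu v hv => ?_⟩
  have := hUV u (hWU hu) v (hWU hv)
  rwa [div_eq_mul_inv] at this

open scoped Pointwise in
lemma lift_thick {Γ : Subgroup PSL2C} (hΓ : DiscreteTopology Γ) (hvol : HasFiniteCovolume Γ)
    {ε : ℝ} (hε : 0 < ε) : ∃ R, ∀ x : SL2C,
      (∀ γ ∈ lift Γ, hs (⇡(x⁻¹ * γ * x) - 1) < ε → γ = 1) → ∃ γ ∈ lift Γ, hs ⇡(γ * x) ≤ R := by
  by_contra! hcon
  obtain ⟨x, hx, hsep⟩ := exists_separated_seq (ε := ε) _ hcon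
  obtain ⟨U, hUo, hU1, hU⟩ := exists_small_nhds hε
  obtain ⟨μ, hμ, s, hdom, hfin⟩ := hvol
  have hcount : Countable Γ := countable_of_Lindelof_of_discrete
  let V : Set PSL2C := QuotientGroup.mk '' U
  have hVo : IsOpen V := QuotientGroup.isOpenMap_coe U hUo
  have hkey (γ : PSL2C) (hγ : γ ∈ Γ) (m n : ℕ) (u v : PSL2C) (hu : u ∈ V) (hv : v ∈ V)
      (h : γ * ((x n : PSL2C) * u) = (x m : PSL2C) * v) : γ = 1 ∧ m = n := by
    obtain ⟨u, hu, rfl⟩ := hu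
    obtain ⟨v, hv, rfl⟩ := hv
    obtain ⟨g, rfl⟩ := QuotientGroup.mk_surjective γ
    obtain ⟨g', hg', hgg, he⟩ : ∃ g' : SL2C, g' ∈ lift Γ ∧
        (QuotientGroup.mk g' : PSL2C) = QuotientGroup.mk g ∧ g' * (x n * u) = x m * v := by
      rcases mk_eq_mk_iff.1 (show (QuotientGroup.mk (g * (x n * u)) : PSL2C) =
        QuotientGroup.mk (x m * v) from h) with h1 | h1
      · exact ⟨g, hγ, rfl, h1⟩
      · exact ⟨-g, mem_lift.2 (by rwa [mk_neg]), mk_neg g, by rw [neg_mul, h1, neg_neg]⟩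
    have h2 : (x m)⁻¹ * g' * x n = v * u⁻¹ := by
      rw [eq_mul_inv_iff_mul_eq, mul_assoc, mul_assoc, inv_mul_eq_iff_eq_mul, he]
    have h3 := hU v hv u hu
    rw [← h2] at h3
    by_cases hmn : m = n
    · subst hmn
      refine ⟨?_, rfl⟩
      rw [← hgg, hx m g' hg' h3]; rfl
    · exact absurd (hsep m n hmn g' hg') (not_le.2 h3)
  let t : Set PSL2C := ⋃ n, (x n : PSL2C) • V
  have hVx (n : ℕ) : IsOpen ((x n : PSL2C) • V) := hVo.smul _
  have hle : μ t ≤ μ s := by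
    refine hdom.measure_le_of_pairwise_disjoint (isOpen_iUnion hVx).measurableSet.nullMeasurableSet
      fun γ δ hγδ => (Set.disjoint_left.2 fun y hy hy' => hγδ ?_).aedisjoint
    obtain ⟨z, hz, rfl⟩ := hy.1
    obtain ⟨w, hw, hwz⟩ := hy'.1
    obtain ⟨n, hn⟩ := Set.mem_iUnion.1 hz
    obtain ⟨m, hm⟩ := Set.mem_iUnion.1 hw
    obtain ⟨u, hu, rfl⟩ := hn
    obtain ⟨v, hv, rfl⟩ := hm
    have h1 : (δ : PSL2C) * ((x m : PSL2C) * v) = γ * ((x n : PSL2C) * u) := hwz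
    have h2 := (hkey _ (δ⁻¹ * γ).2 m n u v hu hv (by
      change (δ : PSL2C)⁻¹ * γ * _ = _
      rw [mul_assoc, ← h1, inv_mul_cancel_left])).1
    exact (inv_mul_eq_one.1 (Subtype.ext h2 : δ⁻¹ * γ = 1)).symm
  have htop : μ t = ⊤ := by
    have hd : Pairwise (Function.onFun Disjoint fun n => (x n : PSL2C) • V) := by
      intro m n hmn
      refine Set.disjoint_left.2 fun y hy hy' => hmn ?_
      obtain ⟨v, hv, rfl⟩ := hy
      obtain ⟨u, hu, h⟩ := hy'
      exact (hkey 1 (one_mem _) m n u v hu hv (by rw [one_mul]; exact h)).2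
    have hV0 : μ V ≠ 0 := (hVo.measure_pos μ ⟨1, 1, hU1, rfl⟩).ne'
    rw [measure_iUnion hd fun n => (hVx n).measurableSet]
    simp only [measure_smul]
    exact ENNReal.tsum_const_eq_top_of_ne_zero hV0
  exact hfin (top_le_iff.1 (htop ▸ hle))

/-- The preimage of a torsion-free lattice satisfies the hypotheses collected in `Good`. -/
lemma good_lift {Γ : Subgroup PSL2C} (hΓ : DiscreteTopology Γ) (hvol : HasFiniteCovolume Γ)
    (htf : ∀ x : Γ, IsOfFinOrder x → x = 1) : Good (lift Γ) where
  neg := by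
    rw [mem_lift, mk_neg]
    exact one_mem Γ
  disc := lift_disc hΓ
  thick _ hε := lift_thick hΓ hvol hε
  tf := lift_tf htf

/-- The conjugation action of `SL(2, ℂ)` on matrices. -/
def adRep : SL2C →* Module.End ℂ (Matrix (Fin 2) (Fin 2) ℂ) where
  toFun x := LinearMap.mulLeft ℂ ⇡x * LinearMap.mulRight ℂ ⇡x⁻¹
  map_one' := by
    ext1 M
    simp [mat_one]
  map_mul' x y := by
    refine LinearMap.ext fun M => ?_
    simp [mat_mul, mul_assoc]

lemma adRep_apply (x : SL2C) (M : Matrix (Fin 2) (Fin 2) ℂ) : adRep x M = ⇡x * M * ⇡x⁻¹ :=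
  (mul_assoc _ _ _).symm

lemma adRep_neg_one (M : Matrix (Fin 2) (Fin 2) ℂ) : adRep (-1) M = M := by
  rw [adRep_apply, neg_one_inv, mat_neg_one]; simp

lemma adRep_unip (v : Fin 2 → ℂ) (M : Matrix (Fin 2) (Fin 2) ℂ) :
    ((adRep (unip v) - 1) ^ 3 : Module.End ℂ (Matrix (Fin 2) (Fin 2) ℂ)) M = 0 := by
  have h2 : nilp v * nilp v = 0 := nilp_sq v
  have h2' (A : Matrix (Fin 2) (Fin 2) ℂ) : nilp v * (nilp v * A) = 0 := by
    rw [← mul_assoc, h2, zero_mul]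
  have hD (A : Matrix (Fin 2) (Fin 2) ℂ) : (adRep (unip v) - 1) A =
      nilp v * A - A * nilp v - nilp v * A * nilp v := by
    rw [LinearMap.sub_apply, adRep_apply, unip_inv, unip_val, Module.End.one_apply]
    noncomm_ring
  rw [pow_succ, pow_two, Module.End.mul_apply, Module.End.mul_apply, hD, hD, hD]
  simp [mul_sub, sub_mul, mul_assoc, h2, h2']

lemma adRep_of_discr {x : SL2C} (hx : discr x ≠ 0) :
    ∃ M, ((adRep x - 1) ^ 3 : Module.End ℂ (Matrix (Fin 2) (Fin 2) ℂ)) M ≠ 0 := by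
  obtain ⟨y, μ, hμ, hd, h⟩ := exists_normal_form hx 0
  have hv : ⇡x *ᵥ (⇡y *ᵥ ![1, 0]) = μ • (⇡y *ᵥ ![1, 0]) := by
    have h1 : ⇡(y⁻¹ * x * y) *ᵥ ![1, 0] = μ • ![1, 0] := by
      rw [mulVec_e1, h]; simp
    have h2 := congrArg (fun u => ⇡y *ᵥ u) h1
    simpa only [mat_mul, ← mulVec_mulVec, mulVec_inv_mulVec, mulVec_smul] using h2
  have hy : ⇡y *ᵥ ![1, 0] ≠ 0 := mulVec_ne_zero y (by simp)
  set v := ⇡y *ᵥ ![1, 0]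
  have hD : (adRep x - 1) (nilp v) = (μ ^ 2 - 1) • nilp v := by
    rw [LinearMap.sub_apply, adRep_apply, conj_nilp, hv, nilp_smul, sub_smul, one_smul,
      Module.End.one_apply]
  have hμ2 : μ ^ 2 - 1 ≠ 0 := fun h0 => hd (by
    rw [show μ - μ⁻¹ = (μ ^ 2 - 1) * μ⁻¹ by field_simp, h0, zero_mul])
  refine ⟨nilp v, ?_⟩
  rw [pow_succ, pow_two, Module.End.mul_apply, Module.End.mul_apply, hD, map_smul, hD, map_smul,
    map_smul, hD]
  exact smul_ne_zero hμ2 (smul_ne_zero hμ2 (smul_ne_zero hμ2 (nilp_ne_zero hy)))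

variable {Γ : Subgroup PSL2C}

/-- The projection to `Γ` of a conjugate of its preimage in `SL(2, ℂ)`. -/
def proj (σ : SL2C) (Γ : Subgroup PSL2C) : conjSubgroup σ (lift Γ) →* Γ where
  toFun h := ⟨QuotientGroup.mk (σ * h * σ⁻¹), h.2⟩
  map_one' := Subtype.ext (by simp)
  map_mul' g h := Subtype.ext (by
    change (QuotientGroup.mk (σ * (g * h : SL2C) * σ⁻¹) : PSL2C) =
      QuotientGroup.mk ((σ * g * σ⁻¹) * (σ * h * σ⁻¹))
    have e : σ * (g * h : SL2C) * σ⁻¹ = (σ * g * σ⁻¹) * (σ * h * σ⁻¹) := by group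
    rw [e])

lemma proj_surjective (σ : SL2C) (Γ : Subgroup PSL2C) : Function.Surjective (proj σ Γ) := by
  rintro ⟨x, hx⟩
  obtain ⟨g, rfl⟩ := QuotientGroup.mk_surjective x
  have e : σ * (σ⁻¹ * g * σ) * σ⁻¹ = g := by group
  exact ⟨⟨σ⁻¹ * g * σ, mem_conjSubgroup.2 (by rw [e]; exact hx)⟩, Subtype.ext
    (show (QuotientGroup.mk (σ * (σ⁻¹ * g * σ) * σ⁻¹) : PSL2C) = _ by rw [e])⟩

lemma eq_of_proj_eq_one {σ : SL2C} {h : conjSubgroup σ (lift Γ)} (hh : proj σ Γ h = 1) :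
    (h : SL2C) = 1 ∨ (h : SL2C) = -1 := by
  have e : σ⁻¹ * (σ * h * σ⁻¹) * σ = h := by group
  refine (mk_eq_one_iff.1 (congrArg Subtype.val hh)).imp (fun h1 => ?_) fun h1 => ?_
  · rw [← e, h1]; simp
  · rw [← e, h1]; simp

/-- A representation of a conjugate of the preimage of `Γ`, trivial on `-1`, which tells apart
`γ` from the elements of `P` by nilpotency of `ρ - 1`, gives a finite quotient separating them. -/
lemma exists_finite_quotient_of_proj {σ : SL2C} (hG : (conjSubgroup σ (lift Γ)).FG)
    {V : Type} [AddCommGroup V] [Module ℂ V] (ρ : conjSubgroup σ (lift Γ) →* Module.End ℂ V)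
    {U : Submodule ℂ V} (hU : U.FG) (hinv : ∀ g, ∀ x ∈ U, ρ g x ∈ U)
    (hneg : ∀ g : conjSubgroup σ (lift Γ), (g : SL2C) = -1 → ∀ x ∈ U, ρ g x = x) (k : ℕ)
    {g : conjSubgroup σ (lift Γ)} {x : V} (hx : x ∈ U) (hg : ((ρ g - 1) ^ k) x ≠ 0)
    {P : Subgroup Γ}
    (hP : ∀ p ∈ P, ∃ h, proj σ Γ h = p ∧ ∀ y ∈ U, ((ρ h - 1) ^ k) y = 0) :
    ∃ (F : Type) (_ : Group F) (_ : Finite F) (φ : Γ →* F),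
      ∀ p ∈ P, ¬IsConj (φ (proj σ Γ g)) (φ p) := by
  obtain ⟨F, _, hF, φ, hφ, hconj⟩ := exists_finite_quotient_of_rep
    ((Group.fg_iff_subgroup_fg _).2 hG) ρ hU hinv k hx hg
  have hker : (proj σ Γ).ker ≤ φ.ker := fun h hh => by
    refine hφ h fun y hy => ?_
    rcases eq_of_proj_eq_one hh with h1 | h1
    · rw [show h = 1 from Subtype.ext h1, map_one, Module.End.one_apply]
    · exact hneg h h1 y hy
  have hlift (h) : (proj σ Γ).liftOfSurjective (proj_surjective σ Γ) ⟨φ, hker⟩ (proj σ Γ h) = φ h :=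
    MonoidHom.liftOfRightInverse_comp_apply _ _ _ ⟨φ, hker⟩ h
  refine ⟨F, inferInstance, hF, (proj σ Γ).liftOfSurjective (proj_surjective σ Γ) ⟨φ, hker⟩,
    fun p hp => ?_⟩
  obtain ⟨h, rfl, hh⟩ := hP p hp
  rw [hlift, hlift]
  exact hconj h hh

lemma exists_unip_of_sq {g : SL2C} (h : discr g = 0) :
    ∃ v, (QuotientGroup.mk g : PSL2C) = QuotientGroup.mk (unip v) := by
  have h1 : ((⇡g).trace - 2) * ((⇡g).trace + 2) = 0 := by
    rw [discr] at h; linear_combination h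
  rcases mul_eq_zero.1 h1 with h1 | h1
  · obtain ⟨v, hv⟩ := exists_unip (sub_eq_zero.1 h1)
    exact ⟨v, by rw [hv]⟩
  · obtain ⟨v, hv⟩ := exists_unip (x := -g) (by rw [mat_neg, trace_neg]; linear_combination -h1)
    exact ⟨v, by rw [← hv, mk_neg]⟩

lemma trace_of_mk_eq_unip {g : SL2C} {v : Fin 2 → ℂ}
    (h : (QuotientGroup.mk g : PSL2C) = QuotientGroup.mk (unip v)) :
    (⇡g).trace = 2 ∨ (⇡g).trace = -2 := by
  refine (mk_eq_mk_iff.1 h).imp (fun h1 => ?_) fun h1 => ?_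
  · rw [h1, trace_unip]
  · rw [h1, mat_neg, trace_neg, trace_unip]

lemma exists_unip_of_isParabolic {x : PSL2C} (hx : x ≠ 1 → _root_.IsParabolic x) :
    ∃ v, x = QuotientGroup.mk (unip v) := by
  by_cases h1 : x = 1
  · exact ⟨0, by rw [h1, unip_zero]; rfl⟩
  · obtain ⟨-, A, rfl, hA⟩ := hx h1
    refine exists_unip_of_sq ?_
    change (⇡A).trace = 2 ∨ (⇡A).trace = -2 at hA
    rw [discr]
    rcases hA with hA | hA <;> rw [hA] <;> norm_num

lemma unip_smul_mul (a b : ℂ) (w : Fin 2 → ℂ) :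
    ∃ c : ℂ, unip (a • w) * unip (b • w) = unip (c • w) := by
  obtain ⟨c, hc⟩ := IsAlgClosed.exists_pow_nat_eq (a ^ 2 + b ^ 2) (n := 2) (by norm_num)
  refine ⟨c, mat_injective ?_⟩
  rw [mat_mul, unip_val, unip_val, unip_val, nilp_smul, nilp_smul, nilp_smul, hc, mul_add, mul_one,
    add_mul, one_mul, smul_mul_smul_comm, nilp_sq, smul_zero, add_zero, add_smul, add_assoc]

lemma unip_smul_inv (a : ℂ) (w : Fin 2 → ℂ) : (unip (a • w))⁻¹ = unip ((Complex.I * a) • w) := by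
  apply mat_injective
  rw [unip_inv, unip_val, nilp_smul, nilp_smul, mul_pow, Complex.I_sq, neg_one_mul, neg_smul,
    sub_eq_add_neg]

/-- The subgroup of the elements of `Γ` that lift to unipotents fixing `w`. -/
def unipSubgroup (Γ : Subgroup PSL2C) (w : Fin 2 → ℂ) : Subgroup Γ where
  carrier := {x | ∃ c : ℂ, (x : PSL2C) = QuotientGroup.mk (unip (c • w))}
  one_mem' := ⟨0, by rw [zero_smul, unip_zero]; rfl⟩
  mul_mem' := by
    rintro x y ⟨a, ha⟩ ⟨b, hb⟩
    obtain ⟨c, hc⟩ := unip_smul_mul a b w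
    exact ⟨c, by rw [← hc, Subgroup.coe_mul, ha, hb]; rfl⟩
  inv_mem' := by
    rintro x ⟨a, ha⟩
    exact ⟨Complex.I * a, by rw [← unip_smul_inv, Subgroup.coe_inv, ha]; rfl⟩

lemma isParabolic_of_mem_unipSubgroup {w : Fin 2 → ℂ} {x : Γ} (hx : x ∈ unipSubgroup Γ w)
    (h1 : x ≠ 1) : _root_.IsParabolic (x : PSL2C) := by
  obtain ⟨c, hc⟩ := hx
  exact ⟨fun h => h1 (Subtype.ext h), unip (c • w), hc.symm, Or.inl (trace_unip _)⟩

lemma trace_nilp_mul (v w : Fin 2 → ℂ) :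
    (nilp v * nilp w).trace = -(v 0 * w 1 - v 1 * w 0) ^ 2 := by
  simp [nilp, trace_fin_two]; ring

/-- Unipotents generating a group of unipotents, up to sign, have the same fixed line. -/
lemma parallel_of_unip_mul {v w a b : Fin 2 → ℂ} (hv : v ≠ 0)
    (ha : (QuotientGroup.mk (unip v * unip w) : PSL2C) = QuotientGroup.mk (unip a))
    (hb : (QuotientGroup.mk (unip v * unip w * unip w) : PSL2C) = QuotientGroup.mk (unip b)) :
    ∃ c : ℂ, w = c • v := by
  have h1 : (⇡(unip v * unip w)).trace = 2 + (nilp v * nilp w).trace := by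
    rw [mat_mul, unip_val, unip_val, mul_add, mul_one, add_mul, one_mul]
    simp only [trace_add, trace_nilp]; simp
  have h2 : (⇡(unip v * unip w * unip w)).trace = 2 + 2 * (nilp v * nilp w).trace := by
    rw [mul_assoc, mat_mul, mat_mul, unip_val, unip_val]
    have e : (1 + nilp w) * (1 + nilp w) = 1 + (nilp w + nilp w) := by
      rw [mul_add, mul_one, add_mul, one_mul, nilp_sq, add_zero, add_assoc]
    rw [e, mul_add, mul_add, mul_one, add_mul, one_mul]
    simp only [trace_add, trace_nilp]; simp; ring
  have h3 := trace_of_mk_eq_unip ha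
  have h4 := trace_of_mk_eq_unip hb
  rw [h1] at h3
  rw [h2] at h4
  have h5 : (nilp v * nilp w).trace = 0 := by
    rcases h3 with h3 | h3
    · linear_combination h3
    · have h6 : (nilp v * nilp w).trace = -4 := by linear_combination h3
      rw [h6] at h4
      norm_num at h4
  rw [trace_nilp_mul, neg_eq_zero, sq_eq_zero_iff, sub_eq_zero] at h5
  exact exists_smul_of_det hv h5

lemma eq_unipSubgroup {P : Subgroup Γ} (hP : IsMaxParabolicSubgroup Γ P) {w : Fin 2 → ℂ}
    (hw : w ≠ 0) {p : Γ} (hp : p ∈ P) (hpw : (p : PSL2C) = QuotientGroup.mk (unip w)) :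
    P = unipSubgroup Γ w := by
  have hu (q : Γ) (hq : q ∈ P) : ∃ v, (q : PSL2C) = QuotientGroup.mk (unip v) :=
    exists_unip_of_isParabolic fun h => hP.1 q hq fun h1 => h (by rw [h1]; rfl)
  refine (hP.2 _ (fun x => isParabolic_of_mem_unipSubgroup) fun q hq => ?_).symm
  obtain ⟨v, hv⟩ := hu q hq
  obtain ⟨a, ha⟩ := hu _ (mul_mem hp hq)
  obtain ⟨b, hb⟩ := hu _ (mul_mem (mul_mem hp hq) hq)
  rw [Subgroup.coe_mul, hpw, hv] at ha
  rw [Subgroup.coe_mul, Subgroup.coe_mul, hpw, hv] at hb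
  obtain ⟨c, rfl⟩ := parallel_of_unip_mul hw ha hb
  exact ⟨c, hv⟩

/-- If an element of the preimage of `Γ` carries the fixed line of an element of `P` to that of
`γ`, then `γ` is conjugate into `P`. -/
lemma exists_isConj_of_mulVec {P : Subgroup Γ} (hP : IsMaxParabolicSubgroup Γ P)
    {w : Fin 2 → ℂ} (hw : w ≠ 0) {p : Γ} (hp : p ∈ P)
    (hpw : (p : PSL2C) = QuotientGroup.mk (unip w)) {v : Fin 2 → ℂ} {γ : Γ}
    (hγ : (γ : PSL2C) = QuotientGroup.mk (unip v)) {g : SL2C} (hg : g ∈ lift Γ) {c : ℂ}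
    (h : ⇡g *ᵥ w = c • v) : ∃ q ∈ P, IsConj γ q := by
  have hc : c ≠ 0 := by
    rintro rfl
    exact mulVec_ne_zero g hw (by rw [h, zero_smul])
  have h1 : ⇡g⁻¹ *ᵥ v = c⁻¹ • w := by
    rw [← inv_mulVec_mulVec g w, h, mulVec_smul, smul_smul, inv_mul_cancel₀ hc, one_smul]
  let g' : Γ := ⟨QuotientGroup.mk g, hg⟩
  refine ⟨g'⁻¹ * γ * g', ?_, isConj_iff.2 ⟨g'⁻¹, by rw [inv_inv]⟩⟩
  rw [eq_unipSubgroup hP hw hp hpw]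
  refine ⟨c⁻¹, ?_⟩
  rw [← h1, ← conj_unip', Subgroup.coe_mul, Subgroup.coe_mul, hγ]
  rfl

lemma unip_e1 : unip ![1, 0] = shear 1 := by
  apply mat_injective
  rw [unip_val, mat_shear]
  ext i j
  fin_cases i <;> fin_cases j <;> simp [nilp]

end SL2C

open SL2C

/-- Let `Γ` be a torsion-free discrete subgroup of `PSL(2, ℂ)` of finite covolume and
let `P` be a maximal parabolic subgroup of `Γ`.  Then `P` is conjugacy distinguished in
`Γ`: whenever `γ ∈ Γ` is not conjugate in `Γ` to any element of `P`, there is a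
homomorphism `φ` from `Γ` to a finite group such that `φ γ` is not conjugate to any
element of `φ '' P`. -/
theorem maximal_parabolic_conjugacy_distinguished
    (Γ : Subgroup PSL2C) (hdisc : DiscreteTopology ↥Γ) (hvol : HasFiniteCovolume Γ)
    (htf : ∀ x : ↥Γ, IsOfFinOrder x → x = 1)
    (P : Subgroup ↥Γ) (hP : IsMaxParabolicSubgroup Γ P)
    (γ : ↥Γ) (hγ : ∀ p ∈ P, ¬IsConj γ p) :
    ∃ (F : Type) (_ : Group F) (_ : Finite F) (φ : ↥Γ →* F),
      ∀ p ∈ P, ¬IsConj (φ γ) (φ p) := by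
  have hgood := good_lift hdisc hvol htf
  have hunip (p : Γ) (hp : p ∈ P) : ∃ w, (p : PSL2C) = QuotientGroup.mk (unip w) :=
    exists_unip_of_isParabolic fun h => hP.1 p hp fun h1 => h (by rw [h1]; rfl)
  by_cases hex : ∃ v, (γ : PSL2C) = QuotientGroup.mk (unip v)
  · obtain ⟨v, hv⟩ := hex
    have hv0 : v ≠ 0 := by
      rintro rfl
      refine hγ 1 (one_mem P) ?_
      rw [show γ = 1 from Subtype.ext (by rw [hv, unip_zero]; rfl)]
    set σ := frame v hv0
    have hH := hgood.conj σ
    have hσ : ⇡σ⁻¹ *ᵥ v = ![1, 0] := frame_inv_e1 v hv0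
    have hproj (u : Fin 2 → ℂ) (x : Γ) (hx : (x : PSL2C) = QuotientGroup.mk (unip u)) :
        ∃ h, proj σ Γ h = x ∧ (h : SL2C) = unip (⇡σ⁻¹ *ᵥ u) := by
      have e : σ * unip (⇡σ⁻¹ *ᵥ u) * σ⁻¹ = unip u := by rw [conj_unip, mulVec_inv_mulVec]
      refine ⟨⟨unip (⇡σ⁻¹ *ᵥ u), ?_⟩, Subtype.ext ?_, rfl⟩
      · rw [mem_conjSubgroup, e, mem_lift, ← hx]
        exact x.2
      · change (QuotientGroup.mk (σ * unip (⇡σ⁻¹ *ᵥ u) * σ⁻¹) : PSL2C) = x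
        rw [e, hx]
    obtain ⟨g, hg, hgv⟩ := hproj v γ hv
    rw [hσ, unip_e1] at hgv
    have h₀ : shear 1 ∈ conjSubgroup σ (lift Γ) := hgv ▸ g.2
    obtain ⟨n, hn, hodd⟩ : ∃ n : ℕ, 36 ≤ n ∧ Odd n := ⟨37, by norm_num, by decide⟩
    rw [← hg]
    refine exists_finite_quotient_of_proj hH.fg' (hH.affineRep one_ne_zero h₀ hn)
      (affineForms_fg n) (fun g x hx => hH.affineRep_mem one_ne_zero h₀ hn g hx)
      (fun h hh x hx => hH.affineRep_neg_one one_ne_zero h₀ hn hodd hh hx) (n - 1 + 1)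
      (x := (0, 1)) ⟨zero_mem _, trivial⟩ (hH.affineRep_shear one_ne_zero h₀ hn hodd hgv)
      fun p hp => ?_
    obtain ⟨w, hw⟩ := hunip p hp
    by_cases hw0 : w = 0
    · refine ⟨1, ?_, fun y _ => ?_⟩
      · rw [map_one]
        exact (Subtype.ext (by rw [hw, hw0, unip_zero]; rfl))
      · rw [map_one, sub_self, zero_pow (by norm_num), LinearMap.zero_apply]
    obtain ⟨h, hh, hhw⟩ := hproj w p hw
    refine ⟨h, hh, fun y hy => hH.affineRep_unip one_ne_zero h₀ hn hhw (fun k hk h0 => ?_) hy⟩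
    have h1 : ⇡k *ᵥ (⇡σ⁻¹ *ᵥ w) = (⇡k *ᵥ (⇡σ⁻¹ *ᵥ w)) 0 • ![1, 0] := by
      ext i
      fin_cases i
      · simp
      · simpa using h0
    obtain ⟨q, hq, hc⟩ := exists_isConj_of_mulVec hP hw0 hp hw hv (mem_conjSubgroup.1 hk)
      (c := (⇡k *ᵥ (⇡σ⁻¹ *ᵥ w)) 0) (by
        rw [mat_mul, mat_mul, ← mulVec_mulVec, ← mulVec_mulVec, h1, mulVec_smul, frame_e1]
        simp)
    exact hγ q hq hc
  · obtain ⟨g, rfl⟩ := proj_surjective 1 Γ γ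
    have hd : discr (g : SL2C) ≠ 0 := fun h0 => hex (by
      obtain ⟨v, hv⟩ := exists_unip_of_sq h0
      exact ⟨v, by rw [← hv]; change (QuotientGroup.mk (1 * (g : SL2C) * 1⁻¹) : PSL2C) = _; simp⟩)
    obtain ⟨M, hM⟩ := adRep_of_discr hd
    refine exists_finite_quotient_of_proj (hgood.conj 1).fg'
      (adRep.comp (conjSubgroup 1 (lift Γ)).subtype) Module.Finite.fg_top
      (fun _ _ _ => trivial) (fun h hh x _ => ?_) 3 (x := M) trivial hM fun p hp => ?_
    · change adRep (h : SL2C) x = x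
      rw [hh, adRep_neg_one]
    · obtain ⟨w, hw⟩ := hunip p hp
      have e : 1 * unip w * 1⁻¹ = unip w := by simp
      refine ⟨⟨unip w, ?_⟩, Subtype.ext ?_, fun y _ => adRep_unip w y⟩
      · rw [mem_conjSubgroup, e, mem_lift, ← hw]
        exact p.2
      · change (QuotientGroup.mk (1 * unip w * 1⁻¹) : PSL2C) = p
        rw [e, hw]
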